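/- arXiv:2510.15008 — 2 statements merged into one kernel-verified Lean document; each statement's English description precedes it below -/
import Mathlib

section
/- The Apéry-like series of weight 5 evaluates as: ∑_{k=1}^∞ 4^k H_k^{(3)} / (k^2 · C(2k,k)) = (217/8)ζ(5) − (9/2)ζ(2)ζ(3) − 16 Li_5(1/2) − (19/2) ln(2) ζ(4) + (8/3) ln^3(2) ζ(2) + (2/15) ln^5(2). -/
open Real

/-- Riemann zeta value at a positive integer `m > 1`, as the series `∑ 1/n^m`. -/
noncomputable def zetaVal (m : ℕ) : ℝ := ∑' n : ℕ, 1 / (n + 1 : ℝ) ^ m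

/-- Polylogarithm `Li_m(z) = ∑_{k≥1} z^k / k^m`. -/
noncomputable def polyLog (m : ℕ) (z : ℝ) : ℝ := ∑' k : ℕ, z ^ (k + 1) / (k + 1 : ℝ) ^ m

/-- Generalized harmonic number `H_k^{(m)} = ∑_{n=1}^k 1/n^m`. -/
noncomputable def genHarmonic (k m : ℕ) : ℝ := ∑ n ∈ Finset.range k, 1 / (n + 1 : ℝ) ^ m


open Set Filter Topology MeasureTheory

theorem ap_hs {f g : ℕ → ℝ} {a b : ℝ} (h : HasSum f a) (hfg : ∀ k, g k = f k) (hab : b = a) :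
    HasSum g b := by
  rw [hab, funext hfg]; exact h

theorem ap_gammaInt (m : ℕ) (r : ℝ) (hr : 0 < r) :
    ∫ u in Ioi (0:ℝ), u ^ m * Real.exp (-(r * u)) = (m.factorial : ℝ) / r ^ (m+1) := by
  have h := Real.integral_rpow_mul_exp_neg_mul_Ioi (a := (m:ℝ)+1) (r := r) (by positivity) hr
  simp only [add_sub_cancel_right, Real.rpow_natCast] at h
  rw [h, Real.Gamma_nat_eq_factorial]
  rw [show ((m:ℝ)+1) = ((m+1 : ℕ) : ℝ) by push_cast; ring, Real.rpow_natCast, one_div, inv_pow]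
  field_simp

theorem ap_gammaIntegrable (m : ℕ) (r : ℝ) (hr : 0 < r) :
    IntegrableOn (fun u => u ^ m * Real.exp (-(r * u))) (Ioi (0:ℝ)) := by
  by_contra hc
  have h := ap_gammaInt m r hr
  rw [integral_undef hc] at h
  have : 0 < (m.factorial : ℝ) / r ^ (m+1) := by positivity
  linarith

theorem ap_zetaSummable (m : ℕ) (hm : 2 ≤ m) : Summable (fun k : ℕ => 1 / ((k:ℝ)+1) ^ m) := by
  have := (summable_nat_add_iff 1).2 (Real.summable_one_div_nat_pow.2 (show 1 < m by omega))
  simpa using this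

theorem ap_lap (c : ℕ → ℝ) (f : ℝ → ℝ) (lam : ℝ) (hl : 0 < lam) (m : ℕ) (hm : 1 ≤ m)
    (hc : ∀ k, 0 < c k) (hc1 : ∀ k, c k ≤ 1)
    (hf : ∀ u > 0, HasSum (fun k : ℕ => c k * Real.exp (-(lam * (k+1) * u))) (f u)) :
    IntegrableOn (fun u => u ^ m * f u) (Ioi 0) ∧
    HasSum (fun k : ℕ => c k * ((m.factorial : ℝ) / (lam * (k+1)) ^ (m+1)))
      (∫ u in Ioi (0:ℝ), u ^ m * f u) := by
  have hint : ∀ k : ℕ, IntegrableOn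
      (fun u => c k * (u ^ m * Real.exp (-(lam * (k+1) * u)))) (Ioi (0:ℝ)) := by
    intro k
    exact (ap_gammaIntegrable m (lam * (k+1)) (by positivity)).const_mul (c k)
  have hval : ∀ k : ℕ, ∫ u in Ioi (0:ℝ), c k * (u ^ m * Real.exp (-(lam * (k+1) * u)))
      = c k * ((m.factorial : ℝ) / (lam * (k+1)) ^ (m+1)) := by
    intro k
    rw [integral_const_mul, ap_gammaInt m (lam * (k+1)) (by positivity)]
  have hnorm : ∀ k : ℕ, ∫ u in Ioi (0:ℝ), ‖c k * (u ^ m * Real.exp (-(lam * (k+1) * u)))‖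
      = c k * ((m.factorial : ℝ) / (lam * (k+1)) ^ (m+1)) := by
    intro k
    rw [← hval k]
    refine setIntegral_congr_fun measurableSet_Ioi fun u hu => ?_
    have h1 := hc k
    have h2 : 0 < u := hu
    exact Real.norm_of_nonneg (by positivity)
  have hs : Summable (fun k : ℕ => c k * ((m.factorial : ℝ) / (lam * (k+1)) ^ (m+1))) := by
    refine Summable.of_nonneg_of_le (fun k => by have := hc k; positivity) (fun k => ?_)
      ((ap_zetaSummable (m+1) (by omega)).mul_left ((m.factorial : ℝ) / lam ^ (m+1)))
    have : (m.factorial : ℝ) / lam ^ (m+1) * (1 / ((k:ℝ)+1) ^ (m+1))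
      = 1 * ((m.factorial : ℝ) / (lam * (k+1)) ^ (m+1)) := by
      rw [mul_pow]; field_simp
    rw [this]
    exact mul_le_mul_of_nonneg_right (hc1 k) (by positivity)
  have key := hasSum_integral_of_summable_integral_norm (μ := volume.restrict (Ioi (0:ℝ)))
    (F := fun (k : ℕ) u => c k * (u ^ m * Real.exp (-(lam * (k+1) * u)))) hint
    (by simp only [hnorm]; exact hs)
  simp only [hval] at key
  have heq : ∫ u in Ioi (0:ℝ), (∑' k : ℕ, c k * (u ^ m * Real.exp (-(lam * (k+1) * u))))
      = ∫ u in Ioi (0:ℝ), u ^ m * f u := by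
    refine setIntegral_congr_fun measurableSet_Ioi fun u hu => ?_
    have h3 := (hf u hu).mul_left (u ^ m)
    refine HasSum.tsum_eq ?_
    exact ap_hs h3 (fun k => by ring) rfl
  rw [heq] at key
  refine ⟨?_, key⟩
  by_contra hcon
  rw [integral_undef hcon] at key
  have h0 := key.tsum_eq
  have := hs.tsum_pos (fun k => by have := hc k; positivity) 0 (by have := hc 0; positivity)
  linarith

/-- integrals `u^m/(e^u-1)`. -/
theorem ap_bose (m : ℕ) (hm : 1 ≤ m) :
    IntegrableOn (fun u => u ^ m * (1 / (Real.exp u - 1))) (Ioi 0) ∧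
    ∫ u in Ioi (0:ℝ), u ^ m * (1 / (Real.exp u - 1)) = (m.factorial : ℝ) * zetaVal (m+1) := by
  have h := ap_lap (fun _ => 1) (fun u => 1 / (Real.exp u - 1)) 1 one_pos m hm (by simp) (by simp)
    (by
      intro u hu
      have h1 : Real.exp (-u) < 1 := by simpa using hu
      have h2 := (hasSum_geometric_of_lt_one (Real.exp_pos (-u)).le h1).mul_left (Real.exp (-u))
      have h3 : Real.exp u ≠ 1 := by simpa using hu.ne'
      refine ap_hs h2 (fun k => ?_) ?_
      · rw [← Real.exp_nat_mul, ← Real.exp_add]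
        simp only [one_mul]; congr 1; ring
      · rw [Real.exp_neg]
        have : Real.exp u - 1 ≠ 0 := sub_ne_zero.2 h3
        field_simp)
  refine ⟨h.1, ?_⟩
  rw [← h.2.tsum_eq, zetaVal, ← tsum_mul_left]
  congr 1; ext k; simp; ring

theorem ap_fermi :
    IntegrableOn (fun u => u ^ 4 * (1 / (2 * Real.exp u - 1))) (Ioi 0) ∧
    ∫ u in Ioi (0:ℝ), u ^ 4 * (1 / (2 * Real.exp u - 1)) = 24 * polyLog 5 (1/2) := by
  have h := ap_lap (fun k => (1/2)^(k+1)) (fun u => 1 / (2 * Real.exp u - 1)) 1 one_pos 4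
    (by norm_num) (fun k => by positivity) (fun k => pow_le_one₀ (by norm_num) (by norm_num))
    (by
      intro u hu
      have h1 : Real.exp (-u) < 1 := by simpa using hu
      have h0 := Real.exp_pos (-u)
      have h2 := (hasSum_geometric_of_lt_one (r := Real.exp (-u) / 2) (by positivity) (by linarith)).mul_left
        (Real.exp (-u)/2)
      have h3 : 1 < Real.exp u := by simpa using hu
      refine ap_hs h2 (fun k => ?_) ?_
      · rw [div_pow (Real.exp (-u)), ← Real.exp_nat_mul]
        have : Real.exp (-(1 * ((k:ℝ)+1) * u)) = Real.exp (-u) * Real.exp (k * -u) := by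
          rw [← Real.exp_add]; congr 1; ring
        rw [this, one_div, inv_pow]; field_simp; ring
      · rw [Real.exp_neg]
        have : 2 * Real.exp u - 1 ≠ 0 := by intro hh; linarith
        field_simp)
  refine ⟨h.1, ?_⟩
  rw [← h.2.tsum_eq, polyLog, ← tsum_mul_left]
  congr 1; ext k; simp [Nat.factorial]; ring

theorem ap_logint (lam : ℝ) (hl : 0 < lam) (m : ℕ) (hm : 1 ≤ m) :
    IntegrableOn (fun u => u ^ m * Real.log (1 - Real.exp (-(lam * u)))) (Ioi 0) ∧
    ∫ u in Ioi (0:ℝ), u ^ m * Real.log (1 - Real.exp (-(lam * u)))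
      = -((m.factorial : ℝ) / lam ^ (m+1) * zetaVal (m+2)) := by
  have h := ap_lap (fun k => 1 / ((k:ℝ)+1)) (fun u => - Real.log (1 - Real.exp (-(lam * u)))) lam hl m
    hm (fun k => by positivity) (fun k => by
      rw [div_le_one (by positivity)]; have : (0:ℝ) ≤ k := by positivity
      linarith)
    (by
      intro u hu
      have h1 : Real.exp (-(lam * u)) < 1 := by
        rw [Real.exp_lt_one_iff]; have := mul_pos hl hu; linarith
      have h2 := Real.hasSum_pow_div_log_of_abs_lt_one (x := Real.exp (-(lam * u)))
        (by rw [abs_of_pos (Real.exp_pos _)]; exact h1)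
      refine ap_hs h2 (fun k => ?_) rfl
      rw [← Real.exp_nat_mul]
      have : -(lam * ((k:ℝ)+1) * u) = ((k+1 : ℕ) : ℝ) * -(lam * u) := by push_cast; ring
      rw [this]; ring)
  have e : ∀ u : ℝ, u ^ m * -Real.log (1 - Real.exp (-(lam * u)))
    = -(u ^ m * Real.log (1 - Real.exp (-(lam * u)))) := fun u => by ring
  simp only [e] at h
  refine ⟨by simpa using h.1.neg, ?_⟩
  rw [← neg_eq_iff_eq_neg, ← integral_neg, ← h.2.tsum_eq, zetaVal, ← tsum_mul_left]
  congr 1; ext k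
  rw [mul_pow]; field_simp; ring

theorem ap_cov (f f' : ℝ → ℝ) (s : Set ℝ) (hs : MeasurableSet s) (himg : f '' s = Ioi 0)
    (hf : ∀ x ∈ s, HasDerivAt f (f' x) x) (hinj : InjOn f s) (g G : ℝ → ℝ)
    (hG : ∀ x ∈ s, |f' x| * g (f x) = G x) :
    (IntegrableOn G s → IntegrableOn g (Ioi 0)) ∧ ∫ x in Ioi (0:ℝ), g x = ∫ x in s, G x := by
  constructor
  · intro h
    rw [← himg, integrableOn_image_iff_integrableOn_abs_deriv_smul hs
      (fun x hx => (hf x hx).hasDerivWithinAt) hinj g]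
    exact h.congr_fun (fun x hx => (hG x hx).symm) hs
  · rw [← himg, integral_image_eq_integral_abs_deriv_smul hs
      (fun x hx => (hf x hx).hasDerivWithinAt) hinj g]
    exact setIntegral_congr_fun hs hG

/-- the `1-x` side -/
theorem ap_sideA :
    IntegrableOn (fun t => (Real.log (1 - Real.exp (-(2*t))) - Real.log 2)^4 - (Real.log 2)^4)
      (Ioi 0) ∧
    ∫ t in Ioi (0:ℝ), ((Real.log (1 - Real.exp (-(2*t))) - Real.log 2)^4 - (Real.log 2)^4)
     = ∫ u in Ioi (0:ℝ), (1/2) * (4 * (Real.log 2)^3 * (u^1 * (1 / (Real.exp u - 1)))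
        + 6 * (Real.log 2)^2 * (u^2 * (1 / (Real.exp u - 1)))
        + 4 * (Real.log 2) * (u^3 * (1 / (Real.exp u - 1)))
        + u^4 * (1 / (Real.exp u - 1))) := by
  have hpos : ∀ u : ℝ, 0 < u → 0 < 1 - Real.exp (-u) ∧ 1 - Real.exp (-u) < 1 := by
    intro u hu
    have : Real.exp (-u) < 1 := by simpa using hu
    have := Real.exp_pos (-u)
    constructor <;> linarith
  have h := ap_cov (fun u => -(1/2) * Real.log (1 - Real.exp (-u)))
    (fun u => -(1/2) * (Real.exp (-u) / (1 - Real.exp (-u)))) (Ioi 0) measurableSet_Ioi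
    (by
      ext t
      simp only [mem_image, mem_Ioi]
      constructor
      · rintro ⟨u, hu, rfl⟩
        have := hpos u hu
        have := Real.log_neg this.1 this.2
        linarith
      · intro ht
        have h2 := hpos (2*t) (by linarith)
        refine ⟨-Real.log (1 - Real.exp (-(2*t))), ?_, ?_⟩
        · have := Real.log_neg h2.1 h2.2; linarith
        · rw [neg_neg, Real.exp_log h2.1, sub_sub_cancel, Real.log_exp]; ring)
    (by
      intro u hu
      have := hpos u hu
      have h1 : HasDerivAt (fun u : ℝ => 1 - Real.exp (-u)) (Real.exp (-u)) u := by
        have := ((hasDerivAt_neg u).exp).const_sub 1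
        simpa using this
      exact (h1.log this.1.ne').const_mul (-(1/2)))
    (by
      intro u hu v hv huv
      have h1 := hpos u hu
      have h2 := hpos v hv
      have h3 : Real.log (1 - Real.exp (-u)) = Real.log (1 - Real.exp (-v)) := by
        have : -(1/2) * Real.log (1 - Real.exp (-u)) = -(1/2) * Real.log (1 - Real.exp (-v)) := huv
        linarith
      have h4 := Real.log_injOn_pos h1.1 h2.1 h3
      have h5 : Real.exp (-u) = Real.exp (-v) := by linarith
      have := Real.exp_injective h5
      linarith)
    (fun t => (Real.log (1 - Real.exp (-(2*t))) - Real.log 2)^4 - (Real.log 2)^4)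
    (fun u => (1/2) * (4 * (Real.log 2)^3 * (u^1 * (1 / (Real.exp u - 1)))
        + 6 * (Real.log 2)^2 * (u^2 * (1 / (Real.exp u - 1)))
        + 4 * (Real.log 2) * (u^3 * (1 / (Real.exp u - 1)))
        + u^4 * (1 / (Real.exp u - 1))))
    (by
      intro u hu
      have h1 := hpos u hu
      have h2 : Real.exp (-u) / (1 - Real.exp (-u)) = 1 / (Real.exp u - 1) := by
        have : 1 < Real.exp u := by simpa using hu
        have : Real.exp u - 1 ≠ 0 := by intro hh; linarith
        rw [Real.exp_neg]
        field_simp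
      have h3 : -(2 * (-(1/2) * Real.log (1 - Real.exp (-u)))) = Real.log (1 - Real.exp (-u)) := by ring
      have h4 : 0 < Real.exp (-u) / (1 - Real.exp (-u)) := div_pos (Real.exp_pos _) h1.1
      rw [h3, Real.exp_log h1.1, sub_sub_cancel, Real.log_exp, abs_of_neg (by linarith), h2]
      ring)
  refine ⟨h.1 ?_, h.2⟩
  exact ((((ap_bose 1 (by norm_num)).1.const_mul _).add ((ap_bose 2 (by norm_num)).1.const_mul _)).add
    ((ap_bose 3 (by norm_num)).1.const_mul _) |>.add (ap_bose 4 (by norm_num)).1).const_mul (1/2)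

/-- the `1+x` side -/
theorem ap_sideB :
    IntegrableOn (fun t => (Real.log (1 + Real.exp (-(2*t))) - Real.log 2)^4 - (Real.log 2)^4)
      (Ioi 0) ∧
    ∫ t in Ioi (0:ℝ), ((Real.log (1 + Real.exp (-(2*t))) - Real.log 2)^4 - (Real.log 2)^4)
     = ∫ u in Ioo (0:ℝ) (Real.log 2), (1/2) * (((u - Real.log 2)^4 - (Real.log 2)^4) +
        (-4 * (Real.log 2)^3 * (u^1 * (1 / (Real.exp u - 1)))
        + 6 * (Real.log 2)^2 * (u^2 * (1 / (Real.exp u - 1)))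
        + -4 * (Real.log 2) * (u^3 * (1 / (Real.exp u - 1)))
        + u^4 * (1 / (Real.exp u - 1)))) := by
  have hpos : ∀ u ∈ Ioo (0:ℝ) (Real.log 2), 0 < Real.exp u - 1 ∧ Real.exp u - 1 < 1 := by
    intro u hu
    have h1 : 1 < Real.exp u := by simpa using hu.1
    have h2 := Real.exp_lt_exp.2 hu.2
    rw [Real.exp_log two_pos] at h2
    constructor <;> linarith
  have h := ap_cov (fun u => -(1/2) * Real.log (Real.exp u - 1))
    (fun u => -(1/2) * (Real.exp u / (Real.exp u - 1))) (Ioo 0 (Real.log 2)) measurableSet_Ioo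
    (by
      ext t
      simp only [mem_image, mem_Ioi]
      constructor
      · rintro ⟨u, hu, rfl⟩
        have := hpos u hu
        have := Real.log_neg this.1 this.2
        linarith
      · intro ht
        have h1 : Real.exp (-(2*t)) < 1 := by rw [Real.exp_lt_one_iff]; linarith
        have h0 := Real.exp_pos (-(2*t))
        refine ⟨Real.log (1 + Real.exp (-(2*t))), ⟨Real.log_pos (by linarith),
          Real.log_lt_log (by linarith) (by linarith)⟩, ?_⟩
        rw [Real.exp_log (by linarith), add_sub_cancel_left, Real.log_exp]; ring)
    (by
      intro u hu
      have := hpos u hu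
      exact (((Real.hasDerivAt_exp u).sub_const 1).log this.1.ne').const_mul (-(1/2)))
    (by
      intro u hu v hv huv
      have h1 := hpos u hu
      have h2 := hpos v hv
      have h3 : Real.log (Real.exp u - 1) = Real.log (Real.exp v - 1) := by
        have : -(1/2) * Real.log (Real.exp u - 1) = -(1/2) * Real.log (Real.exp v - 1) := huv
        linarith
      have h4 := Real.log_injOn_pos h1.1 h2.1 h3
      have h5 : Real.exp u = Real.exp v := by linarith
      exact Real.exp_injective h5)
    (fun t => (Real.log (1 + Real.exp (-(2*t))) - Real.log 2)^4 - (Real.log 2)^4)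
    (fun u => (1/2) * (((u - Real.log 2)^4 - (Real.log 2)^4) +
        (-4 * (Real.log 2)^3 * (u^1 * (1 / (Real.exp u - 1)))
        + 6 * (Real.log 2)^2 * (u^2 * (1 / (Real.exp u - 1)))
        + -4 * (Real.log 2) * (u^3 * (1 / (Real.exp u - 1)))
        + u^4 * (1 / (Real.exp u - 1)))))
    (by
      intro u hu
      have h1 := hpos u hu
      have h2 : Real.exp u / (Real.exp u - 1) = 1 + 1 / (Real.exp u - 1) := by
        have := h1.1.ne'
        field_simp; ring
      have h3 : -(2 * (-(1/2) * Real.log (Real.exp u - 1))) = Real.log (Real.exp u - 1) := by ring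
      have h4 : 0 < Real.exp u / (Real.exp u - 1) := div_pos (Real.exp_pos _) h1.1
      rw [h3, Real.exp_log h1.1, add_sub_cancel, Real.log_exp, abs_of_neg (by linarith), h2]
      ring)
  refine ⟨h.1 ?_, h.2⟩
  have hb := ((((ap_bose 1 (by norm_num)).1.const_mul (-4 * (Real.log 2)^3)).add
    ((ap_bose 2 (by norm_num)).1.const_mul (6 * (Real.log 2)^2))).add
    ((ap_bose 3 (by norm_num)).1.const_mul (-4 * Real.log 2)) |>.add (ap_bose 4 (by norm_num)).1)
  have hc : IntegrableOn (fun u : ℝ => (u - Real.log 2)^4 - (Real.log 2)^4) (Ioo 0 (Real.log 2)) := by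
    refine IntegrableOn.mono_set ?_ Ioo_subset_Icc_self
    exact (Continuous.continuousOn (by fun_prop)).integrableOn_Icc
  exact (hc.add (IntegrableOn.mono_set hb Ioo_subset_Ioi_self)).const_mul (1/2)

theorem ap_tail1 : IntegrableOn (fun u => 1 / (Real.exp u - 1)) (Ioi (Real.log 2)) ∧
    ∫ u in Ioi (Real.log 2), 1 / (Real.exp u - 1) = Real.log 2 := by
  have hl : 0 < Real.log 2 := Real.log_pos (by norm_num)
  have hd : ∀ u ∈ Ici (Real.log 2),
      HasDerivAt (fun u => Real.log (1 - Real.exp (-u))) (1 / (Real.exp u - 1)) u := by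
    intro u hu
    have hu0 : 0 < u := lt_of_lt_of_le hl hu
    have h1 : Real.exp (-u) < 1 := by simpa using hu0
    have h2 : 1 < Real.exp u := by simpa using hu0
    have h3 : HasDerivAt (fun u : ℝ => 1 - Real.exp (-u)) (Real.exp (-u)) u := by
      have := ((hasDerivAt_neg u).exp).const_sub 1
      simpa using this
    have h4 := h3.log (by linarith)
    have h5 : Real.exp (-u) / (1 - Real.exp (-u)) = 1 / (Real.exp u - 1) := by
      have : Real.exp u - 1 ≠ 0 := by intro hh; linarith
      rw [Real.exp_neg]
      field_simp
    rwa [h5] at h4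
  have hlim : Tendsto (fun u => Real.log (1 - Real.exp (-u))) atTop (𝓝 0) := by
    have h1 : Tendsto (fun u : ℝ => 1 - Real.exp (-u)) atTop (𝓝 (1 - 0)) :=
      (Real.tendsto_exp_neg_atTop_nhds_zero).const_sub 1
    have h2 := h1.log (by norm_num)
    simpa using h2
  have hnn : ∀ u ∈ Ioi (Real.log 2), 0 ≤ 1 / (Real.exp u - 1) := by
    intro u hu
    have : 1 < Real.exp u := by simpa using (lt_trans hl hu)
    exact (div_pos one_pos (by linarith)).le
  refine ⟨integrableOn_Ioi_deriv_of_nonneg' hd hnn hlim, ?_⟩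
  rw [integral_Ioi_of_hasDerivAt_of_nonneg' hd hnn hlim, Real.exp_neg, Real.exp_log two_pos,
    show (1 - (2:ℝ)⁻¹) = 2⁻¹ by norm_num, Real.log_inv]
  ring

theorem ap_tail4 : IntegrableOn (fun u => (u - Real.log 2)^4 * (1 / (Real.exp u - 1))) (Ioi (Real.log 2)) ∧
    ∫ u in Ioi (Real.log 2), (u - Real.log 2)^4 * (1 / (Real.exp u - 1)) = 24 * polyLog 5 (1/2) := by
  have himg : (fun s : ℝ => s + Real.log 2) '' Ioi 0 = Ioi (Real.log 2) := by
    simp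
  have hd : ∀ x ∈ Ioi (0:ℝ), HasDerivWithinAt (fun s : ℝ => s + Real.log 2) 1 (Ioi 0) x :=
    fun x _ => ((hasDerivAt_id x).add_const _).hasDerivWithinAt
  have hinj : InjOn (fun s : ℝ => s + Real.log 2) (Ioi 0) := fun x _ y _ h => by simpa using h
  have hG : ∀ x ∈ Ioi (0:ℝ), x^4 * (1 / (2 * Real.exp x - 1)) =
      |(1:ℝ)| • ((x + Real.log 2 - Real.log 2)^4 * (1 / (Real.exp (x + Real.log 2) - 1))) := by
    intro x _
    rw [Real.exp_add, Real.exp_log two_pos, add_sub_cancel_right]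
    simp [mul_comm]
  constructor
  · rw [← himg, integrableOn_image_iff_integrableOn_abs_deriv_smul measurableSet_Ioi hd hinj]
    exact ap_fermi.1.congr_fun hG measurableSet_Ioi
  · rw [← himg, integral_image_eq_integral_abs_deriv_smul measurableSet_Ioi hd hinj, ← ap_fermi.2]
    exact (setIntegral_congr_fun measurableSet_Ioi hG).symm

theorem ap_sides :
    (∫ t in Ioi (0:ℝ), ((Real.log (1 + Real.exp (-(2*t))) - Real.log 2)^4 - (Real.log 2)^4))
    - (∫ t in Ioi (0:ℝ), ((Real.log (1 - Real.exp (-(2*t))) - Real.log 2)^4 - (Real.log 2)^4))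
    = (Real.log 2)^5 / 10 - 4 * (Real.log 2)^3 * zetaVal 2 - 24 * Real.log 2 * zetaVal 4
      - 12 * polyLog 5 (1/2) := by
  have hl : 0 < Real.log 2 := Real.log_pos (by norm_num)
  rw [ap_sideA.2, ap_sideB.2, integral_const_mul, integral_const_mul]
  set L := Real.log 2 with hL
  have b1 := ap_bose 1 (by norm_num)
  have b2 := ap_bose 2 (by norm_num)
  have b3 := ap_bose 3 (by norm_num)
  have b4 := ap_bose 4 (by norm_num)
  set Q : ℝ → ℝ := fun u => (-4 * L^3 * (u^1 * (1 / (Real.exp u - 1)))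
        + 6 * L^2 * (u^2 * (1 / (Real.exp u - 1)))
        + -4 * L * (u^3 * (1 / (Real.exp u - 1)))
        + u^4 * (1 / (Real.exp u - 1))) with hQ
  have hQi : IntegrableOn Q (Ioi 0) := (((b1.1.const_mul (-4 * L^3)).add
    (b2.1.const_mul (6 * L^2))).add (b3.1.const_mul (-4 * L)) |>.add b4.1)
  set Q' : ℝ → ℝ := fun u => (4 * L^3 * (u^1 * (1 / (Real.exp u - 1)))
        + 6 * L^2 * (u^2 * (1 / (Real.exp u - 1)))
        + 4 * L * (u^3 * (1 / (Real.exp u - 1)))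
        + u^4 * (1 / (Real.exp u - 1))) with hQ'
  have hQi' : IntegrableOn Q' (Ioi 0) := (((b1.1.const_mul (4 * L^3)).add
    (b2.1.const_mul (6 * L^2))).add (b3.1.const_mul (4 * L)) |>.add b4.1)
  have hc : IntegrableOn (fun u : ℝ => (u - L)^4 - L^4) (Ioo 0 L) := by
    refine IntegrableOn.mono_set ?_ Ioo_subset_Icc_self
    exact (Continuous.continuousOn (by fun_prop)).integrableOn_Icc
  have hcv : ∫ u in Ioo 0 L, ((u - L)^4 - L^4) = L^5/5 - L^5 := by
    rw [← integral_Ioc_eq_integral_Ioo, ← intervalIntegral.integral_of_le hl.le,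
      intervalIntegral.integral_sub (Continuous.intervalIntegrable (by fun_prop) _ _)
        (Continuous.intervalIntegrable (by fun_prop) _ _),
      intervalIntegral.integral_comp_sub_right (fun x => x^4), integral_pow]
    simp; ring
  have hsum : ∫ u in Ioo 0 L, ((u - L)^4 - L^4 + Q u) = (L^5/5 - L^5) + ∫ u in Ioo 0 L, Q u := by
    rw [integral_add hc (hQi.mono_set Ioo_subset_Ioi_self), hcv]
  have hsplit : ∫ u in Ioi 0, Q u = (∫ u in Ioo 0 L, Q u) + ∫ u in Ioi L, Q u := by
    rw [← integral_Ioc_eq_integral_Ioo, ← setIntegral_union]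
    · rw [Ioc_union_Ioi_eq_Ioi hl.le]
    · exact Ioc_disjoint_Ioi le_rfl
    · exact measurableSet_Ioi
    · exact hQi.mono_set Ioc_subset_Ioi_self
    · exact hQi.mono_set (Ioi_subset_Ioi hl.le)
  have htail : ∫ u in Ioi L, Q u = 24 * polyLog 5 (1/2) - L^4 * L := by
    have : ∀ u, Q u = (u - L)^4 * (1 / (Real.exp u - 1)) - L^4 * (1 / (Real.exp u - 1)) := by
      intro u; simp only [hQ]; ring
    simp only [this]
    rw [integral_sub ap_tail4.1 (ap_tail1.1.const_mul _), integral_const_mul, ap_tail4.2, ap_tail1.2]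
  have hdiff : (∫ u in Ioi 0, Q u) - ∫ u in Ioi 0, Q' u = -8 * L^3 * zetaVal 2 - 48 * L * zetaVal 4 := by
    rw [← integral_sub hQi hQi']
    have : ∀ u, Q u - Q' u = (-8 * L^3) * (u^1 * (1 / (Real.exp u - 1)))
      + (-8 * L) * (u^3 * (1 / (Real.exp u - 1))) := by intro u; simp only [hQ, hQ']; ring
    simp only [this]
    rw [integral_add (b1.1.const_mul _) (b3.1.const_mul _), integral_const_mul, integral_const_mul,
      b1.2, b3.2]
    norm_num [Nat.factorial]; ring
  rw [hsum]
  linarith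

/-- `4^n / C(2n,n)` -/
noncomputable def apC (n : ℕ) : ℝ := (4:ℝ)^n / (Nat.centralBinom n : ℝ)

theorem apC_pos (n : ℕ) : 0 < apC n := by
  have : (0:ℝ) < Nat.centralBinom n := by exact_mod_cast Nat.centralBinom_pos n
  unfold apC; positivity

theorem apC_succ (n : ℕ) : apC (n+1) * (2*n+1) = apC n * (2*n+2) := by
  have h := Nat.succ_mul_centralBinom_succ n
  have h' : ((n:ℝ)+1) * (Nat.centralBinom (n+1) : ℝ) = 2 * (2*n+1) * (Nat.centralBinom n : ℝ) := by
    exact_mod_cast h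
  have h1 : (0:ℝ) < Nat.centralBinom n := by exact_mod_cast Nat.centralBinom_pos n
  have h2 : (0:ℝ) < Nat.centralBinom (n+1) := by exact_mod_cast Nat.centralBinom_pos (n+1)
  unfold apC
  rw [pow_succ, div_mul_eq_mul_div, div_mul_eq_mul_div, div_eq_div_iff h2.ne' h1.ne']
  linear_combination (-2 * (4:ℝ)^n) * h'

theorem apC_sq (n : ℕ) : (apC n)^2 ≤ 4 * n + 1 := by
  induction n with
  | zero => simp [apC]
  | succ k ih =>
    have h := apC_succ k
    have hk : (0:ℝ) ≤ k := by positivity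
    have h2 : (apC (k+1))^2 * (2*k+1)^2 = (apC k)^2 * (2*k+2)^2 := by
      rw [← mul_pow, h, mul_pow]
    have h3 : (apC k)^2 * (2*k+2)^2 ≤ (4 * k + 1) * (2*k+2)^2 :=
      mul_le_mul_of_nonneg_right ih (by positivity)
    have h4 : (0:ℝ) < (2*k+1)^2 := by positivity
    have h5 : (4 * (k:ℝ) + 1) * (2*k+2)^2 ≤ (4*((k+1 : ℕ):ℝ) + 1) * (2*k+1)^2 := by
      push_cast; nlinarith
    exact le_of_mul_le_mul_right (by linarith) h4

theorem apC_lim : Tendsto (fun n : ℕ => apC n / (2*n+1)) atTop (𝓝 0) := by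
  have hb : ∀ n : ℕ, apC n / (2*n+1) ≤ 2 / Real.sqrt (n+1) := by
    intro n
    have h1 : apC n ≤ 2 * Real.sqrt (n+1) := by
      have h := apC_sq n
      have : apC n ≤ Real.sqrt (4*n+1) := Real.le_sqrt_of_sq_le h
      have h2 : Real.sqrt (4*n+1) ≤ Real.sqrt (4 * (n+1)) := Real.sqrt_le_sqrt (by linarith)
      have h3 : Real.sqrt (4 * ((n:ℝ)+1)) = 2 * Real.sqrt (n+1) := by
        rw [Real.sqrt_mul (by norm_num), show (4:ℝ) = 2^2 by norm_num, Real.sqrt_sq (by norm_num)]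
      linarith
    have hs : 0 < Real.sqrt ((n:ℝ)+1) := Real.sqrt_pos.2 (by positivity)
    have hss : Real.sqrt ((n:ℝ)+1) * Real.sqrt ((n:ℝ)+1) = n+1 := Real.mul_self_sqrt (by positivity)
    rw [div_le_div_iff₀ (by positivity) hs]
    have hn : (0:ℝ) ≤ n := by positivity
    nlinarith
  refine squeeze_zero (fun n => by have := apC_pos n; positivity) hb ?_
  refine Tendsto.div_atTop tendsto_const_nhds ?_
  exact Real.tendsto_sqrt_atTop.comp (tendsto_natCast_atTop_atTop.atTop_add tendsto_const_nhds)

noncomputable def apR (n : ℕ) (θ : ℝ) : ℝ := ∫ t in (0:ℝ)..θ, (θ - t) * Real.sin t ^ (2*n)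

theorem apR_rec (n : ℕ) (θ : ℝ) :
    (2*n+2)*(2*n+1) * apR n θ - (2*n+2)^2 * apR (n+1) θ = Real.sin θ ^ (2*n+2) := by
  have h : ∫ t in (0:ℝ)..θ, ((2*n+2)*(2*n+1) * ((θ - t) * Real.sin t ^ (2*n))
      - (2*n+2)^2 * ((θ - t) * Real.sin t ^ (2*(n+1)))) =
      ((θ - θ) * ((2*n+2) * Real.sin θ ^ (2*n+1) * Real.cos θ) + Real.sin θ ^ (2*n+2))
      - ((θ - 0) * ((2*n+2) * Real.sin 0 ^ (2*n+1) * Real.cos 0) + Real.sin 0 ^ (2*n+2)) := by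
    refine intervalIntegral.integral_eq_sub_of_hasDerivAt
      (f := fun t => (θ - t) * ((2*n+2) * Real.sin t ^ (2*n+1) * Real.cos t) + Real.sin t ^ (2*n+2))
      (fun t _ => ?_) (Continuous.intervalIntegrable (by fun_prop) _ _)
    have h1 : HasDerivAt (fun t => θ - t) (-1) t := by simpa using (hasDerivAt_id t).const_sub θ
    have h2 := ((((Real.hasDerivAt_sin t).pow (2*n+1)).const_mul (2*(n:ℝ)+2)).mul (Real.hasDerivAt_cos t))
    have h3 := (h1.mul h2).add ((Real.hasDerivAt_sin t).pow (2*n+2))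
    refine h3.congr_deriv ?_
    have hc : Real.cos t ^ 2 = 1 - Real.sin t ^ 2 := by
      have := Real.sin_sq_add_cos_sq t; linarith
    simp only [Pi.mul_apply, Pi.pow_apply, Nat.add_sub_cancel]
    rw [show 2*n+2-1 = 2*n+1 by omega, show 2*(n+1) = 2*n+2 by ring]
    push_cast
    simp only [pow_succ] at hc ⊢
    simp only [pow_zero, one_mul] at hc ⊢
    linear_combination ((θ - t) * ((2*(n:ℝ)+2) * (2*n+1)) * Real.sin t ^ (2*n)) * hc
  rw [intervalIntegral.integral_sub (Continuous.intervalIntegrable (by fun_prop) _ _)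
    (Continuous.intervalIntegrable (by fun_prop) _ _), intervalIntegral.integral_const_mul,
    intervalIntegral.integral_const_mul] at h
  simp only [apR]
  rw [h]; simp

noncomputable def apT (n : ℕ) (θ : ℝ) : ℝ := 4 * apC n * apR n θ

theorem apT_sub (n : ℕ) (θ : ℝ) :
    apT n θ - apT (n+1) θ = apC (n+1) / ((n:ℝ)+1)^2 * Real.sin θ ^ (2*n+2) := by
  have h := apR_rec n θ
  have hc := apC_succ n
  rw [← h]; unfold apT
  have : (0:ℝ) < (n:ℝ) + 1 := by positivity
  field_simp
  linear_combination (-2 * apR n θ) * hc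

theorem apT_zero (θ : ℝ) : apT 0 θ = 2 * θ^2 := by
  have h : ∫ t in (0:ℝ)..θ, (θ - t) = θ^2/2 := by
    rw [intervalIntegral.integral_sub (by simp) (Continuous.intervalIntegrable (by fun_prop) _ _)]
    simp; ring
  simp [apT, apR, apC, h]; ring

theorem apT_bound (n : ℕ) (θ : ℝ) (h0 : 0 ≤ θ) (h1 : θ ≤ Real.pi/2) :
    0 ≤ apT n θ ∧ apT n θ ≤ 2 * Real.pi * (apC n / (2*n+1)) := by
  have hp := apC_pos n
  have hR0 : 0 ≤ apR n θ := by
    refine intervalIntegral.integral_nonneg h0 fun t ht => ?_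
    have : 0 ≤ Real.sin t := Real.sin_nonneg_of_nonneg_of_le_pi ht.1 (by linarith [ht.2, Real.pi_pos])
    have : 0 ≤ θ - t := by linarith [ht.2]
    positivity
  have hR1 : apR n θ ≤ Real.pi / 2 / (2*n+1) := by
    have hi : ∫ t in (0:ℝ)..θ, Real.pi/2 * (Real.sin t ^ (2*n) * Real.cos t)
        = Real.pi/2 * (Real.sin θ ^ (2*n+1) / (2*n+1)) := by
      rw [intervalIntegral.integral_const_mul]
      congr 1
      have := integral_sin_pow_mul_cos_pow_odd (a := 0) (b := θ) (2*n) 0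
      simp only [mul_zero, zero_add, pow_one, pow_zero, mul_one, Real.sin_zero] at this
      rw [this, integral_pow]
      simp
    have hle : apR n θ ≤ ∫ t in (0:ℝ)..θ, Real.pi/2 * (Real.sin t ^ (2*n) * Real.cos t) := by
      refine intervalIntegral.integral_mono_on h0 (Continuous.intervalIntegrable (by fun_prop) _ _)
        (Continuous.intervalIntegrable (by fun_prop) _ _) fun t ht => ?_
      have hs : 0 ≤ Real.sin t := Real.sin_nonneg_of_nonneg_of_le_pi ht.1 (by linarith [ht.2, Real.pi_pos])
      have hj := Real.mul_le_sin (x := Real.pi/2 - t) (by linarith [ht.2]) (by linarith [ht.1])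
      rw [Real.sin_pi_div_two_sub] at hj
      have hj2 : Real.pi / 2 - t ≤ Real.pi/2 * Real.cos t := by
        have := mul_le_mul_of_nonneg_left hj (show 0 ≤ Real.pi/2 by positivity)
        have e : Real.pi/2 * (2 / Real.pi * (Real.pi/2 - t)) = Real.pi/2 - t := by
          have := Real.pi_pos.ne'; field_simp
        linarith
      have h5 : θ - t ≤ Real.pi/2 * Real.cos t := by linarith
      have := mul_le_mul_of_nonneg_right h5 (pow_nonneg hs (2*n))
      linarith
    rw [hi] at hle
    have hs1 : Real.sin θ ^ (2*n+1) ≤ 1 := pow_le_one₀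
      (Real.sin_nonneg_of_nonneg_of_le_pi h0 (by linarith [Real.pi_pos])) (Real.sin_le_one θ)
    have : Real.pi/2 * (Real.sin θ ^ (2*n+1) / (2*n+1)) ≤ Real.pi / 2 / (2*n+1) := by
      rw [div_eq_mul_one_div (Real.pi/2)]
      have := Real.pi_pos
      gcongr
    linarith
  constructor
  · unfold apT; positivity
  · unfold apT
    calc 4 * apC n * apR n θ ≤ 4 * apC n * (Real.pi / 2 / (2*n+1)) := by gcongr
      _ = _ := by ring

theorem apT_lim (θ : ℝ) (h0 : 0 ≤ θ) (h1 : θ ≤ Real.pi/2) :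
    Tendsto (fun n => apT n θ) atTop (𝓝 0) := by
  refine squeeze_zero (fun n => (apT_bound n θ h0 h1).1) (fun n => (apT_bound n θ h0 h1).2) ?_
  simpa using apC_lim.const_mul (2 * Real.pi)

theorem ap_arcsin (θ : ℝ) (h0 : 0 ≤ θ) (h1 : θ ≤ Real.pi/2) :
    HasSum (fun n : ℕ => apC (n+1) / ((n:ℝ)+1)^2 * Real.sin θ ^ (2*n+2)) (2 * θ^2) := by
  have hs : 0 ≤ Real.sin θ := Real.sin_nonneg_of_nonneg_of_le_pi h0 (by linarith [Real.pi_pos])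
  rw [hasSum_iff_tendsto_nat_of_nonneg (fun n => by have := apC_pos (n+1); positivity)]
  simp only [← apT_sub, Finset.sum_range_sub']
  simpa [apT_zero] using (apT_lim θ h0 h1).const_sub (apT 0 θ)

theorem ap_intPsi (n : ℕ) : apR (n+1) (Real.pi/2) =
    (n+1) * ∫ t in (0:ℝ)..(Real.pi/2), (Real.pi/2 - t)^2 * (Real.sin t ^ (2*n+1) * Real.cos t) := by
  have h : ∫ t in (0:ℝ)..(Real.pi/2), ((n+1) * ((Real.pi/2 - t)^2 * (Real.sin t ^ (2*n+1) * Real.cos t))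
      - (Real.pi/2 - t) * Real.sin t ^ (2*(n+1))) =
      ((Real.pi/2 - Real.pi/2)^2/2 * Real.sin (Real.pi/2) ^ (2*n+2))
      - ((Real.pi/2 - 0)^2/2 * Real.sin 0 ^ (2*n+2)) := by
    refine intervalIntegral.integral_eq_sub_of_hasDerivAt
      (f := fun t => (Real.pi/2 - t)^2/2 * Real.sin t ^ (2*n+2))
      (fun t _ => ?_) (Continuous.intervalIntegrable (by fun_prop) _ _)
    have h1 : HasDerivAt (fun t => Real.pi/2 - t) (-1) t := by
      simpa using (hasDerivAt_id t).const_sub (Real.pi/2)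
    have h3 := ((h1.pow 2).div_const 2).mul ((Real.hasDerivAt_sin t).pow (2*n+2))
    refine h3.congr_deriv ?_
    simp only [Pi.pow_apply]
    rw [show 2*n+2-1 = 2*n+1 by omega, show 2*(n+1) = 2*n+2 by ring]
    push_cast
    ring
  rw [intervalIntegral.integral_sub (Continuous.intervalIntegrable (by fun_prop) _ _)
    (Continuous.intervalIntegrable (by fun_prop) _ _), intervalIntegral.integral_const_mul] at h
  simp only [apR]
  simp at h
  linarith

theorem ap_intLog (n : ℕ) :
    IntegrableOn (fun t => Real.log (Real.sin t)^2 * (Real.sin t ^ (2*n+1) * Real.cos t))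
      (Ioc 0 (Real.pi/2)) ∧
    ∫ t in (0:ℝ)..(Real.pi/2), Real.log (Real.sin t)^2 * (Real.sin t ^ (2*n+1) * Real.cos t)
      = 1 / (4 * ((n:ℝ)+1)^3) := by
  set G : ℝ → ℝ := fun t => Real.sin t ^ (2*n) * (Real.sin t * Real.log (Real.sin t))^2 / (2*n+2)
    - 2 * (Real.sin t ^ (2*n+1) * (Real.sin t * Real.log (Real.sin t))) / (2*n+2)^2
    + 2 * Real.sin t ^ (2*n+2) / (2*n+2)^3 with hG
  have hcont : Continuous G := by
    have h1 : Continuous (fun t => Real.sin t * Real.log (Real.sin t)) :=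
      Real.continuous_mul_log.comp Real.continuous_sin
    simp only [hG]; fun_prop
  have hpi := Real.pi_pos
  have hsin : ∀ t ∈ Ioo 0 (Real.pi/2), 0 < Real.sin t ∧ 0 < Real.cos t := fun t ht =>
    ⟨Real.sin_pos_of_pos_of_lt_pi ht.1 (by linarith [ht.2]),
      Real.cos_pos_of_mem_Ioo ⟨by linarith [ht.1], ht.2⟩⟩
  have hd : ∀ t ∈ Ioo 0 (Real.pi/2), HasDerivAt G
      (Real.log (Real.sin t)^2 * (Real.sin t ^ (2*n+1) * Real.cos t)) t := by
    intro t ht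
    have hs := (hsin t ht).1
    have d1 := Real.hasDerivAt_sin t
    have d2 := d1.log hs.ne'
    have d3 := d1.mul d2
    have d4 := ((((d1.pow (2*n)).mul (d3.pow 2)).div_const (2*(n:ℝ)+2)).sub
      ((((d1.pow (2*n+1)).mul d3).const_mul 2).div_const ((2*(n:ℝ)+2)^2))).add
      (((d1.pow (2*n+2)).const_mul 2).div_const ((2*(n:ℝ)+2)^3))
    refine d4.congr_deriv ?_
    simp only [Pi.pow_apply, Pi.mul_apply]
    have hn : (0:ℝ) < 2*n+2 := by positivity
    rcases Nat.eq_zero_or_pos n with rfl | hnpos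
    · simp
      field_simp
      ring
    · obtain ⟨m, rfl⟩ : ∃ m, n = m+1 := ⟨n-1, by omega⟩
      rw [show 2*(m+1)+2-1 = 2*m+3 by omega, show 2*(m+1)+1-1 = 2*m+2 by omega,
        show 2*(m+1)-1 = 2*m+1 by omega]
      push_cast
      push_cast at hn
      field_simp
      ring
  have hnn : ∀ t ∈ Ioo 0 (Real.pi/2), 0 ≤
      (Real.log (Real.sin t)^2 * (Real.sin t ^ (2*n+1) * Real.cos t)) := by
    intro t ht
    have := (hsin t ht).1
    have := (hsin t ht).2
    positivity
  have hI := intervalIntegral.integrableOn_deriv_of_nonneg hcont.continuousOn hd hnn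
  refine ⟨hI, ?_⟩
  rw [intervalIntegral.integral_eq_sub_of_hasDerivAt_of_le (by positivity) hcont.continuousOn hd
    ((intervalIntegrable_iff_integrableOn_Ioc_of_le (by positivity)).2 hI)]
  simp [hG]
  field_simp
  ring

theorem ap_Tle (n : ℕ) : apT n (Real.pi/2) ≤ Real.pi^2/2 := by
  induction n with
  | zero => rw [apT_zero]; apply le_of_eq; ring
  | succ k ih =>
    have h := apT_sub k (Real.pi/2)
    have hp := apC_pos (k+1)
    have : 0 ≤ apC (k+1) / ((k:ℝ)+1)^2 * Real.sin (Real.pi/2) ^ (2*k+2) := by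
      rw [Real.sin_pi_div_two]; positivity
    linarith

theorem ap_Tpos (n : ℕ) : 0 ≤ apT n (Real.pi/2) :=
  (apT_bound n (Real.pi/2) (by positivity) le_rfl).1

theorem ap_Tsummable : Summable (fun k : ℕ => apT k (Real.pi/2) / ((k:ℝ)+1)^3) := by
  refine Summable.of_nonneg_of_le (fun k => ?_) (fun k => ?_)
    ((ap_zetaSummable 3 (by norm_num)).mul_left (Real.pi^2/2))
  · have := ap_Tpos k; positivity
  · rw [mul_one_div]
    have := ap_Tle k
    gcongr

theorem ap_abel_fin (N : ℕ) :
    ∑ k ∈ Finset.range N, apC (k+1) / ((k:ℝ)+1)^2 * genHarmonic (k+1) 3 =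
    ∑ k ∈ Finset.range N, apT k (Real.pi/2) / ((k:ℝ)+1)^3 - apT N (Real.pi/2) * genHarmonic N 3 := by
  induction N with
  | zero => simp [genHarmonic]
  | succ N ih =>
    rw [Finset.sum_range_succ, Finset.sum_range_succ, ih]
    have h := apT_sub N (Real.pi/2)
    rw [Real.sin_pi_div_two, one_pow, mul_one] at h
    rw [← h]
    have hg : genHarmonic (N+1) 3 = genHarmonic N 3 + 1 / ((N:ℝ)+1)^3 := by
      unfold genHarmonic; rw [Finset.sum_range_succ]
    rw [hg]; ring

theorem ap_abel : HasSum (fun k : ℕ => apC (k+1) / ((k:ℝ)+1)^2 * genHarmonic (k+1) 3)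
    (∑' k : ℕ, apT k (Real.pi/2) / ((k:ℝ)+1)^3) := by
  have hH : ∀ N, 0 ≤ genHarmonic N 3 := fun N => Finset.sum_nonneg fun i _ => by positivity
  rw [hasSum_iff_tendsto_nat_of_nonneg (fun k => by
    have := apC_pos (k+1); have := hH (k+1); positivity)]
  simp only [ap_abel_fin]
  have h1 := ap_Tsummable.hasSum.tendsto_sum_nat
  have h2 := apT_lim (Real.pi/2) (by positivity) le_rfl
  have h3 : Tendsto (fun N => genHarmonic N 3) atTop (𝓝 (∑' k : ℕ, 1 / ((k:ℝ)+1)^3)) :=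
    (ap_zetaSummable 3 (by norm_num)).hasSum.tendsto_sum_nat
  simpa using h1.sub (h2.mul h3)

theorem ap_term (k : ℕ) :
    IntegrableOn (fun t => 4 * (apC (k+1) / ((k:ℝ)+1)^2) * (((Real.pi/2 - t)^2 + Real.log (Real.sin t)^2)
      * (Real.sin t ^ (2*k+1) * Real.cos t))) (Ioc 0 (Real.pi/2)) ∧
    ∫ t in Ioc 0 (Real.pi/2), 4 * (apC (k+1) / ((k:ℝ)+1)^2) * (((Real.pi/2 - t)^2 + Real.log (Real.sin t)^2)
      * (Real.sin t ^ (2*k+1) * Real.cos t)) = apT k (Real.pi/2) / ((k:ℝ)+1)^3 := by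
  obtain ⟨i1, e1⟩ := ap_intLog k
  have i2 : IntegrableOn (fun t => (Real.pi/2 - t)^2 * (Real.sin t ^ (2*k+1) * Real.cos t))
      (Ioc 0 (Real.pi/2)) := (Continuous.integrableOn_Icc (by fun_prop)).mono_set Ioc_subset_Icc_self
  have e2 := ap_intPsi k
  have hpi : (0:ℝ) ≤ Real.pi/2 := by positivity
  rw [intervalIntegral.integral_of_le hpi] at e1 e2
  have h := apT_sub k (Real.pi/2)
  rw [Real.sin_pi_div_two, one_pow, mul_one] at h
  have hT : apT k (Real.pi/2) = apT (k+1) (Real.pi/2) + apC (k+1) / ((k:ℝ)+1)^2 := by linarith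
  simp only [add_mul]
  constructor
  · exact (i2.add i1).const_mul _
  · rw [integral_const_mul, integral_add i2 i1, hT, e1, apT, e2]
    have : (0:ℝ) < (k:ℝ)+1 := by positivity
    field_simp

theorem ap_S : (∑' k : ℕ, apT k (Real.pi/2) / ((k:ℝ)+1)^3 =
    ∫ t in (0:ℝ)..(Real.pi/2), 8 * t^2 * (Real.cos t / Real.sin t) *
      ((Real.pi/2 - t)^2 + Real.log (Real.sin t)^2)) ∧
    IntegrableOn (fun t => 8 * t^2 * (Real.cos t / Real.sin t) *
      ((Real.pi/2 - t)^2 + Real.log (Real.sin t)^2)) (Ioc 0 (Real.pi/2)) := by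
  have hpi : (0:ℝ) ≤ Real.pi/2 := by positivity
  have key := hasSum_integral_of_summable_integral_norm
    (μ := volume.restrict (Ioc 0 (Real.pi/2)))
    (F := fun (k:ℕ) t => 4 * (apC (k+1) / ((k:ℝ)+1)^2) * (((Real.pi/2 - t)^2 + Real.log (Real.sin t)^2)
      * (Real.sin t ^ (2*k+1) * Real.cos t))) (fun k => (ap_term k).1) ?_
  · have e : ∫ t in Ioc 0 (Real.pi/2), ∑' k : ℕ, 4 * (apC (k+1) / ((k:ℝ)+1)^2) * (((Real.pi/2 - t)^2 + Real.log (Real.sin t)^2)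
      * (Real.sin t ^ (2*k+1) * Real.cos t)) = ∫ t in Ioc 0 (Real.pi/2), 8 * t^2 * (Real.cos t / Real.sin t) *
      ((Real.pi/2 - t)^2 + Real.log (Real.sin t)^2) := by
      refine setIntegral_congr_fun measurableSet_Ioc fun t ht => ?_
      have hs : 0 < Real.sin t := Real.sin_pos_of_pos_of_lt_pi ht.1 (by linarith [ht.2, Real.pi_pos])
      have h := (ap_arcsin t ht.1.le ht.2).mul_left (4 * (Real.cos t / Real.sin t) *
        ((Real.pi/2 - t)^2 + Real.log (Real.sin t)^2))
      refine HasSum.tsum_eq (ap_hs h (fun k => ?_) ?_)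
      · rw [show 2*k+2 = (2*k+1)+1 by ring, pow_succ]
        field_simp
        ring
      · ring
    rw [e] at key
    simp only [fun k => (ap_term k).2] at key
    have hX := key.tsum_eq
    have hpos : 0 < ∑' k : ℕ, apT k (Real.pi/2) / ((k:ℝ)+1)^3 := by
      refine ap_Tsummable.tsum_pos (fun k => ?_) 0 ?_
      · have := ap_Tpos k; positivity
      · rw [apT_zero]; positivity
    refine ⟨by rw [intervalIntegral.integral_of_le hpi]; exact hX, ?_⟩
    by_contra hni
    rw [hX, integral_undef hni] at hpos
    exact lt_irrefl _ hpos
  · refine ap_Tsummable.congr fun k => ?_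
    rw [← (ap_term k).2]
    refine setIntegral_congr_fun measurableSet_Ioc fun t ht => ?_
    have hs : 0 ≤ Real.sin t := Real.sin_nonneg_of_nonneg_of_le_pi ht.1.le (by linarith [ht.2, Real.pi_pos])
    have hc : 0 ≤ Real.cos t := Real.cos_nonneg_of_mem_Icc ⟨by linarith [ht.1], ht.2⟩
    have := apC_pos (k+1)
    refine (Real.norm_of_nonneg ?_).symm
    positivity

theorem ap_xlog (m : ℕ) (hm : 1 ≤ m) :
    Tendsto (fun x : ℝ => x * Real.log x ^ m) (𝓝[>] 0) (𝓝 0) := by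
  have hm' : (0:ℝ) < m := by exact_mod_cast hm
  have h := (tendsto_log_mul_rpow_nhdsGT_zero (r := 1/(m:ℝ)) (by positivity)).pow m
  rw [zero_pow (by omega)] at h
  refine h.congr' ?_
  filter_upwards [self_mem_nhdsWithin] with x hx
  have hx' : (0:ℝ) < x := hx
  rw [mul_pow, ← Real.rpow_natCast (x ^ (1/(m:ℝ))), ← Real.rpow_mul hx'.le,
    one_div_mul_cancel hm'.ne', Real.rpow_one, mul_comm]

theorem ap_tlog (m : ℕ) (hm : 1 ≤ m) :
    ContinuousOn (fun t : ℝ => t * Real.log (Real.sin t) ^ m) (Icc 0 (Real.pi/2)) := by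
  have hpi := Real.pi_pos
  intro t ht
  rcases eq_or_lt_of_le ht.1 with h0 | h0
  · subst h0
    refine ContinuousWithinAt.mono (t := Ici 0) ?_ (fun x hx => hx.1)
    rw [← continuousWithinAt_Ioi_iff_Ici]
    unfold ContinuousWithinAt
    have e0 : ((fun t : ℝ => t * Real.log (Real.sin t) ^ m) 0) = 0 := by simp
    rw [e0]
    have hsin : Tendsto Real.sin (𝓝[>] 0) (𝓝[>] 0) := by
      refine tendsto_nhdsWithin_iff.2 ⟨?_, ?_⟩
      · have := Real.continuous_sin.tendsto 0
        rw [Real.sin_zero] at this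
        exact this.mono_left nhdsWithin_le_nhds
      · filter_upwards [Ioo_mem_nhdsGT hpi] with x hx
        exact Real.sin_pos_of_pos_of_lt_pi hx.1 hx.2
    have h := ((ap_xlog m hm).comp hsin).norm.const_mul (Real.pi/2)
    rw [norm_zero, mul_zero] at h
    refine squeeze_zero_norm' ?_ h
    filter_upwards [Ioo_mem_nhdsGT (show (0:ℝ) < Real.pi/2 by positivity)] with x hx
    have hj := Real.mul_le_sin hx.1.le hx.2.le
    have hs : 0 < Real.sin x := Real.sin_pos_of_pos_of_lt_pi hx.1 (by linarith [hx.2])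
    have hj2 : x ≤ Real.pi/2 * Real.sin x := by
      have := mul_le_mul_of_nonneg_left hj (show 0 ≤ Real.pi/2 by positivity)
      have e : Real.pi/2 * (2 / Real.pi * x) = x := by
        have := Real.pi_pos.ne'; field_simp
      linarith
    simp only [Function.comp, norm_mul, Real.norm_of_nonneg hx.1.le, Real.norm_of_nonneg hs.le]
    rw [← mul_assoc]
    gcongr
  · have hs : 0 < Real.sin t := Real.sin_pos_of_pos_of_lt_pi h0 (by linarith [ht.2])
    refine ContinuousAt.continuousWithinAt ?_
    exact continuousAt_id.mul ((Real.continuous_sin.continuousAt.log hs.ne').pow m)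

theorem ap_S2 : (∑' k : ℕ, apT k (Real.pi/2) / ((k:ℝ)+1)^3 =
    ∫ t in (0:ℝ)..(Real.pi/2), (16 * Real.log (Real.cos t) * t * (Real.pi/2 - t) * ((Real.pi/2 - t) - t)
      - 16/3 * (Real.pi/2 - t) * Real.log (Real.cos t)^3)) ∧
    ContinuousOn (fun t => 16 * Real.log (Real.cos t) * t * (Real.pi/2 - t) * ((Real.pi/2 - t) - t)
      - 16/3 * (Real.pi/2 - t) * Real.log (Real.cos t)^3) (Icc 0 (Real.pi/2)) := by
  have hpi := Real.pi_pos
  have hh : (0:ℝ) ≤ Real.pi/2 := by positivity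
  have c1 := ap_tlog 1 le_rfl
  have c3 := ap_tlog 3 (by norm_num)
  obtain ⟨hS, hI⟩ := ap_S
  set g : ℝ → ℝ := fun t => 16 * (t * Real.log (Real.sin t)^1) * (Real.pi/2 - t) * ((Real.pi/2 - t) - t)
    + 16/3 * (t * Real.log (Real.sin t)^3) with hg
  have hgc : ContinuousOn g (Icc 0 (Real.pi/2)) := by
    simp only [hg]
    refine ContinuousOn.add (((c1.const_mul 16).mul (by fun_prop)).mul (by fun_prop)) (c3.const_mul _)
  have hgi : IntegrableOn g (Ioc 0 (Real.pi/2)) :=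
    (hgc.integrableOn_Icc).mono_set Ioc_subset_Icc_self
  have hF : ∫ t in (0:ℝ)..(Real.pi/2), (8 * t^2 * (Real.cos t / Real.sin t) *
      ((Real.pi/2 - t)^2 + Real.log (Real.sin t)^2) + g t) = 0 := by
    rw [intervalIntegral.integral_eq_sub_of_hasDerivAt_of_le hh (f := fun t =>
      8 * t * (Real.pi/2 - t)^2 * (t * Real.log (Real.sin t)^1) + 8/3 * t * (t * Real.log (Real.sin t)^3))]
    · simp
    · refine ContinuousOn.add (ContinuousOn.mul (by fun_prop) c1) (ContinuousOn.mul (by fun_prop) c3)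
    · intro t ht
      have hs : 0 < Real.sin t := Real.sin_pos_of_pos_of_lt_pi ht.1 (by linarith [ht.2])
      have d0 := hasDerivAt_id t
      have d1 : HasDerivAt (fun t => Real.pi/2 - t) (-1) t := by
        simpa using (hasDerivAt_id t).const_sub (Real.pi/2)
      have d2 := (Real.hasDerivAt_sin t).log hs.ne'
      have d3 := (((d0.const_mul 8).mul (d1.pow 2)).mul (d0.mul (d2.pow 1))).add
        ((d0.const_mul (8/3)).mul (d0.mul (d2.pow 3)))
      refine d3.congr_deriv ?_
      simp only [Pi.mul_apply, Pi.pow_apply, id, hg]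
      field_simp
      push_cast
      ring
    · exact (intervalIntegrable_iff_integrableOn_Ioc_of_le hh).2 (hI.add hgi)
  rw [intervalIntegral.integral_add ((intervalIntegrable_iff_integrableOn_Ioc_of_le hh).2 hI)
    ((intervalIntegrable_iff_integrableOn_Ioc_of_le hh).2 hgi), ← hS] at hF
  have hflip : ∀ t, 16 * Real.log (Real.cos t) * t * (Real.pi/2 - t) * ((Real.pi/2 - t) - t)
      - 16/3 * (Real.pi/2 - t) * Real.log (Real.cos t)^3 = - g (Real.pi/2 - t) := by
    intro t
    simp only [hg, Real.sin_pi_div_two_sub]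
    ring
  constructor
  · simp only [hflip]
    rw [intervalIntegral.integral_neg, intervalIntegral.integral_comp_sub_left (fun t => g t)]
    simp only [sub_self, sub_zero]
    linarith
  · simp only [hflip]
    refine ContinuousOn.neg (hgc.comp (by fun_prop) ?_)
    intro t ht
    exact ⟨by linarith [ht.2], by linarith [ht.1]⟩

theorem ap_logsin4 : IntervalIntegrable (fun t => Real.log (Real.sin t)^4) volume 0 (Real.pi/2) := by
  have hpi := Real.pi_pos
  have hh : (0:ℝ) ≤ Real.pi/2 := by positivity
  obtain ⟨B, hB⟩ := (isCompact_Icc (a := (0:ℝ)) (b := Real.pi/2)).exists_bound_of_continuousOn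
    (ap_tlog 8 (by norm_num))
  have hr : IntervalIntegrable (fun t : ℝ => Real.sqrt B * t ^ (-(1/2) : ℝ)) volume 0 (Real.pi/2) :=
    (intervalIntegral.intervalIntegrable_rpow' (by norm_num)).const_mul _
  refine hr.mono_fun (by
    exact ((Real.measurable_log.comp Real.measurable_sin).pow_const 4).aestronglyMeasurable) ?_
  rw [uIoc_of_le hh]
  refine (ae_restrict_mem measurableSet_Ioc).mono fun t ht => ?_
  have h1 := hB t ⟨ht.1.le, ht.2⟩
  show ‖Real.log (Real.sin t)^4‖ ≤ ‖Real.sqrt B * t ^ (-(1/2) : ℝ)‖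
  have ht0 := ht.1
  rw [Real.norm_of_nonneg (by positivity), Real.norm_of_nonneg (by positivity), Real.rpow_neg ht0.le,
    ← Real.sqrt_eq_rpow, ← div_eq_mul_inv, ← Real.sqrt_div' _ ht0.le]
  refine Real.le_sqrt_of_sq_le ?_
  rw [le_div_iff₀ ht0]
  have := (le_abs_self _).trans h1
  nlinarith

theorem ap_logcos4 : IntervalIntegrable (fun t => Real.log (Real.cos t)^4) volume 0 (Real.pi/2) := by
  have h := (ap_logsin4.comp_sub_left (Real.pi/2)).symm
  simp only [Real.sin_pi_div_two_sub, sub_self, sub_zero] at h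
  exact h

noncomputable def apP (z : ℂ) : ℂ := ((Real.pi:ℂ)/2)^2 * z - 4 * ((Real.pi:ℂ)/2) * z^2 + 7/3 * z^3

noncomputable def apQ (w z : ℂ) : ℂ :=
  w * (-(8*(Real.pi:ℂ)/3) * (w^2 - 3 * (Real.log 2 : ℝ) * w + 3 * ((Real.log 2 : ℝ):ℂ)^2)
    - 4/3 * Complex.I * (w^3 - 4 * (Real.log 2 : ℝ) * w^2 + 6 * ((Real.log 2 : ℝ):ℂ)^2 * w
      - 4 * ((Real.log 2 : ℝ):ℂ)^3) + 16 * apP z)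

noncomputable def apW (z : ℂ) : ℂ := Complex.log (1 + Complex.exp (2 * Complex.I * z))

noncomputable def apH (z : ℂ) : ℂ := apQ (apW z) z

theorem apH_diff (z : ℂ) (hz : 1 + Complex.exp (2 * Complex.I * z) ∈ Complex.slitPlane) :
    DifferentiableAt ℂ apH z := by
  have h : DifferentiableAt ℂ apW z := by
    unfold apW
    exact DifferentiableAt.clog (by fun_prop) hz
  unfold apH apQ apP
  fun_prop

theorem apW_slit (z : ℂ) (hz : 0 < z.im) : 1 + Complex.exp (2 * Complex.I * z) ∈ Complex.slitPlane := by
  apply Complex.mem_slitPlane_of_norm_lt_one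
  rw [Complex.norm_exp]
  simp
  exact hz

theorem apH_right (y : ℝ) (hy : 0 < y) :
    (Complex.I * apH ((Real.pi/2 : ℝ) + y * Complex.I)).re =
    4/3 * ((Real.log (1 - Real.exp (-(2*y))) - Real.log 2)^4 - (Real.log 2)^4)
      + 112/3 * (y^3 * Real.log (1 - Real.exp (-(2*y)))) := by
  have hw : apW ((Real.pi/2 : ℝ) + y * Complex.I) = ((Real.log (1 - Real.exp (-(2*y))) : ℝ) : ℂ) := by
    unfold apW
    have e : 2 * Complex.I * (((Real.pi/2 : ℝ):ℂ) + y * Complex.I) = Real.pi * Complex.I + ((-(2*y) : ℝ) : ℂ) := by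
      push_cast
      linear_combination (2 * (y:ℂ)) * Complex.I_sq
    rw [e, Complex.exp_add, Complex.exp_pi_mul_I, ← Complex.ofReal_exp,
      Complex.ofReal_log (by
        have : Real.exp (-(2*y)) ≤ 1 := Real.exp_le_one_iff.2 (by linarith)
        linarith)]
    push_cast
    congr 1
    ring
  unfold apH
  rw [hw]
  generalize Real.log (1 - Real.exp (-(2*y))) = a
  unfold apQ apP
  generalize Real.log 2 = L
  simp [pow_succ]
  ring

theorem apH_left (y : ℝ) (hy : 0 < y) :
    (Complex.I * apH ((0 : ℝ) + y * Complex.I)).re =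
    4/3 * ((Real.log (1 + Real.exp (-(2*y))) - Real.log 2)^4 - (Real.log 2)^4)
      - 16 * (Real.pi/2)^2 * (y * Real.log (1 + Real.exp (-(2*y))))
      + 112/3 * (y^3 * Real.log (1 + Real.exp (-(2*y)))) := by
  have hw : apW ((0 : ℝ) + y * Complex.I) = ((Real.log (1 + Real.exp (-(2*y))) : ℝ) : ℂ) := by
    unfold apW
    have e : 2 * Complex.I * (((0 : ℝ):ℂ) + y * Complex.I) = ((-(2*y) : ℝ) : ℂ) := by
      push_cast
      linear_combination (2 * (y:ℂ)) * Complex.I_sq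
    rw [e, ← Complex.ofReal_exp, Complex.ofReal_log (by positivity)]
    push_cast
    rfl
  unfold apH
  rw [hw]
  generalize Real.log (1 + Real.exp (-(2*y))) = a
  unfold apQ apP
  generalize Real.log 2 = L
  simp [pow_succ]
  ring

theorem apW_bot_eq (x : ℝ) :
    1 + Complex.exp (2 * Complex.I * x) = ((2 * Real.cos x : ℝ) : ℂ) * Complex.exp (x * Complex.I) := by
  have : Complex.exp (2 * Complex.I * x) = Complex.exp (x * Complex.I) * Complex.exp (x * Complex.I) := by
    rw [← Complex.exp_add]; congr 1; ring
  rw [this]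
  push_cast
  rw [Complex.two_cos, add_mul, ← Complex.exp_add, ← Complex.exp_add, neg_mul, neg_add_cancel,
    Complex.exp_zero, Complex.exp_add]
  ring

theorem apW_bot (x : ℝ) (h0 : 0 < x) (h1 : x < Real.pi/2) :
    apW x = ((Real.log (Real.cos x) + Real.log 2 : ℝ) : ℂ) + x * Complex.I := by
  have hc : 0 < Real.cos x := Real.cos_pos_of_mem_Ioo ⟨by linarith, h1⟩
  unfold apW
  rw [apW_bot_eq, Complex.log_ofReal_mul (by positivity) (Complex.exp_ne_zero _),
    Complex.log_exp (by simp; linarith [Real.pi_pos]) (by simp; linarith [Real.pi_pos]),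
    Real.log_mul (by norm_num) hc.ne', add_comm (Real.log 2)]

theorem apH_bot (x : ℝ) (h0 : 0 < x) (h1 : x < Real.pi/2) :
    (apH x).re = (16 * Real.log (Real.cos x) * x * (Real.pi/2 - x) * ((Real.pi/2 - x) - x)
      - 16/3 * (Real.pi/2 - x) * Real.log (Real.cos x)^3)
      + (16 * Real.log 2 * ((Real.pi/2)^2 * x - 4 * (Real.pi/2) * x^2 + 7/3 * x^3)
        - 8*Real.pi/3 * Real.log 2^3) := by
  unfold apH
  rw [apW_bot x h0 h1]
  generalize Real.log (Real.cos x) = p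
  unfold apQ apP
  generalize Real.log 2 = L
  simp [pow_succ]
  ring

theorem apW_bot_slit (x : ℝ) (h0 : 0 < x) (h1 : x < Real.pi/2) :
    1 + Complex.exp (2 * Complex.I * x) ∈ Complex.slitPlane := by
  have hc : 0 < Real.cos x := Real.cos_pos_of_mem_Ioo ⟨by linarith, h1⟩
  rw [apW_bot_eq]
  left
  rw [Complex.re_ofReal_mul, Complex.exp_ofReal_mul_I_re]
  positivity

/-- polynomial growth bound -/
theorem apQ_bound : ∃ C : ℝ, 0 < C ∧ ∀ w z : ℂ, ‖apQ w z‖ ≤ C * (‖w‖ * (1 + ‖w‖)^3 * (1 + ‖z‖)^3) := by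
  have hpi := Real.pi_pos
  have hL : 0 < Real.log 2 := Real.log_pos (by norm_num)
  set L := Real.log 2 with hLdef
  refine ⟨8*Real.pi/3 * (1 + 3 * L + 3 * L^2) + 4/3 * (1 + 4*L + 6*L^2 + 4*L^3)
    + 16 * ((Real.pi/2)^2 + 4 * (Real.pi/2) + 7/3), by positivity, fun w z => ?_⟩
  unfold apQ
  rw [norm_mul]
  set a := ‖w‖ with ha
  set r := ‖z‖ with hr
  have ha0 : 0 ≤ a := norm_nonneg _
  have hr0 : 0 ≤ r := norm_nonneg _
  have hA : 1 ≤ (1+a)^3 := one_le_pow₀ (by linarith)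
  have hR : 1 ≤ (1+r)^3 := one_le_pow₀ (by linarith)
  have hA1 : a ≤ (1+a)^3 := by nlinarith [pow_nonneg ha0 3, pow_nonneg ha0 2]
  have hA2 : a^2 ≤ (1+a)^3 := by nlinarith [pow_nonneg ha0 3, pow_nonneg ha0 2]
  have hA3 : a^3 ≤ (1+a)^3 := by nlinarith [pow_nonneg ha0 3, pow_nonneg ha0 2]
  have hR1 : r ≤ (1+r)^3 := by nlinarith [pow_nonneg hr0 3, pow_nonneg hr0 2]
  have hR2 : r^2 ≤ (1+r)^3 := by nlinarith [pow_nonneg hr0 3, pow_nonneg hr0 2]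
  have hR3 : r^3 ≤ (1+r)^3 := by nlinarith [pow_nonneg hr0 3, pow_nonneg hr0 2]
  have n1 : ‖w^2 - 3 * (L:ℂ) * w + 3 * (L:ℂ)^2‖ ≤ (1 + 3 * L + 3 * L^2) * (1+a)^3 := by
    calc _ ≤ ‖w^2‖ + ‖3 * (L:ℂ) * w‖ + ‖3 * (L:ℂ)^2‖ :=
          (norm_add_le _ _).trans (add_le_add_left (norm_sub_le _ _) _)
      _ = a^2 + 3 * L * a + 3 * L^2 := by simp [abs_of_pos hL, ha]
      _ ≤ (1+a)^3 + 3 * L * (1+a)^3 + 3 * L^2 * (1+a)^3 := by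
          have q1 := mul_le_mul_of_nonneg_left hA1 (show 0 ≤ 3 * L by positivity)
          have q2 := le_mul_of_one_le_right (show 0 ≤ 3 * L^2 by positivity) hA
          linarith
      _ = _ := by ring
  have n2 : ‖w^3 - 4 * (L:ℂ) * w^2 + 6 * (L:ℂ)^2 * w - 4 * (L:ℂ)^3‖
      ≤ (1 + 4*L + 6*L^2 + 4*L^3) * (1+a)^3 := by
    calc _ ≤ ‖w^3‖ + ‖4 * (L:ℂ) * w^2‖ + ‖6 * (L:ℂ)^2 * w‖ + ‖4 * (L:ℂ)^3‖ :=
          (norm_sub_le _ _).trans (add_le_add_left ((norm_add_le _ _).trans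
            (add_le_add_left (norm_sub_le _ _) _)) _)
      _ = a^3 + 4 * L * a^2 + 6 * L^2 * a + 4 * L^3 := by simp [abs_of_pos hL, ha]
      _ ≤ (1+a)^3 + 4 * L * (1+a)^3 + 6 * L^2 * (1+a)^3 + 4 * L^3 * (1+a)^3 := by
          have q1 := mul_le_mul_of_nonneg_left hA2 (show 0 ≤ 4 * L by positivity)
          have q2 := mul_le_mul_of_nonneg_left hA1 (show 0 ≤ 6 * L^2 by positivity)
          have q3 := le_mul_of_one_le_right (show 0 ≤ 4 * L^3 by positivity) hA
          linarith
      _ = _ := by ring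
  have n3 : ‖apP z‖ ≤ ((Real.pi/2)^2 + 4 * (Real.pi/2) + 7/3) * (1+r)^3 := by
    unfold apP
    calc _ ≤ ‖((Real.pi:ℂ)/2)^2 * z‖ + ‖4 * ((Real.pi:ℂ)/2) * z^2‖ + ‖7/3 * z^3‖ :=
          (norm_add_le _ _).trans (add_le_add_left (norm_sub_le _ _) _)
      _ = (Real.pi/2)^2 * r + 4 * (Real.pi/2) * r^2 + 7/3 * r^3 := by simp [abs_of_pos hpi, hr]
      _ ≤ (Real.pi/2)^2 * (1+r)^3 + 4 * (Real.pi/2) * (1+r)^3 + 7/3 * (1+r)^3 := by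
          gcongr
      _ = _ := by ring
  have n4 := norm_add_le (-(8*(Real.pi:ℂ)/3) * (w^2 - 3 * (L:ℂ) * w + 3 * (L:ℂ)^2)
    - 4/3 * Complex.I * (w^3 - 4 * (L:ℂ) * w^2 + 6 * (L:ℂ)^2 * w - 4 * (L:ℂ)^3)) (16 * apP z)
  have n5 := norm_sub_le (-(8*(Real.pi:ℂ)/3) * (w^2 - 3 * (L:ℂ) * w + 3 * (L:ℂ)^2))
    (4/3 * Complex.I * (w^3 - 4 * (L:ℂ) * w^2 + 6 * (L:ℂ)^2 * w - 4 * (L:ℂ)^3))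
  have e1 : ‖-(8*(Real.pi:ℂ)/3)‖ = 8*Real.pi/3 := by simp [abs_of_pos hpi]
  have e2 : ‖(4/3 * Complex.I : ℂ)‖ = 4/3 := by simp
  rw [norm_mul, e1, norm_mul, e2] at n5
  have e3 : ‖16 * apP z‖ = 16 * ‖apP z‖ := by simp
  rw [e3] at n4
  set A := (1+a)^3
  set R := (1+r)^3
  have hAR : A ≤ A * R := le_mul_of_one_le_right (by linarith) hR
  have hRA : R ≤ A * R := le_mul_of_one_le_left (by linarith) hA
  have m1 : 8*Real.pi/3 * ‖w^2 - 3 * (L:ℂ) * w + 3 * (L:ℂ)^2‖ ≤ 8*Real.pi/3 * ((1 + 3 * L + 3 * L^2) * (A * R)) := by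
    have := n1.trans (mul_le_mul_of_nonneg_left hAR (by positivity))
    gcongr
  have m2 : 4/3 * ‖w^3 - 4 * (L:ℂ) * w^2 + 6 * (L:ℂ)^2 * w - 4 * (L:ℂ)^3‖
      ≤ 4/3 * ((1 + 4*L + 6*L^2 + 4*L^3) * (A * R)) := by
    have := n2.trans (mul_le_mul_of_nonneg_left hAR (by positivity))
    gcongr
  have m3 := n3.trans (mul_le_mul_of_nonneg_left hRA (by positivity))
  calc _ ≤ a * (8*Real.pi/3 * ((1 + 3 * L + 3 * L^2) * (A * R)) + 4/3 * ((1 + 4*L + 6*L^2 + 4*L^3) * (A * R))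
        + 16 * (((Real.pi/2)^2 + 4 * (Real.pi/2) + 7/3) * (A * R))) := by
        gcongr
        linarith
    _ = _ := by ring

noncomputable def apRt (y : ℝ) : ℝ :=
    4/3 * ((Real.log (1 - Real.exp (-(2*y))) - Real.log 2)^4 - (Real.log 2)^4)
      + 112/3 * (y^3 * Real.log (1 - Real.exp (-(2*y))))

noncomputable def apLf (y : ℝ) : ℝ :=
    4/3 * ((Real.log (1 + Real.exp (-(2*y))) - Real.log 2)^4 - (Real.log 2)^4)
      - 16 * (Real.pi/2)^2 * (y * Real.log (1 + Real.exp (-(2*y))))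
      + 112/3 * (y^3 * Real.log (1 + Real.exp (-(2*y))))

theorem apH_contOn (s : Set ℝ) (φ : ℝ → ℂ) (hφ : Continuous φ) (him : ∀ x ∈ s, 0 < (φ x).im) :
    ContinuousOn (fun x => apH (φ x)) s := fun x hx =>
  (ContinuousAt.comp (apH_diff _ (apW_slit _ (him x hx))).continuousAt hφ.continuousAt).continuousWithinAt

theorem ap_rect (ε T : ℝ) (hε : 0 < ε) (hT : ε ≤ T) :
    (∫ x in (0:ℝ)..(Real.pi/2), (apH (x + ε * Complex.I)).re)
    - (∫ x in (0:ℝ)..(Real.pi/2), (apH (x + T * Complex.I)).re)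
    + (∫ y in ε..T, apRt y) - (∫ y in ε..T, apLf y) = 0 := by
  have h := Complex.integral_boundary_rect_eq_zero_of_differentiableOn apH
    ((0:ℝ) + ε * Complex.I) ((Real.pi/2 : ℝ) + T * Complex.I) (by
      intro z hz
      refine (apH_diff z (apW_slit z ?_)).differentiableWithinAt
      have h2 := hz.2
      simp [uIcc_of_le hT] at h2
      linarith [h2.1])
  have r1 : ((((0:ℝ):ℂ) + ε * Complex.I)).re = 0 := by simp
  have r2 : ((((Real.pi/2 : ℝ):ℂ) + T * Complex.I)).re = Real.pi/2 := by simp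
  have r3 : ((((0:ℝ):ℂ) + ε * Complex.I)).im = ε := by simp
  have r4 : ((((Real.pi/2 : ℝ):ℂ) + T * Complex.I)).im = T := by simp
  rw [r1, r2, r3, r4] at h
  have hpos : ∀ y ∈ uIcc ε T, 0 < y := by
    intro y hy
    rw [uIcc_of_le hT] at hy
    linarith [hy.1]
  have i1 : IntervalIntegrable (fun x : ℝ => apH (x + ε * Complex.I)) volume 0 (Real.pi/2) :=
    (apH_contOn _ _ (by fun_prop) (fun x _ => by simpa using hε)).intervalIntegrable
  have i2 : IntervalIntegrable (fun x : ℝ => apH (x + T * Complex.I)) volume 0 (Real.pi/2) :=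
    (apH_contOn _ _ (by fun_prop) (fun x _ => by simp; linarith)).intervalIntegrable
  have i3 : IntervalIntegrable (fun y : ℝ => Complex.I * apH ((Real.pi/2 : ℝ) + y * Complex.I)) volume ε T :=
    ((apH_contOn _ _ (by fun_prop) (fun y hy => by simpa using hpos y hy)).intervalIntegrable).const_mul _
  have i4 : IntervalIntegrable (fun y : ℝ => Complex.I * apH ((0 : ℝ) + y * Complex.I)) volume ε T :=
    ((apH_contOn _ _ (by fun_prop) (fun y hy => by simpa using hpos y hy)).intervalIntegrable).const_mul _
  rw [smul_eq_mul, smul_eq_mul, ← intervalIntegral.integral_const_mul,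
    ← intervalIntegral.integral_const_mul] at h
  have c1 := Complex.reCLM.intervalIntegral_comp_comm i1
  have c2 := Complex.reCLM.intervalIntegral_comp_comm i2
  have c3 := Complex.reCLM.intervalIntegral_comp_comm i3
  have c4 := Complex.reCLM.intervalIntegral_comp_comm i4
  simp only [Complex.reCLM_apply] at c1 c2 c3 c4
  have e3 : ∫ y in ε..T, apRt y = ∫ y in ε..T, (Complex.I * apH ((Real.pi/2 : ℝ) + y * Complex.I)).re :=
    intervalIntegral.integral_congr fun y hy => (apH_right y (hpos y hy)).symm
  have e4 : ∫ y in ε..T, apLf y = ∫ y in ε..T, (Complex.I * apH ((0 : ℝ) + y * Complex.I)).re :=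
    intervalIntegral.integral_congr fun y hy => (apH_left y (hpos y hy)).symm
  rw [e3, e4, c1, c2, c3, c4, ← Complex.sub_re, ← Complex.add_re, ← Complex.sub_re, h, Complex.zero_re]

theorem ap_side_lim (f : ℝ → ℝ) (hf : IntegrableOn f (Ioi 0)) :
    Tendsto (fun n : ℕ => ∫ y in (1/((n:ℝ)+4))..((n:ℝ)+4), f y) atTop (𝓝 (∫ y in Ioi 0, f y)) := by
  have hT : Tendsto (fun n : ℕ => (n:ℝ)+4) atTop atTop :=
    tendsto_natCast_atTop_atTop.atTop_add tendsto_const_nhds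
  have hE : Tendsto (fun n : ℕ => 1/((n:ℝ)+4)) atTop (𝓝 0) := tendsto_const_nhds.div_atTop hT
  have hii : ∀ a b : ℝ, 0 ≤ a → 0 ≤ b → IntervalIntegrable f volume a b := by
    intro a b ha hb
    rw [intervalIntegrable_iff]
    refine hf.mono_set fun x hx => ?_
    have := hx.1
    exact lt_of_le_of_lt (le_min ha hb) this
  have h1 := intervalIntegral_tendsto_integral_Ioi 0 hf hT
  have h2 : Tendsto (fun n : ℕ => ∫ y in (0:ℝ)..(1/((n:ℝ)+4)), f y) atTop (𝓝 0) := by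
    have hc : ContinuousOn (fun x => ∫ y in (0:ℝ)..x, f y) (Icc 0 1) := by
      have hu : uIcc (0:ℝ) 1 = Icc 0 1 := uIcc_of_le zero_le_one
      rw [← hu]
      refine intervalIntegral.continuousOn_primitive_interval (μ := volume) ?_
      rw [hu]
      exact (integrableOn_Icc_iff_integrableOn_Ioc).2 (hf.mono_set fun x hx => hx.1)
    have := hc 0 (by simp)
    unfold ContinuousWithinAt at this
    simp only [intervalIntegral.integral_same] at this
    refine this.comp (tendsto_nhdsWithin_iff.2 ⟨hE, Eventually.of_forall fun n => ⟨by positivity, ?_⟩⟩)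
    rw [div_le_one (by positivity)]
    have : (0:ℝ) ≤ n := by positivity
    linarith
  have h3 := h1.sub h2
  rw [sub_zero] at h3
  refine h3.congr fun n => ?_
  rw [intervalIntegral.integral_interval_sub_left (hii _ _ le_rfl (by positivity))
    (hii _ _ le_rfl (by positivity))]

theorem ap_top_lim :
    Tendsto (fun n : ℕ => ∫ x in (0:ℝ)..(Real.pi/2), (apH (x + (((n:ℝ)+4 : ℝ) : ℂ) * Complex.I)).re)
      atTop (𝓝 0) := by
  obtain ⟨C, hC, hQ⟩ := apQ_bound
  have hpi := Real.pi_pos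
  have hpi4 := Real.pi_le_four
  have hT : Tendsto (fun n : ℕ => (n:ℝ)+7) atTop atTop :=
    tendsto_natCast_atTop_atTop.atTop_add tendsto_const_nhds
  have hl := ((Real.tendsto_pow_mul_exp_neg_atTop_nhds_zero 3).comp hT).const_mul
    (C * (3/2 * Real.exp 3 * 8) * (Real.pi/2))
  rw [mul_zero] at hl
  refine squeeze_zero_norm (fun n => ?_) hl
  have hb : ∀ x ∈ uIoc (0:ℝ) (Real.pi/2), ‖(apH (x + (((n:ℝ)+4 : ℝ) : ℂ) * Complex.I)).re‖ ≤
      C * (3/2 * Real.exp 3 * 8) * (((n:ℝ)+7)^3 * Real.exp (-((n:ℝ)+7))) := by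
    intro x hx
    rw [uIoc_of_le (by positivity)] at hx
    have hn : (0:ℝ) ≤ n := by positivity
    set T : ℝ := (n:ℝ)+4 with hTd
    refine (Complex.abs_re_le_norm _).trans ((hQ _ _).trans ?_)
    have hz : ‖(x:ℂ) + (T:ℂ) * Complex.I‖ ≤ 2 + T := by
      refine (norm_add_le _ _).trans ?_
      simp [abs_of_pos hx.1, abs_of_pos (show 0 < T by linarith)]
      linarith [hx.2]
    have he : ‖Complex.exp (2 * Complex.I * ((x:ℂ) + (T:ℂ) * Complex.I))‖ = Real.exp (-(2*T)) := by
      rw [Complex.norm_exp]; simp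
    have heT : Real.exp (-(2*T)) ≤ Real.exp 3 * Real.exp (-((n:ℝ)+7)) := by
      rw [← Real.exp_add]; apply Real.exp_le_exp.2; linarith
    have he2 : Real.exp (-(2*T)) ≤ 1/2 := by
      have h1 : 2 ≤ Real.exp (2*T) := by linarith [Real.add_one_le_exp (2*T)]
      rw [Real.exp_neg, inv_eq_one_div]
      exact one_div_le_one_div_of_le (by norm_num) h1
    have hw : ‖apW ((x:ℂ) + (T:ℂ) * Complex.I)‖ ≤ 3/2 * Real.exp (-(2*T)) := by
      have := Complex.norm_log_one_add_half_le_self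
        (z := Complex.exp (2 * Complex.I * ((x:ℂ) + (T:ℂ) * Complex.I))) (by rw [he]; exact he2)
      rw [he] at this
      exact this
    have hw1 : 1 + ‖apW ((x:ℂ) + (T:ℂ) * Complex.I)‖ ≤ 2 := by linarith
    calc C * (‖apW ((x:ℂ) + (T:ℂ) * Complex.I)‖ * (1 + ‖apW ((x:ℂ) + (T:ℂ) * Complex.I)‖)^3
          * (1 + ‖(x:ℂ) + (T:ℂ) * Complex.I‖)^3)
        ≤ C * ((3/2 * (Real.exp 3 * Real.exp (-((n:ℝ)+7)))) * 2^3 * (1 + (2+T))^3) := by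
          gcongr
          linarith
      _ = _ := by rw [hTd]; ring
  have := intervalIntegral.norm_integral_le_of_norm_le_const hb
  refine this.trans (le_of_eq ?_)
  rw [sub_zero, abs_of_pos (by positivity)]
  simp only [Function.comp]
  ring

theorem ap_bot_lim :
    Tendsto (fun n : ℕ => ∫ x in (0:ℝ)..(Real.pi/2), (apH (x + ((1/((n:ℝ)+4) : ℝ) : ℂ) * Complex.I)).re)
      atTop (𝓝 (∫ x in (0:ℝ)..(Real.pi/2), (apH x).re)) := by
  obtain ⟨C, hC, hQ⟩ := apQ_bound
  have hpi := Real.pi_pos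
  have hpi4 := Real.pi_lt_d2
  have hh : (0:ℝ) ≤ Real.pi/2 := by positivity
  have hT : Tendsto (fun n : ℕ => (n:ℝ)+4) atTop atTop :=
    tendsto_natCast_atTop_atTop.atTop_add tendsto_const_nhds
  have hE : Tendsto (fun n : ℕ => 1/((n:ℝ)+4)) atTop (𝓝 0) := tendsto_const_nhds.div_atTop hT
  have hne : ∀ᵐ x : ℝ, x ≠ Real.pi/2 := by simp [ae_iff]
  refine intervalIntegral.tendsto_integral_filter_of_dominated_convergence
    (fun x => C * (8 * (Real.log (Real.cos x)^4 + 625) * 64)) ?_ ?_ ?_ ?_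
  · refine Eventually.of_forall fun n => ?_
    refine ContinuousOn.aestronglyMeasurable ?_ measurableSet_uIoc
    refine Complex.continuous_re.comp_continuousOn (apH_contOn _ _ (by fun_prop) (fun x _ => ?_))
    rw [Complex.add_im, Complex.ofReal_im, zero_add, Complex.im_ofReal_mul, Complex.I_im, mul_one]
    positivity
  · refine Eventually.of_forall fun n => ?_
    filter_upwards [hne] with x hxne hx
    rw [uIoc_of_le hh] at hx
    have hxlt : x < Real.pi/2 := lt_of_le_of_ne hx.2 hxne
    have hc : 0 < Real.cos x := Real.cos_pos_of_mem_Ioo ⟨by linarith [hx.1], hxlt⟩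
    set e : ℝ := 1/((n:ℝ)+4) with he
    have he0 : 0 < e := by positivity
    have he1 : e ≤ 1/4 := by
      rw [he]; exact one_div_le_one_div_of_le (by norm_num) (by linarith [show (0:ℝ) ≤ n by positivity])
    refine (Complex.abs_re_le_norm _).trans ((hQ _ _).trans ?_)
    have hz : ‖(x:ℂ) + (e:ℂ) * Complex.I‖ ≤ 3 := by
      refine (norm_add_le _ _).trans ?_
      rw [norm_mul, Complex.norm_I, mul_one, Complex.norm_real, Complex.norm_real,
        Real.norm_of_nonneg hx.1.le, Real.norm_of_nonneg he0.le]
      linarith [hx.2]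
    set r : ℝ := Real.exp (-(2*e)) with hr
    have hr1 : r ≤ 1 := Real.exp_le_one_iff.2 (by linarith)
    have hr2 : 1/2 ≤ r := by linarith [Real.add_one_le_exp (-(2*e))]
    have hexp : Complex.exp (2 * Complex.I * ((x:ℂ) + (e:ℂ) * Complex.I)) =
        (r:ℂ) * Complex.exp (((2*x : ℝ):ℂ) * Complex.I) := by
      rw [hr, Complex.ofReal_exp, ← Complex.exp_add]
      congr 1
      push_cast
      linear_combination (2 * (e:ℂ)) * Complex.I_sq
    set v : ℂ := 1 + Complex.exp (2 * Complex.I * ((x:ℂ) + (e:ℂ) * Complex.I)) with hv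
    have hv2 : ‖v‖ ≤ 2 := by
      rw [hv, hexp]
      refine (norm_add_le _ _).trans ?_
      rw [norm_mul, Complex.norm_exp_ofReal_mul_I, Complex.norm_real, Real.norm_of_nonneg (by linarith)]
      simp; linarith
    have hv1 : Real.cos x ≤ ‖v‖ := by
      refine abs_le_of_sq_le_sq' ?_ (norm_nonneg _) |>.2
      rw [← Complex.normSq_eq_norm_sq, Complex.normSq_apply, hv, hexp]
      simp only [Complex.add_re, Complex.add_im, Complex.re_ofReal_mul, Complex.im_ofReal_mul,
        Complex.exp_ofReal_mul_I_re, Complex.exp_ofReal_mul_I_im, Complex.one_re, Complex.one_im]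
      have s1 := Real.sin_sq_add_cos_sq (2*x)
      have s2 := Real.cos_two_mul x
      have s3 : (1 + r * Real.cos (2*x)) * (1 + r * Real.cos (2*x)) + (0 + r * Real.sin (2*x)) * (0 + r * Real.sin (2*x))
          = (1 - r)^2 + 4 * r * Real.cos x^2 := by
        linear_combination r^2 * s1 + 2 * r * s2
      rw [s3]
      nlinarith [sq_nonneg (1-r), sq_nonneg (Real.cos x)]
    have hw : 1 + ‖apW ((x:ℂ) + (e:ℂ) * Complex.I)‖ ≤ |Real.log (Real.cos x)| + 5 := by
      have h1 : ‖apW ((x:ℂ) + (e:ℂ) * Complex.I)‖ ≤ |Real.log ‖v‖| + Real.pi := by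
        have := Complex.norm_le_abs_re_add_abs_im (Complex.log v)
        rw [Complex.log_re, Complex.log_im] at this
        exact this.trans (by linarith [Complex.abs_arg_le_pi v])
      have h2 : |Real.log ‖v‖| ≤ |Real.log (Real.cos x)| + Real.log 2 := by
        have a1 := Real.log_le_log hc hv1
        have a2 := Real.log_le_log (hc.trans_le hv1) hv2
        have a3 : 0 < Real.log 2 := Real.log_pos (by norm_num)
        rw [abs_le]
        constructor
        · linarith [neg_abs_le (Real.log (Real.cos x))]
        · linarith [abs_nonneg (Real.log (Real.cos x))]
      have h3 := Real.log_two_lt_d9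
      linarith
    set a := |Real.log (Real.cos x)| with ha
    have ha0 : 0 ≤ a := abs_nonneg _
    have ha4 : Real.log (Real.cos x)^4 = a^4 := by
      rw [ha]; exact (Even.pow_abs (by decide) _).symm
    rw [ha4]
    calc C * (‖apW ((x:ℂ) + (e:ℂ) * Complex.I)‖ * (1 + ‖apW ((x:ℂ) + (e:ℂ) * Complex.I)‖)^3
          * (1 + ‖(x:ℂ) + (e:ℂ) * Complex.I‖)^3)
        ≤ C * ((a+5) * (a+5)^3 * (1 + 3)^3) := by
          gcongr
          linarith
      _ = C * ((a+5)^4 * 64) := by ring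
      _ ≤ _ := by
          gcongr
          nlinarith [sq_nonneg (a-5), sq_nonneg (a+5), sq_nonneg (a^2-25), mul_nonneg ha0 (sq_nonneg (a-5)), sq_nonneg ((a-5)*(a+5)), sq_nonneg ((a-5)^2)]
  · exact (((ap_logcos4.add (by simp)).const_mul 8).mul_const 64).const_mul C
  · filter_upwards [hne] with x hxne hx
    rw [uIoc_of_le hh] at hx
    have hxlt : x < Real.pi/2 := lt_of_le_of_ne hx.2 hxne
    have hcont : ContinuousAt apH (x:ℂ) := (apH_diff _ (apW_bot_slit x hx.1 hxlt)).continuousAt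
    have hE' : Tendsto (fun n : ℕ => (x:ℂ) + ((1/((n:ℝ)+4) : ℝ) : ℂ) * Complex.I) atTop (𝓝 (x:ℂ)) := by
      have := (((Complex.continuous_ofReal.tendsto 0).comp hE).mul_const Complex.I).const_add (x:ℂ)
      simpa [Function.comp] using this
    exact (Complex.continuous_re.tendsto _).comp (hcont.tendsto.comp hE')

theorem ap_logB (m : ℕ) (hm : 1 ≤ m) :
    IntegrableOn (fun u => u ^ m * Real.log (1 + Real.exp (-(2 * u)))) (Ioi 0) ∧
    ∫ u in Ioi (0:ℝ), u ^ m * Real.log (1 + Real.exp (-(2 * u)))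
      = ((m.factorial : ℝ) / 2 ^ (m+1) * zetaVal (m+2)) - ((m.factorial : ℝ) / 4 ^ (m+1) * zetaVal (m+2)) := by
  obtain ⟨i2, e2⟩ := ap_logint 2 (by norm_num) m hm
  obtain ⟨i4, e4⟩ := ap_logint 4 (by norm_num) m hm
  have hE : EqOn (fun u => u ^ m * Real.log (1 - Real.exp (-(4 * u))) - u ^ m * Real.log (1 - Real.exp (-(2 * u))))
      (fun u => u ^ m * Real.log (1 + Real.exp (-(2 * u)))) (Ioi 0) := by
    intro u hu
    have hu' : (0:ℝ) < u := hu
    have h1 : Real.exp (-(2*u)) < 1 := by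
      have := Real.exp_lt_exp.2 (show -(2*u) < 0 by linarith)
      rwa [Real.exp_zero] at this
    have h2 : 0 < Real.exp (-(2*u)) := Real.exp_pos _
    have h3 : 1 - Real.exp (-(4*u)) = (1 - Real.exp (-(2*u))) * (1 + Real.exp (-(2*u))) := by
      have : Real.exp (-(4*u)) = Real.exp (-(2*u)) * Real.exp (-(2*u)) := by
        rw [← Real.exp_add]; congr 1; ring
      rw [this]; ring
    simp only
    rw [h3, Real.log_mul (by linarith) (by linarith)]
    ring
  constructor
  · exact (i4.sub i2).congr_fun hE measurableSet_Ioi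
  · rw [← setIntegral_congr_fun measurableSet_Ioi hE, integral_sub i4 i2, e2, e4]
    ring

theorem ap_Rt : IntegrableOn apRt (Ioi 0) ∧ ∫ y in Ioi (0:ℝ), apRt y =
    4/3 * (∫ t in Ioi (0:ℝ), ((Real.log (1 - Real.exp (-(2*t))) - Real.log 2)^4 - (Real.log 2)^4))
    + 112/3 * -(6/16 * zetaVal 5) := by
  obtain ⟨i2, e2⟩ := ap_logint 2 (by norm_num) 3 (by norm_num)
  have i1 := ap_sideA.1
  constructor
  · exact (i1.const_mul (4/3)).add (i2.const_mul (112/3))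
  · unfold apRt
    rw [integral_add (i1.const_mul (4/3)) (i2.const_mul (112/3)), integral_const_mul,
      integral_const_mul, e2]
    norm_num [Nat.factorial]

theorem ap_Lf : IntegrableOn apLf (Ioi 0) ∧ ∫ y in Ioi (0:ℝ), apLf y =
    4/3 * (∫ t in Ioi (0:ℝ), ((Real.log (1 + Real.exp (-(2*t))) - Real.log 2)^4 - (Real.log 2)^4))
    - 16 * (Real.pi/2)^2 * (3/16 * zetaVal 3) + 112/3 * (6/16 * zetaVal 5 - 6/256 * zetaVal 5) := by
  obtain ⟨i2, e2⟩ := ap_logB 3 (by norm_num)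
  obtain ⟨i3, e3⟩ := ap_logB 1 (by norm_num)
  simp only [pow_one] at i3 e3
  have i1 := ap_sideB.1
  constructor
  · exact ((i1.const_mul (4/3)).sub (i3.const_mul _)).add (i2.const_mul (112/3))
  · unfold apLf
    have i13 : Integrable (fun y => 4/3 * ((Real.log (1 + Real.exp (-(2*y))) - Real.log 2)^4 - (Real.log 2)^4)
      - 16 * (Real.pi/2)^2 * (y * Real.log (1 + Real.exp (-(2*y))))) (volume.restrict (Ioi 0)) :=
      (i1.const_mul (4/3)).sub (i3.const_mul _)
    rw [integral_add i13 (i2.const_mul (112/3)), integral_sub (i1.const_mul (4/3)) (i3.const_mul _), integral_const_mul,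
      integral_const_mul, integral_const_mul, e2, e3]
    norm_num [Nat.factorial]
    ring

theorem ap_contour : ∫ x in (0:ℝ)..(Real.pi/2), (apH x).re =
    (∫ y in Ioi (0:ℝ), apLf y) - ∫ y in Ioi (0:ℝ), apRt y := by
  have h := ((ap_bot_lim.sub ap_top_lim).add (ap_side_lim apRt ap_Rt.1)).sub (ap_side_lim apLf ap_Lf.1)
  have h0 : Tendsto (fun _ : ℕ => (0:ℝ)) atTop (𝓝 0) := tendsto_const_nhds
  have := tendsto_nhds_unique (h.congr fun n : ℕ => ap_rect (1/((n:ℝ)+4)) ((n:ℝ)+4) (by positivity) (by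
    have hn : (0:ℝ) ≤ n := by positivity
    rw [div_le_iff₀ (by positivity)]
    nlinarith)) h0
  linarith

theorem ap_botval : ∫ x in (0:ℝ)..(Real.pi/2), (apH x).re =
    (∑' k : ℕ, apT k (Real.pi/2) / ((k:ℝ)+1)^3) + (- 4 * Real.log 2 * (Real.pi/2)^4
      - 4 * Real.pi^2/3 * Real.log 2^3) := by
  have hh : (0:ℝ) ≤ Real.pi/2 := by positivity
  obtain ⟨hS, hc⟩ := ap_S2
  have e : ∫ x in (0:ℝ)..(Real.pi/2), (apH x).re = ∫ x in (0:ℝ)..(Real.pi/2),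
      ((16 * Real.log (Real.cos x) * x * (Real.pi/2 - x) * ((Real.pi/2 - x) - x)
      - 16/3 * (Real.pi/2 - x) * Real.log (Real.cos x)^3)
      + (16 * Real.log 2 * ((Real.pi/2)^2 * x - 4 * (Real.pi/2) * x^2 + 7/3 * x^3)
        - 8*Real.pi/3 * Real.log 2^3)) := by
    rw [intervalIntegral.integral_of_le hh, intervalIntegral.integral_of_le hh,
      integral_Ioc_eq_integral_Ioo, integral_Ioc_eq_integral_Ioo]
    exact setIntegral_congr_fun measurableSet_Ioo fun x hx => apH_bot x hx.1 hx.2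
  rw [e, intervalIntegral.integral_add (by
    refine ContinuousOn.intervalIntegrable ?_
    rw [uIcc_of_le hh]; exact hc) (Continuous.intervalIntegrable (by fun_prop) _ _), ← hS]
  congr 1
  rw [intervalIntegral.integral_eq_sub_of_hasDerivAt (f := fun x => 16 * Real.log 2 *
    ((Real.pi/2)^2 * (x^2/2) - 4 * (Real.pi/2) * (x^3/3) + 7/3 * (x^4/4)) - 8*Real.pi/3 * Real.log 2^3 * x)
    (fun x _ => ?_) (Continuous.intervalIntegrable (by fun_prop) _ _)]
  · simp; ring
  · have p2 := ((hasDerivAt_id x).pow 2).div_const 2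
    have p3 := ((hasDerivAt_id x).pow 3).div_const 3
    have p4 := ((hasDerivAt_id x).pow 4).div_const 4
    have d := ((((p2.const_mul ((Real.pi/2)^2)).sub (p3.const_mul (4 * (Real.pi/2)))).add
      (p4.const_mul (7/3))).const_mul (16 * Real.log 2)).sub
      ((hasDerivAt_id x).const_mul (8*Real.pi/3 * Real.log 2^3))
    refine d.congr_deriv ?_
    simp

theorem ap_z2 : zetaVal 2 = Real.pi^2/6 := by
  have h := (hasSum_nat_add_iff' 1).2 hasSum_zeta_two
  unfold zetaVal
  simpa using h.tsum_eq

theorem ap_z4 : zetaVal 4 = Real.pi^4/90 := by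
  have h := (hasSum_nat_add_iff' 1).2 hasSum_zeta_four
  unfold zetaVal
  simpa using h.tsum_eq

theorem stmt_0 :
    ∑' k : ℕ, (4 : ℝ) ^ (k + 1) * genHarmonic (k + 1) 3 /
      ((k + 1 : ℝ) ^ 2 * (Nat.choose (2 * (k + 1)) (k + 1) : ℝ))
    = 217 / 8 * zetaVal 5 - 9 / 2 * zetaVal 2 * zetaVal 3 - 16 * polyLog 5 (1 / 2)
      - 19 / 2 * Real.log 2 * zetaVal 4 + 8 / 3 * Real.log 2 ^ 3 * zetaVal 2 + 2 / 15 * Real.log 2 ^ 5 := by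
  have hsum : ∑' k : ℕ, (4 : ℝ) ^ (k + 1) * genHarmonic (k + 1) 3 /
      ((k + 1 : ℝ) ^ 2 * (Nat.choose (2 * (k + 1)) (k + 1) : ℝ)) =
      ∑' k : ℕ, apT k (Real.pi/2) / ((k:ℝ)+1)^3 := by
    rw [← ap_abel.tsum_eq]
    refine tsum_congr fun k => ?_
    rw [← Nat.centralBinom_eq_two_mul_choose]
    unfold apC
    have h2 : (0:ℝ) < Nat.centralBinom (k+1) := by exact_mod_cast Nat.centralBinom_pos (k+1)
    field_simp
  rw [hsum]
  have h1 := ap_contour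
  rw [ap_botval, ap_Lf.2, ap_Rt.2] at h1
  have h2 := ap_sides
  have z2 := ap_z2
  have z4 := ap_z4
  rw [z2, z4] at h2 ⊢
  linear_combination h1 + 4/3 * h2
end

section
/- The Apéry-like series of weight 5 evaluates as: ∑_{k=1}^∞ 4^k H_k^{(2)} / (k^3 · C(2k,k)) = (31/4)ζ(5) + (3/2)ζ(2)ζ(3) − 16 Li_5(1/2) − 2 ln(2) ζ(4) + (8/3) ln^3(2) ζ(2) + (2/15) ln^5(2). -/
open Real

noncomputable def aC (k : ℕ) : ℝ := (4 : ℝ) ^ (k + 1) / ((k + 1 : ℝ) ^ 2 * (Nat.choose (2 * (k + 1)) (k + 1) : ℝ))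

lemma aC_pos (k : ℕ) : 0 < aC k := by
  unfold aC
  have : 0 < Nat.choose (2 * (k + 1)) (k + 1) := Nat.choose_pos (by omega)
  positivity

lemma aC_zero : aC 0 = 2 := by norm_num [aC]

lemma aC_succ (k : ℕ) : aC (k+1) * ((2 * k + 4) * (2 * k + 3)) = aC k * (4 * (k+1)^2) := by
  unfold aC
  have h := Nat.succ_mul_centralBinom_succ (k+1)
  rw [Nat.centralBinom, Nat.centralBinom] at h
  have h1 : 0 < Nat.choose (2 * (k + 1)) (k + 1) := Nat.choose_pos (by omega)
  have h2 : 0 < Nat.choose (2 * (k + 1 + 1)) (k + 1 + 1) := Nat.choose_pos (by omega)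
  have h' : ((k:ℝ) + 1 + 1) * (Nat.choose (2 * (k + 1 + 1)) (k + 1 + 1) : ℝ) = 2 * (2 * (k+1) + 1) * (Nat.choose (2 * (k + 1)) (k + 1) : ℝ) := by
    exact_mod_cast h
  have h1' : (Nat.choose (2 * (k + 1)) (k + 1) : ℝ) ≠ 0 := by positivity
  have h2' : (Nat.choose (2 * (k + 1 + 1)) (k + 1 + 1) : ℝ) ≠ 0 := by positivity
  push_cast
  generalize (Nat.choose (2 * (k + 1)) (k + 1) : ℝ) = c at *
  generalize (Nat.choose (2 * (k + 1 + 1)) (k + 1 + 1) : ℝ) = d at *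
  rw [div_mul_eq_mul_div, div_mul_eq_mul_div, div_eq_div_iff (by positivity) (by positivity)]
  rw [pow_succ (4:ℝ) (k+1)]
  linear_combination (-4 ^ (k+1) * 4 * (k+1)^2 * (k+2)) * h'

/-- growth bound -/
lemma aC_bound (k : ℕ) : aC k * (4 * (k+1)^2) ≤ 8 * (k+1) := by
  unfold aC
  have h := Nat.four_pow_le_two_mul_self_mul_centralBinom (k+1) (by omega)
  rw [Nat.centralBinom] at h
  have h1 : 0 < Nat.choose (2 * (k + 1)) (k + 1) := Nat.choose_pos (by omega)
  have h' : (4:ℝ)^(k+1) ≤ 2 * (k+1) * (Nat.choose (2 * (k + 1)) (k + 1) : ℝ) := by exact_mod_cast h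
  have h1' : (0:ℝ) < (Nat.choose (2 * (k + 1)) (k + 1) : ℝ) := by positivity
  rw [div_mul_eq_mul_div, div_le_iff₀ (by positivity)]
  nlinarith [mul_le_mul_of_nonneg_left h' (by positivity : (0:ℝ) ≤ 4 * (k+1)^2)]

/-- weighted partial sums -/
noncomputable def PS (w : ℕ → ℝ) (N : ℕ) (x : ℝ) : ℝ := ∑ k ∈ Finset.range N, w k * aC k * sin x ^ (2 * (k + 1))
noncomputable def PS1 (w : ℕ → ℝ) (N : ℕ) (x : ℝ) : ℝ := ∑ k ∈ Finset.range N, w k * aC k * ((2 * (k + 1)) * sin x ^ (2 * k + 1) * cos x)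

lemma PS_deriv (w : ℕ → ℝ) (N : ℕ) (x : ℝ) : HasDerivAt (PS w N) (PS1 w N x) x := by
  unfold PS PS1
  apply HasDerivAt.fun_sum
  intro k _
  apply HasDerivAt.const_mul
  have := (hasDerivAt_sin x).pow (2 * (k+1))
  refine this.congr_deriv ?_
  rw [show 2 * (k+1) - 1 = 2 * k + 1 by omega]
  push_cast; ring

lemma PS1_deriv (w : ℕ → ℝ) (N : ℕ) (x : ℝ) : HasDerivAt (PS1 w N)
    (∑ k ∈ Finset.range N, w k * aC k * ((2 * k + 2) * (2 * k + 1) * sin x ^ (2 * k) - 4 * (k+1)^2 * sin x ^ (2 * (k+1)))) x := by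
  unfold PS1
  apply HasDerivAt.fun_sum
  intro k _
  apply HasDerivAt.const_mul
  have := (((hasDerivAt_sin x).pow (2 * k+1)).const_mul (2 * ((k:ℝ) + 1))).mul (hasDerivAt_cos x)
  refine this.congr_deriv ?_
  rw [show 2 * k+1 - 1 = 2 * k by omega]
  have hc : cos x * cos x = 1 - sin x ^ 2 := by rw [← Real.cos_sq']; ring
  rw [Pi.pow_apply]
  push_cast
  linear_combination ((2 * (k:ℝ)+2) * (2 * k + 1) * sin x ^ (2 * k)) * hc

/-- telescoped second derivative -/
lemma PS_tele (w : ℕ → ℝ) (N : ℕ) (x : ℝ) :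
    (∑ k ∈ Finset.range (N+1), w k * aC k * ((2 * k + 2) * (2 * k + 1) * sin x ^ (2 * k) - 4 * (k+1)^2 * sin x ^ (2 * (k+1))))
    = 4 * w 0 + (∑ k ∈ Finset.range N, (w (k+1) - w k) * (4 * (k+1)^2) * aC k * sin x ^ (2 * (k+1))) - w N * (aC N * (4 * (N+1)^2)) * sin x ^ (2 * (N+1)) := by
  induction N with
  | zero => simp [aC_zero]; ring
  | succ n ih =>
    rw [Finset.sum_range_succ, ih, Finset.sum_range_succ]
    have := aC_succ n
    push_cast
    linear_combination (w (n+1) * sin x ^ (2 * (n+1))) * this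

lemma taylor_bound (R R1 R2 : ℝ → ℝ) (h0 : R 0 = 0) (h1 : R1 0 = 0)
    (hR : ∀ x, HasDerivAt R (R1 x) x) (hR1 : ∀ x, HasDerivAt R1 (R2 x) x) (T M : ℝ) (hT : 0 ≤ T)
    (hM : ∀ x ∈ Set.Icc 0 T, 0 ≤ R2 x ∧ R2 x ≤ M) : 0 ≤ R T ∧ R T ≤ M * T ^ 2 / 2 := by
  have key : ∀ (f g : ℝ → ℝ), (∀ x, HasDerivAt f (g x) x) → f 0 = 0 → (∀ x ∈ Set.Icc 0 T, 0 ≤ g x) → ∀ x ∈ Set.Icc 0 T, 0 ≤ f x := by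
    intro f g hf hf0 hg x hx
    have hm : MonotoneOn f (Set.Icc 0 T) := by
      apply monotoneOn_of_deriv_nonneg (convex_Icc 0 T)
      · exact fun y _ => (hf y).continuousAt.continuousWithinAt
      · exact fun y _ => (hf y).differentiableAt.differentiableWithinAt
      · intro y hy; rw [interior_Icc] at hy; rw [(hf y).deriv]; exact hg y ⟨hy.1.le, hy.2.le⟩
    rw [← hf0]; exact hm ⟨le_rfl, hT⟩ hx hx.1
  constructor
  · exact key R R1 hR h0 (key R1 R2 hR1 h1 (fun x hx => (hM x hx).1)) T ⟨hT, le_rfl⟩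
  · have := key (fun x => M * x^2/2 - R x) (fun x => M * x - R1 x) ?_ (by simp [h0])
      (key (fun x => M * x - R1 x) (fun x => M - R2 x) ?_ (by simp [h1]) (fun x hx => by linarith [(hM x hx).2])) T ⟨hT, le_rfl⟩
    · simp at this; linarith
    · intro x
      have := (((hasDerivAt_pow 2 x).const_mul M).div_const 2).sub (hR x)
      refine this.congr_deriv ?_
      push_cast; ring
    · intro x
      have := ((hasDerivAt_id x).const_mul M).sub (hR1 x)
      refine this.congr_deriv ?_
      ring

lemma sin_pow_mono {x T : ℝ} (hx : x ∈ Set.Icc 0 T) (hT : T ≤ π/2) (n : ℕ) : 0 ≤ sin x ^ n ∧ sin x ^ n ≤ sin T ^ n := by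
  have h0 : 0 ≤ sin x := sin_nonneg_of_nonneg_of_le_pi hx.1 (by linarith [hx.2, pi_pos])
  have h1 : sin x ≤ sin T := sin_le_sin_of_le_of_le_pi_div_two (by linarith [hx.1, pi_pos]) hT hx.2
  exact ⟨by positivity, by gcongr⟩

lemma PS_zero (w : ℕ → ℝ) (N : ℕ) : PS w N 0 = 0 := by simp [PS]
lemma PS1_zero (w : ℕ → ℝ) (N : ℕ) : PS1 w N 0 = 0 := by simp [PS1]

lemma P_bound (N : ℕ) (T : ℝ) (h0 : 0 ≤ T) (hT : T ≤ π/2) :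
    0 ≤ 2 * T^2 - PS (fun _ => 1) (N+1) T ∧ 2 * T^2 - PS (fun _ => 1) (N+1) T ≤ (8 * (N+1) * sin T ^ (2 * (N+1))) * T^2/2 := by
  apply taylor_bound (fun x => 2 * x^2 - PS (fun _ => 1) (N+1) x) (fun x => 4 * x - PS1 (fun _ => 1) (N+1) x)
    (fun x => aC N * (4 * (N+1)^2) * sin x ^ (2 * (N+1))) (by simp [PS_zero]) (by simp [PS1_zero])
  · intro x
    refine (((hasDerivAt_pow 2 x).const_mul 2).sub (PS_deriv (fun _ => 1) (N+1) x)).congr_deriv ?_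
    push_cast; ring
  · intro x
    refine (((hasDerivAt_id x).const_mul 4).sub (PS1_deriv (fun _ => 1) (N+1) x)).congr_deriv ?_
    rw [PS_tele]; simp
  · exact h0
  · intro x hx
    obtain ⟨h1, h2⟩ := sin_pow_mono hx hT (2 * (N+1))
    have := aC_pos N
    refine ⟨by positivity, ?_⟩
    exact mul_le_mul (aC_bound N) h2 h1 (by positivity)

noncomputable def hh (k : ℕ) : ℝ := ∑ n ∈ Finset.range k, 1 / (n + 1 : ℝ) ^ 2

lemma hh_nonneg (k : ℕ) : 0 ≤ hh k := Finset.sum_nonneg (fun _ _ => by positivity)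
lemma hh_le (k : ℕ) : hh k ≤ k := by
  unfold hh
  calc _ ≤ ∑ n ∈ Finset.range k, (1:ℝ) := by
        apply Finset.sum_le_sum; intro i _
        rw [div_le_one (by positivity)]
        exact one_le_pow₀ (by linarith [(Nat.cast_nonneg i : (0:ℝ) ≤ i)])
    _ = k := by simp

lemma Q_bound (N : ℕ) (T : ℝ) (h0 : 0 ≤ T) (hT : T ≤ π/2) :
    0 ≤ 2/3 * T^4 - PS hh (N+2) T ∧ 2/3 * T^4 - PS hh (N+2) T ≤
      (4 * ((8 * (N+1) * sin T ^ (2 * (N+1))) * T^2/2) + (N+1) * (8 * (N+2)) * sin T ^ (2 * (N+2))) * T^2/2 := by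
  apply taylor_bound (fun x => 2/3 * x^4 - PS hh (N+2) x) (fun x => 8/3 * x^3 - PS1 hh (N+2) x)
    (fun x => 4 * (2 * x^2 - PS (fun _ => 1) (N+1) x) + hh (N+1) * (aC (N+1) * (4 * (N+2)^2)) * sin x ^ (2 * (N+2))) (by simp [PS_zero]) (by simp [PS1_zero])
  · intro x
    refine (((hasDerivAt_pow 4 x).const_mul (2/3)).sub (PS_deriv hh (N+2) x)).congr_deriv ?_
    push_cast; ring
  · intro x
    refine (((hasDerivAt_pow 3 x).const_mul (8/3)).sub (PS1_deriv hh (N+2) x)).congr_deriv ?_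
    rw [PS_tele]
    have : ∀ k ∈ Finset.range (N+1), (hh (k+1) - hh k) * (4 * ((k:ℝ)+1)^2) * aC k * sin x ^ (2 * (k+1)) = 4 * (1 * aC k * sin x ^ (2 * (k+1))) := by
      intro k _
      have : hh (k+1) - hh k = 1/((k:ℝ)+1)^2 := by unfold hh; rw [Finset.sum_range_succ]; ring
      rw [this]; field_simp
    rw [Finset.sum_congr rfl this, ← Finset.mul_sum, ← PS.eq_1 (fun _ => 1)]
    have h00 : hh 0 = 0 := by simp [hh]
    rw [h00]
    push_cast; ring
  · exact h0
  · intro x hx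
    obtain ⟨h1, h2⟩ := sin_pow_mono hx hT (2 * (N+1))
    obtain ⟨h3, h4⟩ := sin_pow_mono hx hT (2 * (N+2))
    obtain ⟨h5, h6⟩ := P_bound N x hx.1 (hx.2.trans hT)
    have := aC_pos (N+1)
    have h7 := hh_nonneg (N+1)
    have h8 := hh_le (N+1)
    have h9 := aC_bound (N+1)
    push_cast at h8 h9
    rw [show ((N:ℝ)+1+1) = N+2 by ring] at h9
    have hx0 := hx.1
    have hxT := hx.2
    refine ⟨by positivity, ?_⟩
    refine add_le_add ?_ ?_
    · have hsT := h1.trans h2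
      have : (8 * ((N:ℝ)+1) * sin x ^ (2 * (N+1))) * x^2/2 ≤ (8 * (N+1) * sin T ^ (2 * (N+1))) * T^2/2 := by gcongr
      linarith
    · gcongr

lemma lim_aux (s : ℝ) (h0 : 0 ≤ s) (h1 : s < 1) (j : ℕ) : Filter.Tendsto (fun N : ℕ => ((N:ℝ)) ^ j * s ^ (2 * (N))) Filter.atTop (nhds 0) := by
  have := tendsto_pow_const_mul_const_pow_of_abs_lt_one (r := s^2) j (by rw [abs_of_nonneg (by positivity)]; exact pow_lt_one₀ h0 h1 (by norm_num))
  simpa only [pow_mul] using this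

lemma hasSum_P (T : ℝ) (h0 : 0 ≤ T) (hT : T < π/2) : HasSum (fun k => aC k * sin T ^ (2 * (k+1))) (2 * T^2) := by
  have hs0 : 0 ≤ sin T := sin_nonneg_of_nonneg_of_le_pi h0 (by linarith [pi_pos])
  have hs1 : sin T < 1 := by
    rw [← sin_pi_div_two]; exact sin_lt_sin_of_lt_of_le_pi_div_two (by linarith [pi_pos]) le_rfl hT
  rw [hasSum_iff_tendsto_nat_of_nonneg (fun k => by have := aC_pos k; positivity)]
  rw [← Filter.tendsto_add_atTop_iff_nat 1]
  have e : ∀ N, ∑ k ∈ Finset.range (N+1), aC k * sin T ^ (2 * (k+1)) = 2 * T^2 - (2 * T^2 - PS (fun _ => 1) (N+1) T) := by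
    intro N; simp [PS]
  simp_rw [e]
  have : Filter.Tendsto (fun N : ℕ => 2 * T^2 - PS (fun _ => 1) (N+1) T) Filter.atTop (nhds 0) := by
    refine squeeze_zero (fun N => (P_bound N T h0 hT.le).1) (fun N => (P_bound N T h0 hT.le).2) ?_
    have := ((Filter.tendsto_add_atTop_iff_nat 1).2 (lim_aux (sin T) hs0 hs1 1)).const_mul (8 * T^2/2)
    rw [mul_zero] at this
    refine this.congr (fun N => ?_)
    push_cast; ring
  have := this.const_sub (2 * T^2)
  rwa [sub_zero] at this

lemma hasSum_Q (T : ℝ) (h0 : 0 ≤ T) (hT : T < π/2) : HasSum (fun k => hh k * aC k * sin T ^ (2 * (k+1))) (2/3 * T^4) := by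
  have hs0 : 0 ≤ sin T := sin_nonneg_of_nonneg_of_le_pi h0 (by linarith [pi_pos])
  have hs1 : sin T < 1 := by
    rw [← sin_pi_div_two]; exact sin_lt_sin_of_lt_of_le_pi_div_two (by linarith [pi_pos]) le_rfl hT
  rw [hasSum_iff_tendsto_nat_of_nonneg (fun k => by have := aC_pos k; have := hh_nonneg k; positivity)]
  rw [← Filter.tendsto_add_atTop_iff_nat 2]
  have e : ∀ N, ∑ k ∈ Finset.range (N+2), hh k * aC k * sin T ^ (2 * (k+1)) = 2/3 * T^4 - (2/3 * T^4 - PS hh (N+2) T) := by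
    intro N; simp [PS]
  simp_rw [e]
  have : Filter.Tendsto (fun N : ℕ => 2/3 * T^4 - PS hh (N+2) T) Filter.atTop (nhds 0) := by
    refine squeeze_zero (fun N => (Q_bound N T h0 hT.le).1) (fun N => (Q_bound N T h0 hT.le).2) ?_
    have t1 := ((Filter.tendsto_add_atTop_iff_nat 1).2 (lim_aux (sin T) hs0 hs1 1)).const_mul (8 * T^4)
    have t2 := ((Filter.tendsto_add_atTop_iff_nat 2).2 (lim_aux (sin T) hs0 hs1 2)).const_mul (4 * T^2)
    have t3 := ((Filter.tendsto_add_atTop_iff_nat 2).2 (lim_aux (sin T) hs0 hs1 1)).const_mul (-4 * T^2)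
    have := (t1.add t2).add t3
    simp only [mul_zero, add_zero] at this
    refine this.congr (fun N => ?_)
    push_cast; ring
  have := this.const_sub (2/3 * T^4)
  rwa [sub_zero] at this

lemma summable_aC : Summable aC := by
  apply summable_of_sum_range_le (c := 2 * (π/2)^2) (fun k => (aC_pos k).le)
  intro n
  have := (P_bound n (π/2) (by positivity) le_rfl).1
  simp [PS] at this
  rw [Finset.sum_range_succ] at this
  have := (aC_pos n).le
  linarith

lemma summable_haC : Summable (fun k => hh k * aC k) := by
  have hn : ∀ k, 0 ≤ hh k * aC k := fun k => mul_nonneg (hh_nonneg k) (aC_pos k).le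
  apply summable_of_sum_range_le (c := 2/3 * (π/2)^4) hn
  intro n
  have := (Q_bound n (π/2) (by positivity) le_rfl).1
  simp [PS] at this
  rw [Finset.sum_range_succ, Finset.sum_range_succ] at this
  have := hn n
  have := hn (n+1)
  linarith


lemma log_bound {u t : ℝ} (hu : 0 < u) (hu1 : u ≤ 1) (hut : u ≤ t) (ht : t ≤ 2) :
    |log t| ≤ 8 * u ^ (-(1/8) : ℝ) := by
  have h1 := abs_log_mul_self_rpow_lt u (1/8) hu hu1 (by norm_num)
  have h2 : 1 ≤ u ^ (-(1/8) : ℝ) := one_le_rpow_of_pos_of_le_one_of_nonpos hu hu1 (by norm_num)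
  have h3 : |log u| ≤ 8 * u ^ (-(1/8) : ℝ) := by
    rw [abs_mul, abs_of_pos (rpow_pos_of_pos hu (1/8))] at h1
    rw [rpow_neg hu.le, ← div_eq_mul_inv, le_div_iff₀ (rpow_pos_of_pos hu _)]
    linarith
  have hl : log u ≤ log t := log_le_log hu hut
  have hl2 : log t ≤ log 2 := log_le_log (by linarith) ht
  have := log_two_lt_d9
  rw [abs_le]
  constructor
  · linarith [neg_abs_le (log u)]
  · linarith

lemma rpow_eighth_pow {u : ℝ} (hu : 0 < u) (hu1 : u ≤ 1) {n : ℕ} (hn : n ≤ 4) :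
    (u ^ (-(1/8) : ℝ)) ^ n ≤ u ^ (-(1/2) : ℝ) := by
  have h2 : 1 ≤ u ^ (-(1/8) : ℝ) := one_le_rpow_of_pos_of_le_one_of_nonpos hu hu1 (by norm_num)
  calc _ ≤ (u ^ (-(1/8) : ℝ)) ^ 4 := pow_le_pow_right₀ h2 hn
    _ = _ := by rw [← rpow_natCast, ← rpow_mul hu.le]; norm_num

lemma log_pow_bound {u t : ℝ} (hu : 0 < u) (hu1 : u ≤ 1) (hut : u ≤ t) (ht : t ≤ 2) {n : ℕ} (hn : n ≤ 4) :
    |log t| ^ n ≤ 4096 * u ^ (-(1/2) : ℝ) := by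
  calc |log t| ^ n ≤ (8 * u ^ (-(1/8) : ℝ)) ^ n := pow_le_pow_left₀ (abs_nonneg _) (log_bound hu hu1 hut ht) n
    _ = 8 ^ n * (u ^ (-(1/8) : ℝ)) ^ n := by rw [mul_pow]
    _ ≤ 8 ^ 4 * u ^ (-(1/2) : ℝ) := by
        gcongr
        · norm_num
        · exact rpow_eighth_pow hu hu1 hn
    _ = _ := by norm_num

lemma int_half : MeasureTheory.IntegrableOn (fun x : ℝ => (2/π * x) ^ (-(1/2) : ℝ)) (Set.Ioo 0 (π/2)) := by
  have h : IntervalIntegrable (fun x : ℝ => x ^ (-(1/2) : ℝ)) MeasureTheory.volume 0 (2/π * (π/2)) :=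
    intervalIntegral.intervalIntegrable_rpow' (by norm_num)
  have h2 := h.comp_mul_left (c := 2/π)
  simp only [zero_div] at h2
  rw [mul_div_cancel_left₀ _ (by positivity)] at h2
  rw [intervalIntegrable_iff_integrableOn_Ioo_of_le (by positivity)] at h2
  exact h2

lemma sin_u {x : ℝ} (hx : x ∈ Set.Ioo 0 (π/2)) : 0 < 2/π * x ∧ 2/π * x ≤ 1 ∧ 2/π * x ≤ sin x ∧ sin x ≤ 2 ∧ 0 < sin x ∧ 0 < cos x := by
  have hp := pi_pos
  have h1 := mul_le_sin hx.1.le hx.2.le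
  have hx1 := hx.1
  have h0 : 0 < 2/π * x := by positivity
  refine ⟨h0, ?_, h1, by linarith [sin_le_one x], by linarith, cos_pos_of_mem_Ioo ⟨by linarith, hx.2⟩⟩
  exact h1.trans (sin_le_one x)

lemma sinInt (g : ℝ → ℝ) (hg : Measurable g) (C : ℝ) (hC : ∀ x ∈ Set.Ioo 0 (π/2), |g x| ≤ C) (n : ℕ) (hn : n ≤ 4) :
    MeasureTheory.IntegrableOn (fun x : ℝ => g x * log (sin x) ^ n) (Set.Ioo 0 (π/2)) := by
  refine MeasureTheory.Integrable.mono' (int_half.const_mul (C * 4096)) ?_ ?_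
  · exact (hg.mul ((measurable_log.comp measurable_sin).pow_const n)).aestronglyMeasurable
  · rw [MeasureTheory.ae_restrict_iff' measurableSet_Ioo]
    refine Filter.Eventually.of_forall (fun x hx => ?_)
    obtain ⟨h1, h2, h3, h4, _⟩ := sin_u hx
    rw [norm_mul, norm_pow, Real.norm_eq_abs, Real.norm_eq_abs, mul_assoc]
    have := hC x hx
    exact mul_le_mul this (log_pow_bound h1 h2 h3 h4 hn) (by positivity) ((abs_nonneg _).trans this)

lemma moment1 (k : ℕ) : ∫ x in Set.Ioo 0 (π/2), sin x ^ (2 * k + 1) * cos x = 1 / (2 * (k+1)) := by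
  rw [← MeasureTheory.integral_Ioc_eq_integral_Ioo, ← intervalIntegral.integral_of_le (by positivity)]
  rw [intervalIntegral.integral_eq_sub_of_hasDerivAt (f := fun x => sin x ^ (2 * k + 2) / (2 * (k+1)))]
  · simp
  · intro x _
    refine (((hasDerivAt_sin x).pow (2 * k+2)).div_const _).congr_deriv ?_
    rw [show 2 * k + 2 - 1 = 2 * k + 1 by omega]
    push_cast
    field_simp
  · apply Continuous.intervalIntegrable; fun_prop

lemma moment2_int (k : ℕ) : MeasureTheory.IntegrableOn (fun x => sin x ^ (2 * k + 1) * cos x * log (sin x) ^ 2) (Set.Ioo 0 (π/2)) := by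
  apply sinInt (fun x => sin x ^ (2 * k + 1) * cos x) (by fun_prop) 1 _ 2 (by norm_num)
  intro x hx
  rw [abs_mul, abs_pow]
  have := abs_sin_le_one x
  have := abs_cos_le_one x
  exact mul_le_one₀ (pow_le_one₀ (abs_nonneg _) (abs_sin_le_one x)) (abs_nonneg _) (abs_cos_le_one x)

lemma moment2 (k : ℕ) : ∫ x in Set.Ioo 0 (π/2), sin x ^ (2 * k + 1) * cos x * log (sin x) ^ 2 = 1 / (4 * (k+1)^3) := by
  rw [← MeasureTheory.integral_Ioc_eq_integral_Ioo, ← intervalIntegral.integral_of_le (by positivity)]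
  rw [intervalIntegral.integral_eq_sub_of_hasDerivAt_of_le (f := fun x => sin x ^ (2 * k) * (sin x * log (sin x)) ^ 2 / (2 * (k+1))
    - 2 * (sin x ^ (2 * k + 1) * (sin x * log (sin x))) / (2 * (k+1))^2 + 2 * sin x ^ (2 * k + 2) / (2 * (k+1))^3) (by positivity)]
  · simp; field_simp; norm_num
  · apply Continuous.continuousOn
    have : Continuous (fun x => sin x * log (sin x)) := Real.continuous_mul_log.comp continuous_sin
    fun_prop
  · intro x hx
    obtain ⟨_, _, _, _, hs, hc⟩ := sin_u hx
    have hl := (hasDerivAt_sin x).log hs.ne'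
    have hm := (hasDerivAt_sin x).fun_mul hl
    have h1 := ((((hasDerivAt_sin x).fun_pow (2 * k)).fun_mul (hm.fun_pow 2)).div_const (2 * ((k:ℝ)+1)))
    have h2 := ((((hasDerivAt_sin x).fun_pow (2 * k + 1)).fun_mul hm).const_mul 2).div_const ((2 * ((k:ℝ)+1))^2)
    have h3 := (((hasDerivAt_sin x).fun_pow (2 * k + 2)).const_mul 2).div_const ((2 * ((k:ℝ)+1))^3)
    refine ((h1.fun_sub h2).fun_add h3).congr_deriv ?_
    rw [show 2 * k + 2 - 1 = 2 * k + 1 by omega, show 2 * k + 1 - 1 = 2 * k by omega]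
    have hk : (↑(2 * k) : ℝ) * sin x ^ (2 * k - 1) = 2 * k * sin x ^ (2 * k) / sin x := by
      rcases Nat.eq_zero_or_pos k with h | h
      · simp [h]
      · rw [eq_div_iff hs.ne', mul_assoc, ← pow_succ, show 2 * k - 1 + 1 = 2 * k by omega]; push_cast; ring
    rw [hk]
    push_cast
    rw [pow_succ (sin x) (2 * k)]
    generalize sin x ^ (2 * k) = p
    field_simp
    ring
  · rw [intervalIntegrable_iff_integrableOn_Ioo_of_le (by positivity)]
    exact moment2_int k

lemma series1 : HasSum (fun k => hh k * aC k / (k+1)) (∫ x in Set.Ioo 0 (π/2), 4/3 * x^4 * cos x / sin x) := by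
  have key := MeasureTheory.hasSum_integral_of_summable_integral_norm (μ := MeasureTheory.volume.restrict (Set.Ioo 0 (π/2)))
    (F := fun k x => 2 * (hh k * aC k) * (sin x ^ (2 * k + 1) * cos x)) ?_ ?_
  · convert! key using 1
    · funext k
      rw [MeasureTheory.integral_const_mul, moment1]; field_simp
    · apply MeasureTheory.setIntegral_congr_fun measurableSet_Ioo
      intro x hx
      obtain ⟨_, _, _, _, hs, hc⟩ := sin_u hx
      have := ((hasSum_Q x hx.1.le hx.2).mul_left (2 * cos x / sin x)).tsum_eq
      simp only
      rw [show 4/3 * x^4 * cos x / sin x = (2 * cos x / sin x) * (2/3 * x^4) by ring, ← this]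
      congr 1; funext k
      rw [show 2 * (k+1) = 2 * k + 1 + 1 by ring, pow_succ]
      field_simp
  · intro k
    apply MeasureTheory.Integrable.const_mul
    apply MeasureTheory.IntegrableOn.mono_set (t := Set.Icc 0 (π/2)) _ Set.Ioo_subset_Icc_self
    apply Continuous.integrableOn_Icc; fun_prop
  · refine summable_haC.of_nonneg_of_le (fun k => by positivity) (fun k => ?_)
    have e : ∫ x in Set.Ioo 0 (π/2), ‖2 * (hh k * aC k) * (sin x ^ (2 * k + 1) * cos x)‖ = 2 * (hh k * aC k) * (1/(2 * (k+1))) := by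
      rw [← moment1, ← MeasureTheory.integral_const_mul]
      apply MeasureTheory.setIntegral_congr_fun measurableSet_Ioo
      intro x hx
      obtain ⟨_, _, _, _, hs, hc⟩ := sin_u hx
      have := aC_pos k
      have := hh_nonneg k
      simp only
      rw [Real.norm_of_nonneg (by positivity)]
    rw [e]
    have : 0 ≤ hh k * aC k := mul_nonneg (hh_nonneg k) (aC_pos k).le
    rw [mul_one_div, div_le_iff₀ (by positivity)]
    nlinarith [mul_nonneg this (Nat.cast_nonneg k : (0:ℝ) ≤ k)]

lemma series2 : HasSum (fun k => aC k / (k+1)^3) (∫ x in Set.Ioo 0 (π/2), 8 * x^2 * cos x / sin x * log (sin x) ^ 2) := by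
  have key := MeasureTheory.hasSum_integral_of_summable_integral_norm (μ := MeasureTheory.volume.restrict (Set.Ioo 0 (π/2)))
    (F := fun k x => 4 * aC k * (sin x ^ (2 * k + 1) * cos x * log (sin x) ^ 2)) ?_ ?_
  · convert! key using 1
    · funext k
      rw [MeasureTheory.integral_const_mul, moment2]; field_simp
    · apply MeasureTheory.setIntegral_congr_fun measurableSet_Ioo
      intro x hx
      obtain ⟨_, _, _, _, hs, hc⟩ := sin_u hx
      have := ((hasSum_P x hx.1.le hx.2).mul_left (4 * cos x / sin x * log (sin x) ^ 2)).tsum_eq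
      simp only
      rw [show 8 * x^2 * cos x / sin x * log (sin x) ^ 2 = (4 * cos x / sin x * log (sin x) ^ 2) * (2 * x^2) by ring, ← this]
      congr 1; funext k
      rw [show 2 * (k+1) = 2 * k + 1 + 1 by ring, pow_succ]
      field_simp
      ring
  · intro k
    exact (moment2_int k).const_mul _
  · refine summable_aC.of_nonneg_of_le (fun k => by positivity) (fun k => ?_)
    have e : ∫ x in Set.Ioo 0 (π/2), ‖4 * aC k * (sin x ^ (2 * k + 1) * cos x * log (sin x) ^ 2)‖ = 4 * aC k * (1/(4 * (k+1)^3)) := by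
      rw [← moment2, ← MeasureTheory.integral_const_mul]
      apply MeasureTheory.setIntegral_congr_fun measurableSet_Ioo
      intro x hx
      obtain ⟨_, _, _, _, hs, hc⟩ := sin_u hx
      have := aC_pos k
      simp only
      rw [Real.norm_of_nonneg (by positivity)]
    rw [e]
    have := aC_pos k
    have h1 : (1:ℝ) ≤ (k+1)^3 := one_le_pow₀ (by linarith [(Nat.cast_nonneg k : (0:ℝ) ≤ k)])
    rw [mul_one_div, div_le_iff₀ (by positivity)]
    nlinarith

/-- the sum as an integral of log-sines -/
lemma series_eq : HasSum (fun k => aC k * (hh (k+1)) / (k+1)) (-(16/3) * ∫ x in Set.Ioo 0 (π/2), (x * log (sin x) ^ 3 + x^3 * log (sin x))) := by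
  have h := series1.add series2
  have hp := pi_pos
  have xcot : ∀ x ∈ Set.Ioo 0 (π/2), |x * (cos x / sin x)| ≤ π/2 := by
    intro x hx
    obtain ⟨_, _, h3, _, hs, hc⟩ := sin_u hx
    have hx0 := hx.1
    rw [abs_of_nonneg (by positivity), mul_div_assoc', div_le_iff₀ hs]
    have : x * cos x ≤ x * 1 := by gcongr; exact cos_le_one x
    have h4 : π/2 * (2/π * x) = x := by field_simp
    nlinarith [mul_le_mul_of_nonneg_left h3 (by positivity : 0 ≤ π/2)]
  have mcot : Measurable (fun x => x * (cos x / sin x)) := by fun_prop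
  have bx : ∀ x ∈ Set.Ioo 0 (π/2), ∀ n : ℕ, |x ^ n| ≤ (π/2)^n := by
    intro x hx n
    have := hx.1
    have := hx.2
    rw [abs_of_nonneg (by positivity)]
    gcongr
  have i1 : MeasureTheory.IntegrableOn (fun x => 4/3 * x^4 * cos x / sin x) (Set.Ioo 0 (π/2)) := by
    have := sinInt (fun x => (4/3 * x^3) * (x * (cos x / sin x))) (by fun_prop) ((4/3 * (π/2)^3) * (π/2)) (fun x hx => by
      rw [abs_mul, abs_mul]
      gcongr
      · norm_num
      · exact bx x hx 3
      · exact xcot x hx) 0 (by norm_num)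
    refine this.congr_fun (fun x hx => ?_) measurableSet_Ioo
    simp only [pow_zero]; ring
  have i2 : MeasureTheory.IntegrableOn (fun x => 8 * x^2 * cos x / sin x * log (sin x) ^ 2) (Set.Ioo 0 (π/2)) := by
    have := sinInt (fun x => (8 * x^1) * (x * (cos x / sin x))) (by fun_prop) ((8 * (π/2)^1) * (π/2)) (fun x hx => by
      rw [abs_mul, abs_mul]
      gcongr
      · norm_num
      · exact bx x hx 1
      · exact xcot x hx) 2 (by norm_num)
    refine this.congr_fun (fun x hx => ?_) measurableSet_Ioo
    simp only; ring
  have i3 : MeasureTheory.IntegrableOn (fun x => x * log (sin x) ^ 3) (Set.Ioo 0 (π/2)) := by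
    refine sinInt (fun x => x) (by fun_prop) (π/2) (fun x hx => ?_) 3 (by norm_num)
    simpa using bx x hx 1
  have i4 : MeasureTheory.IntegrableOn (fun x => x^3 * log (sin x)) (Set.Ioo 0 (π/2)) := by
    have := sinInt (fun x => x^3) (by fun_prop) ((π/2)^3) (fun x hx => bx x hx 3) 1 (by norm_num)
    simpa using this
  have ftc : ∫ x in Set.Ioo 0 (π/2), ((16/3) * (x * log (sin x) ^ 3 + x^3 * log (sin x)) + (4/3 * x^4 * cos x / sin x + 8 * x^2 * cos x / sin x * log (sin x) ^ 2)) = 0 := by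
    rw [← MeasureTheory.integral_Ioc_eq_integral_Ioo, ← intervalIntegral.integral_of_le (by positivity)]
    rw [intervalIntegral.integral_eq_sub_of_hasDerivAt_of_le (f := fun x => 4/3 * (x^4 * log (sin x)) + 8/3 * (x^2 * log (sin x) ^ 3)) (by positivity)]
    · simp
    · intro x hx
      rcases hx.1.eq_or_lt with h0 | h0
      · subst h0
        have hz : Filter.Tendsto (fun x : ℝ => 4096 * (π/2) * ((4/3) * |x|^3 + 8/3 * |x|^1) * (2/π * |x|) ^ (1/2 : ℝ)) (nhdsWithin 0 (Set.Icc 0 (π/2))) (nhds 0) := by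
          have hc : ContinuousAt (fun x : ℝ => 4096 * (π/2) * ((4/3) * |x|^3 + 8/3 * |x|^1) * (2/π * |x|) ^ (1/2 : ℝ)) 0 := by
            apply ContinuousAt.mul (by fun_prop)
            apply ContinuousAt.rpow_const (by fun_prop) (by right; norm_num)
          have := hc.tendsto
          simp at this
          have t2 : Filter.Tendsto _ (nhdsWithin 0 (Set.Icc 0 (π/2))) _ := this.mono_left nhdsWithin_le_nhds
          simpa using t2
        unfold ContinuousWithinAt
        have e0 : 4/3 * ((0:ℝ)^4 * log (sin 0)) + 8/3 * ((0:ℝ)^2 * log (sin 0) ^ 3) = 0 := by simp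
        simp only [e0]
        refine squeeze_zero_norm' ?_ hz
        filter_upwards [self_mem_nhdsWithin, nhdsWithin_le_nhds (Iio_mem_nhds (show (0:ℝ) < π/2 by positivity))] with x hx hx2
        rcases hx.1.eq_or_lt with h00 | h00
        · rw [← h00]; simp
        · obtain ⟨h1, h2, h3, h4, hs, hc⟩ := sin_u ⟨h00, hx2⟩
          have b1 := log_pow_bound h1 h2 h3 h4 (n := 1) (by norm_num)
          have b3 := log_pow_bound h1 h2 h3 h4 (n := 3) (by norm_num)
          have eu : (2/π * x) ^ (1/2 : ℝ) = (2/π * x) * (2/π * x) ^ (-(1/2) : ℝ) := by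
            rw [← rpow_one_add' h1.le (by norm_num)]; norm_num
          rw [abs_of_pos h00, eu, Real.norm_eq_abs]
          calc _ ≤ |4/3 * (x^4 * log (sin x))| + |8/3 * (x^2 * log (sin x)^3)| := abs_add_le _ _
            _ = 4/3 * x^4 * |log (sin x)|^1 + 8/3 * x^2 * |log (sin x)|^3 := by
              simp only [abs_mul, abs_pow]; rw [abs_of_pos h00, abs_of_pos (by norm_num : (0:ℝ) < 4/3), abs_of_pos (by norm_num : (0:ℝ) < 8/3)]; ring
            _ ≤ 4/3 * x^4 * (4096 * (2/π * x) ^ (-(1/2) : ℝ)) + 8/3 * x^2 * (4096 * (2/π * x) ^ (-(1/2) : ℝ)) := by gcongr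
            _ = _ := by
              generalize (2/π * x) ^ (-(1/2) : ℝ) = q
              field_simp
      · apply ContinuousAt.continuousWithinAt
        have hs : sin x ≠ 0 := (sin_pos_of_pos_of_lt_pi h0 (by linarith [hx.2])).ne'
        fun_prop (disch := assumption)
    · intro x hx
      obtain ⟨_, _, h3, _, hs, hc⟩ := sin_u hx
      have hl := (hasDerivAt_sin x).log hs.ne'
      have h1 := (((hasDerivAt_pow 4 x).fun_mul hl).const_mul (4/3)).fun_add (((hasDerivAt_pow 2 x).fun_mul (hl.fun_pow 3)).const_mul (8/3))
      refine h1.congr_deriv ?_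
      push_cast
      field_simp
      ring
    · rw [intervalIntegrable_iff_integrableOn_Ioo_of_le (by positivity)]
      exact ((i3.add i4).const_mul _).add (i1.add i2)
  have i34 : MeasureTheory.IntegrableOn (fun x => (16/3) * (x * log (sin x) ^ 3 + x^3 * log (sin x))) (Set.Ioo 0 (π/2)) := (i3.add i4).const_mul _
  have i12 : MeasureTheory.IntegrableOn (fun x => (4/3 * x^4 * cos x / sin x + 8 * x^2 * cos x / sin x * log (sin x) ^ 2)) (Set.Ioo 0 (π/2)) := i1.add i2
  rw [MeasureTheory.integral_add i34 i12, MeasureTheory.integral_const_mul, MeasureTheory.integral_add i1 i2] at ftc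
  convert! h using 1
  · funext k
    have : hh (k+1) = hh k + 1/((k:ℝ)+1)^2 := by unfold hh; rw [Finset.sum_range_succ]
    rw [this]; field_simp
  · linarith


noncomputable def WW (r x : ℝ) : ℂ := Complex.log (1 + r * Complex.exp (2 * x * Complex.I))

noncomputable def fR (n : ℕ) (x : ℝ) : ℝ := ((log (1 + x) - log 2) ^ n - (-log 2) ^ n) / x

lemma norm_rexp (r x : ℝ) (hr : 0 ≤ r) : ‖(r:ℂ) * Complex.exp (2 * x * Complex.I)‖ = r := by
  rw [norm_mul, show (2 * x * Complex.I : ℂ) = ((2 * x : ℝ) : ℂ) * Complex.I by push_cast; ring, Complex.norm_exp_ofReal_mul_I]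
  simp [abs_of_nonneg hr]

lemma one_add_slit {z : ℂ} (hz : z ∈ Metric.ball (0:ℂ) 1) : 1 + z ∈ Complex.slitPlane := by
  left
  have h1 : ‖z‖ < 1 := by simpa using hz
  have h2 := Complex.abs_re_le_norm z
  have := neg_abs_le z.re
  simp; linarith

lemma arc (n : ℕ) (r : ℝ) (h0 : 0 < r) (h1 : r < 1) :
    ∫ x in (0:ℝ)..(π/2), ((WW r x - (log 2 : ℝ)) ^ n - (-((log 2 : ℝ):ℂ)) ^ n) = Complex.I / 2 * ((∫ x in (-r)..r, fR n x : ℝ) : ℂ) := by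
  set h : ℂ → ℂ := fun z => (Complex.log (1 + z) - (log 2 : ℝ)) ^ n with hh_def
  have hd : DifferentiableOn ℂ h (Metric.ball 0 1) := by
    intro z hz
    apply DifferentiableAt.differentiableWithinAt
    apply DifferentiableAt.pow
    apply DifferentiableAt.sub_const
    apply DifferentiableAt.clog (by fun_prop) (one_add_slit hz)
  have hg : DifferentiableOn ℂ (dslope h 0) (Metric.ball 0 1) :=
    (Complex.differentiableOn_dslope (Metric.ball_mem_nhds 0 one_pos)).2 hd
  obtain ⟨G, hG⟩ := hg.isExactOn_ball
  have hh0 : h 0 = (-((log 2 : ℝ):ℂ)) ^ n := by simp [hh_def]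
  -- arc
  have e1 : ∫ x in (0:ℝ)..(π/2), (2 * Complex.I) * ((WW r x - (log 2 : ℝ)) ^ n - (-((log 2 : ℝ):ℂ)) ^ n) = G (-r) - G r := by
    rw [intervalIntegral.integral_eq_sub_of_hasDerivAt (f := fun x : ℝ => G (r * Complex.exp (2 * x * Complex.I)))]
    · congr 2
      · rw [show (2 * ((π/2 : ℝ):ℂ) * Complex.I) = π * Complex.I by push_cast; ring, Complex.exp_pi_mul_I]; ring
      · simp
    · intro x _
      have hb : (r:ℂ) * Complex.exp (2 * x * Complex.I) ∈ Metric.ball (0:ℂ) 1 := by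
        simp only [mem_ball_zero_iff]; rw [norm_rexp r x h0.le]; exact h1
      have hx : HasDerivAt (fun x : ℝ => (r:ℂ) * Complex.exp (2 * x * Complex.I)) (r * (Complex.exp (2 * x * Complex.I) * (2 * 1 * Complex.I))) x := by
        apply HasDerivAt.const_mul
        apply HasDerivAt.cexp
        apply HasDerivAt.mul_const
        apply HasDerivAt.const_mul
        exact Complex.ofRealCLM.hasDerivAt
      have := (hG _ hb).comp x hx
      refine this.congr_deriv ?_
      have hne : (r:ℂ) * Complex.exp (2 * x * Complex.I) ≠ 0 := mul_ne_zero (by exact_mod_cast h0.ne') (Complex.exp_ne_zero _)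
      rw [dslope_of_ne _ hne, slope_def_field, hh0, hh_def]
      unfold WW
      field_simp
      ring
    · apply ContinuousOn.intervalIntegrable
      apply Continuous.continuousOn
      apply Continuous.mul continuous_const
      apply Continuous.sub _ continuous_const
      apply Continuous.pow
      apply Continuous.sub _ continuous_const
      unfold WW
      apply Continuous.clog (by fun_prop)
      intro x
      apply one_add_slit
      simp only [mem_ball_zero_iff]; rw [norm_rexp r x h0.le]; exact h1
  have e2 : ((∫ x in (-r)..r, fR n x : ℝ) : ℂ) = G r - G (-r) := by
    have : ∫ x in (-r)..r, dslope h 0 (x:ℂ) = G r - G (-r) := by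
      rw [intervalIntegral.integral_eq_sub_of_hasDerivAt (f := fun x : ℝ => G x)]
      · simp
      · intro x hx
        rw [Set.uIcc_of_le (by linarith)] at hx
        have hb : (x:ℂ) ∈ Metric.ball (0:ℂ) 1 := by
          simp; rw [abs_lt]; constructor <;> linarith [hx.1, hx.2]
        exact (hG _ hb).comp_ofReal
      · apply ContinuousOn.intervalIntegrable
        apply hg.continuousOn.comp Complex.continuous_ofReal.continuousOn
        intro x hx
        rw [Set.uIcc_of_le (by linarith)] at hx
        simp; rw [abs_lt]; constructor <;> linarith [hx.1, hx.2]
    rw [← this, ← intervalIntegral.integral_ofReal]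
    apply intervalIntegral.integral_congr_ae
    have hae : ∀ᵐ x : ℝ, x ≠ 0 := by
      rw [MeasureTheory.ae_iff]; simp
    filter_upwards [hae] with x hx0 hx
    rw [Set.uIoc_of_le (by linarith)] at hx
    rw [dslope_of_ne _ (by exact_mod_cast hx0), slope_def_field, hh0, hh_def]
    unfold fR
    push_cast
    rw [Complex.ofReal_log (by linarith [hx.1])]
    push_cast
    simp
  rw [intervalIntegral.integral_const_mul] at e1
  rw [e2]
  linear_combination (-Complex.I/2) * e1 + (∫ x in (0:ℝ)..(π/2), ((WW r x - (log 2 : ℝ)) ^ n - (-((log 2 : ℝ):ℂ)) ^ n)) * Complex.I_sq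

lemma cos_u {x : ℝ} (hx : x ∈ Set.Ioo 0 (π/2)) : 0 < 1 - 2/π * x ∧ 1 - 2/π * x ≤ 1 ∧ 1 - 2/π * x ≤ cos x ∧ 0 < cos x := by
  have hp := pi_pos
  have h1 := one_sub_mul_le_cos hx.1.le hx.2.le
  have hx1 := hx.1
  have h0 : 0 < 2/π * x := by positivity
  refine ⟨?_, by linarith, h1, cos_pos_of_mem_Ioo ⟨by linarith, hx.2⟩⟩
  have : 2/π * x < 2/π * (π/2) := by gcongr; exact hx.2
  have e : 2/π * (π/2) = 1 := by field_simp
  linarith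

lemma int_half_cos : IntervalIntegrable (fun x : ℝ => (1 - 2/π * x) ^ (-(1/2) : ℝ)) MeasureTheory.volume 0 (π/2) := by
  have h : IntervalIntegrable (fun x : ℝ => (2/π * x) ^ (-(1/2) : ℝ)) MeasureTheory.volume 0 (π/2) := by
    rw [intervalIntegrable_iff_integrableOn_Ioo_of_le (by positivity)]; exact int_half
  have h2 := (h.comp_sub_left (π/2)).symm
  simp only [sub_zero, sub_self] at h2
  refine h2.congr (fun x _ => ?_)
  have hp := pi_pos
  congr 1; field_simp

lemma rexp_re (r x : ℝ) : (1 + r * Complex.exp (2 * x * Complex.I)).re = 1 + r * cos (2 * x) := by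
  rw [show (2 * x * Complex.I : ℂ) = ((2 * x : ℝ) : ℂ) * Complex.I by push_cast; ring, Complex.add_re, Complex.re_ofReal_mul, Complex.exp_ofReal_mul_I_re, Complex.one_re]

lemma rexp_im (r x : ℝ) : (1 + r * Complex.exp (2 * x * Complex.I)).im = r * sin (2 * x) := by
  rw [show (2 * x * Complex.I : ℂ) = ((2 * x : ℝ) : ℂ) * Complex.I by push_cast; ring, Complex.add_im, Complex.im_ofReal_mul, Complex.exp_ofReal_mul_I_im, Complex.one_im, zero_add]

lemma W_norm {r x : ℝ} (hr : 1/4 ≤ r) (hr1 : r ≤ 1) (hx : x ∈ Set.Ioo 0 (π/2)) : ‖WW r x‖ ≤ 12 * (1 - 2/π * x) ^ (-(1/8) : ℝ) := by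
  obtain ⟨h1, h2, h3, h4⟩ := cos_u hx
  have hle : ‖1 + r * Complex.exp (2 * x * Complex.I)‖ ≤ 2 := by
    refine (norm_add_le _ _).trans ?_
    rw [norm_rexp r x (by linarith), norm_one]; linarith
  have hge : cos x ≤ ‖1 + r * Complex.exp (2 * x * Complex.I)‖ := by
    rw [← abs_of_pos h4, ← Real.norm_eq_abs]
    rw [← abs_norm (1 + r * Complex.exp (2 * x * Complex.I)), Real.norm_eq_abs]
    apply sq_le_sq.1
    rw [← Complex.normSq_eq_norm_sq, Complex.normSq_apply]
    rw [rexp_re, rexp_im]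
    have hs := Real.sin_sq_add_cos_sq (2 * x)
    have hc := Real.cos_two_mul x
    have : (1 + r * cos (2 * x)) * (1 + r * cos (2 * x)) + r * sin (2 * x) * (r * sin (2 * x)) = (1-r)^2 + 4 * r * cos x ^2 := by
      linear_combination r^2 * hs + 2 * r * hc
    rw [this]
    nlinarith [sq_nonneg (1-r), sq_nonneg (cos x)]
  have hl := log_bound h1 h2 (h3.trans hge) hle
  have h5 : 1 ≤ (1 - 2/π * x) ^ (-(1/8) : ℝ) := one_le_rpow_of_pos_of_le_one_of_nonpos h1 h2 (by norm_num)
  unfold WW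
  generalize 1 + r * Complex.exp (2 * x * Complex.I) = z at *
  rw [Complex.log]
  refine (norm_add_le _ _).trans ?_
  rw [norm_mul, Complex.norm_I, Complex.norm_real, Complex.norm_real, Real.norm_eq_abs, Real.norm_eq_abs]
  have := Complex.abs_arg_le_pi z
  linarith [pi_le_four]

lemma W_bound {r x c : ℝ} {n : ℕ} (hn : n ≤ 4) (hc : |c| ≤ 1) (hr : 1/4 ≤ r) (hr1 : r ≤ 1) (hx : x ∈ Set.Ioo 0 (π/2)) :
    ‖(WW r x - c) ^ n‖ ≤ 13^4 * (1 - 2/π * x) ^ (-(1/2) : ℝ) := by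
  obtain ⟨h1, h2, h3, h4⟩ := cos_u hx
  have h5 : 1 ≤ (1 - 2/π * x) ^ (-(1/8) : ℝ) := one_le_rpow_of_pos_of_le_one_of_nonpos h1 h2 (by norm_num)
  have h6 : ‖WW r x - c‖ ≤ 13 * (1 - 2/π * x) ^ (-(1/8) : ℝ) := by
    refine (norm_sub_le _ _).trans ?_
    rw [Complex.norm_real, Real.norm_eq_abs]
    linarith [W_norm hr hr1 hx]
  rw [norm_pow]
  calc _ ≤ (13 * (1 - 2/π * x) ^ (-(1/8) : ℝ)) ^ n := by gcongr
    _ = 13 ^ n * ((1 - 2/π * x) ^ (-(1/8) : ℝ)) ^ n := by rw [mul_pow]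
    _ ≤ _ := by
      gcongr
      · norm_num
      · exact rpow_eighth_pow h1 h2 hn

lemma one_add_exp (x : ℝ) : 1 + Complex.exp (2 * x * Complex.I) = ((2 * cos x : ℝ) : ℂ) * Complex.exp (x * Complex.I) := by
  have : Complex.exp (2 * x * Complex.I) = Complex.exp (x * Complex.I) * Complex.exp (x * Complex.I) := by
    rw [← Complex.exp_add]; congr 1; ring
  rw [this]
  push_cast
  rw [Complex.cos, show -(x:ℂ) * Complex.I = -(x * Complex.I) by ring, Complex.exp_neg]
  have := Complex.exp_ne_zero (x * Complex.I)
  field_simp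
  ring

lemma W_one {x : ℝ} (hx : x ∈ Set.Ioo 0 (π/2)) : WW 1 x = (log (cos x) : ℝ) + (log 2 : ℝ) + x * Complex.I := by
  obtain ⟨h1, h2, h3, h4⟩ := cos_u hx
  unfold WW
  rw [Complex.ofReal_one, one_mul, one_add_exp, Complex.log_ofReal_mul (by positivity) (Complex.exp_ne_zero _), Complex.log_exp]
  · rw [Real.log_mul (by norm_num) h4.ne']; push_cast; ring
  · simp; linarith [hx.1, pi_pos]
  · simp; linarith [hx.2, pi_pos]

lemma W_meas (r : ℝ) : Measurable (WW r) := by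
  unfold WW
  apply Complex.measurable_log.comp
  fun_prop

lemma W_int (w : ℝ → ℂ) (hw : Continuous w) (c : ℝ) (hc : |c| ≤ 1) (n : ℕ) (hn : n ≤ 4) (r : ℝ) (hr : 1/4 ≤ r) (hr1 : r ≤ 1) :
    IntervalIntegrable (fun x => w x * (WW r x - c) ^ n) MeasureTheory.volume 0 (π/2) := by
  obtain ⟨C, hC⟩ := (isCompact_Icc (a := (0:ℝ)) (b := π/2)).exists_bound_of_continuousOn hw.continuousOn
  have hb := int_half_cos.const_mul (C * 13^4)
  rw [intervalIntegrable_iff_integrableOn_Ioo_of_le (by positivity)] at hb ⊢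
  refine MeasureTheory.Integrable.mono' hb ?_ ?_
  · exact (hw.measurable.mul (((W_meas r).sub_const _).pow_const n)).aestronglyMeasurable
  · rw [MeasureTheory.ae_restrict_iff' measurableSet_Ioo]
    refine Filter.Eventually.of_forall (fun x hx => ?_)
    rw [norm_mul, mul_assoc]
    have h1 := hC x ⟨hx.1.le, hx.2.le⟩
    exact mul_le_mul h1 (W_bound hn hc hr hr1 hx) (norm_nonneg _) ((norm_nonneg _).trans h1)

lemma W_lim (w : ℝ → ℂ) (hw : Continuous w) (c : ℝ) (hc : |c| ≤ 1) (n : ℕ) (hn : n ≤ 4) :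
    Filter.Tendsto (fun r => ∫ x in (0:ℝ)..(π/2), w x * (WW r x - c) ^ n) (nhdsWithin 1 (Set.Iio 1))
      (nhds (∫ x in (0:ℝ)..(π/2), w x * (WW 1 x - c) ^ n)) := by
  obtain ⟨C, hC⟩ := (isCompact_Icc (a := (0:ℝ)) (b := π/2)).exists_bound_of_continuousOn hw.continuousOn
  have hae : ∀ᵐ x : ℝ, x ≠ π/2 := by
    rw [MeasureTheory.ae_iff]; simp
  apply intervalIntegral.tendsto_integral_filter_of_dominated_convergence (fun x => C * 13^4 * (1 - 2/π * x) ^ (-(1/2) : ℝ))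
  · exact Filter.Eventually.of_forall (fun r => (hw.measurable.mul (((W_meas r).sub_const _).pow_const n)).aestronglyMeasurable)
  · filter_upwards [self_mem_nhdsWithin, nhdsWithin_le_nhds (Ioi_mem_nhds (show (1/4:ℝ) < 1 by norm_num))] with r hr1 hr
    filter_upwards [hae] with x hx0 hx
    rw [Set.uIoc_of_le (by positivity)] at hx
    have hx' : x ∈ Set.Ioo 0 (π/2) := ⟨hx.1, lt_of_le_of_ne hx.2 hx0⟩
    rw [norm_mul, mul_assoc]
    have h1 := hC x ⟨hx.1.le, hx.2⟩
    exact mul_le_mul h1 (W_bound hn hc (le_of_lt hr) (le_of_lt hr1) hx') (norm_nonneg _) ((norm_nonneg _).trans h1)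
  · exact int_half_cos.const_mul (C * 13^4)
  · filter_upwards [hae] with x hx0 hx
    rw [Set.uIoc_of_le (by positivity)] at hx
    have hx' : x ∈ Set.Ioo 0 (π/2) := ⟨hx.1, lt_of_le_of_ne hx.2 hx0⟩
    obtain ⟨h1, h2, h3, h4⟩ := cos_u hx'
    have hcont : ContinuousAt (fun r : ℝ => w x * (WW r x - c) ^ n) 1 := by
      unfold WW
      apply ContinuousAt.mul continuousAt_const
      apply ContinuousAt.pow
      apply ContinuousAt.sub _ continuousAt_const
      apply ContinuousAt.clog (by fun_prop)
      left
      rw [rexp_re, Real.cos_two_mul]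
      nlinarith
    exact hcont.tendsto.mono_left nhdsWithin_le_nhds


lemma cosInt (g : ℝ → ℝ) (hg : Continuous g) (n : ℕ) (hn : n ≤ 4) :
    IntervalIntegrable (fun x : ℝ => g x * log (cos x) ^ n) MeasureTheory.volume 0 (π/2) := by
  obtain ⟨C, hC⟩ := (isCompact_Icc (a := (0:ℝ)) (b := π/2)).exists_bound_of_continuousOn hg.continuousOn
  have hb := int_half_cos.const_mul (C * 4096)
  rw [intervalIntegrable_iff_integrableOn_Ioo_of_le (by positivity)] at hb ⊢
  refine MeasureTheory.Integrable.mono' hb ?_ ?_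
  · exact (hg.measurable.mul ((measurable_log.comp measurable_cos).pow_const n)).aestronglyMeasurable
  · rw [MeasureTheory.ae_restrict_iff' measurableSet_Ioo]
    refine Filter.Eventually.of_forall (fun x hx => ?_)
    obtain ⟨h1, h2, h3, h4⟩ := cos_u hx
    rw [norm_mul, norm_pow, Real.norm_eq_abs (log _), mul_assoc]
    have := hC x ⟨hx.1.le, hx.2.le⟩
    exact mul_le_mul this (log_pow_bound h1 h2 h3 (by linarith [cos_le_one x]) hn) (by positivity) ((norm_nonneg _).trans this)

lemma log2_abs : |log 2| ≤ 1 := by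
  rw [abs_of_pos (log_pos (by norm_num))]; linarith [log_two_lt_d9]

lemma arc' (n : ℕ) (hn : n ≤ 4) (r : ℝ) (h0 : 1/4 ≤ r) (h1 : r < 1) :
    ∫ x in (0:ℝ)..(π/2), 1 * (WW r x - (log 2 : ℝ)) ^ n = (((-log 2) ^ n * (π/2) : ℝ) : ℂ) + Complex.I / 2 * ((∫ x in (-r)..r, fR n x : ℝ) : ℂ) := by
  rw [← arc n r (by linarith) h1, intervalIntegral.integral_sub]
  · simp; ring
  · have := W_int (fun _ => 1) continuous_const (log 2) log2_abs n hn r h0 h1.le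
    simpa only [one_mul] using this
  · simp

lemma ev_r : ∀ᶠ r : ℝ in nhdsWithin 1 (Set.Iio 1), 1/4 ≤ r ∧ r < 1 := by
  filter_upwards [self_mem_nhdsWithin, nhdsWithin_le_nhds (Ioi_mem_nhds (show (1/4:ℝ) < 1 by norm_num))] with r hr1 hr
  exact ⟨le_of_lt hr, hr1⟩

lemma hae2 : ∀ᵐ x : ℝ, x ≠ π/2 := by
  rw [MeasureTheory.ae_iff]; simp

lemma int_n3 : ∫ x in (0:ℝ)..(π/2), (log (cos x) ^ 3 - 3 * x^2 * log (cos x)) = - log 2 ^ 3 * (π/2) := by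
  have hl := W_lim (fun _ => 1) continuous_const (log 2) log2_abs 3 (by norm_num)
  have hi := W_int (fun _ => 1) continuous_const (log 2) log2_abs 3 (by norm_num) 1 (by norm_num) le_rfl
  have hre := (Complex.continuous_re.tendsto _).comp hl
  have hconst : Filter.Tendsto (Complex.re ∘ fun r => ∫ x in (0:ℝ)..(π/2), 1 * (WW r x - (log 2 : ℝ)) ^ 3) (nhdsWithin 1 (Set.Iio 1)) (nhds ((-log 2) ^ 3 * (π/2))) := by
    refine Filter.Tendsto.congr' ?_ tendsto_const_nhds
    filter_upwards [ev_r] with r hr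
    simp only [Function.comp]
    rw [arc' 3 (by norm_num) r hr.1 hr.2]
    rw [Complex.add_re, Complex.ofReal_re]
    simp
  have huniq := tendsto_nhds_unique hre hconst
  have hcomm := Complex.reCLM.intervalIntegral_comp_comm hi
  simp only [Complex.reCLM_apply] at hcomm
  rw [← hcomm] at huniq
  rw [show - log 2 ^ 3 * (π/2) = (-log 2) ^ 3 * (π/2) by ring, ← huniq]
  apply intervalIntegral.integral_congr_ae
  filter_upwards [hae2] with x hx0 hx
  rw [Set.uIoc_of_le (by positivity)] at hx
  have hx' : x ∈ Set.Ioo 0 (π/2) := ⟨hx.1, lt_of_le_of_ne hx.2 hx0⟩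
  rw [W_one hx']
  generalize log (cos x) = c
  rw [show ((1:ℂ) * (c + (log 2 : ℝ) + x * Complex.I - (log 2 : ℝ)) ^ 3) = ((c^3 - 3 * x^2 * c : ℝ):ℂ) + ((3 * c^2 * x - x^3 : ℝ) : ℂ) * Complex.I by
    push_cast
    linear_combination (3 * c * x^2 + x^3 * Complex.I : ℂ) * Complex.I_sq]
  simp [-Complex.ofReal_sub, -Complex.ofReal_mul, -Complex.ofReal_pow]

lemma int_n4 (J : ℝ) (hJ : Filter.Tendsto (fun r => ∫ x in (-r)..r, fR 4 x) (nhdsWithin 1 (Set.Iio 1)) (nhds J)) :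
    ∫ x in (0:ℝ)..(π/2), (4 * (x * log (cos x) ^ 3 - x^3 * log (cos x))) = J / 2 := by
  have hl := W_lim (fun _ => 1) continuous_const (log 2) log2_abs 4 (by norm_num)
  have hi := W_int (fun _ => 1) continuous_const (log 2) log2_abs 4 (by norm_num) 1 (by norm_num) le_rfl
  have hre := (Complex.continuous_im.tendsto _).comp hl
  have hconst : Filter.Tendsto (Complex.im ∘ fun r => ∫ x in (0:ℝ)..(π/2), 1 * (WW r x - (log 2 : ℝ)) ^ 4) (nhdsWithin 1 (Set.Iio 1)) (nhds (J/2)) := by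
    refine Filter.Tendsto.congr' ?_ (hJ.div_const 2)
    filter_upwards [ev_r] with r hr
    simp only [Function.comp]
    rw [arc' 4 (by norm_num) r hr.1 hr.2]
    rw [Complex.add_im, Complex.ofReal_im]
    simp; ring
  have huniq := tendsto_nhds_unique hre hconst
  have hcomm := Complex.imCLM.intervalIntegral_comp_comm hi
  simp only [Complex.imCLM_apply] at hcomm
  rw [← hcomm] at huniq
  rw [← huniq]
  apply intervalIntegral.integral_congr_ae
  filter_upwards [hae2] with x hx0 hx
  rw [Set.uIoc_of_le (by positivity)] at hx
  have hx' : x ∈ Set.Ioo 0 (π/2) := ⟨hx.1, lt_of_le_of_ne hx.2 hx0⟩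
  rw [W_one hx']
  generalize log (cos x) = c
  rw [show ((1:ℂ) * (c + (log 2 : ℝ) + x * Complex.I - (log 2 : ℝ)) ^ 4) = ((c^4 - 6 * x^2 * c^2 + x^4 : ℝ):ℂ) + ((4 * (x * c^3 - x^3 * c) : ℝ) : ℂ) * Complex.I by
    push_cast
    linear_combination (6 * c^2 * x^2 + 4 * c * x^3 * Complex.I + x^4 * (Complex.I^2 - 1) : ℂ) * Complex.I_sq]
  simp [-Complex.ofReal_sub, -Complex.ofReal_mul, -Complex.ofReal_pow, -Complex.ofReal_add]

/-- Fourier moments -/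
noncomputable def mom (b n : ℕ) : ℝ := ∫ x in (0:ℝ)..(π/2), x ^ b * cos (2 * n * x)

lemma fourier_r (b : ℕ) (r : ℝ) (h0 : 0 ≤ r) (h1 : r < 1) :
    HasSum (fun n : ℕ => (-1) ^ (n+1) * r ^ n / n * mom b n) (∫ x in (0:ℝ)..(π/2), x^b * (WW r x).re) := by
  have key := intervalIntegral.hasSum_integral_of_dominated_convergence (μ := MeasureTheory.volume) (a := 0) (b := π/2)
    (F := fun (n : ℕ) x => x^b * ((-1) ^ (n+1) * r ^ n / n * cos (2 * n * x))) (f := fun x => x^b * (WW r x).re)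
    (bound := fun n x => |x|^b * r^n) ?_ ?_ ?_ ?_ ?_
  · convert! key using 1
    funext n
    unfold mom
    rw [← intervalIntegral.integral_const_mul]
    congr 1; funext x; ring
  · intro n
    apply Continuous.aestronglyMeasurable; fun_prop
  · intro n
    refine Filter.Eventually.of_forall (fun x _ => ?_)
    rw [norm_mul, norm_pow, Real.norm_eq_abs]
    gcongr
    rw [norm_mul, norm_div, norm_mul, norm_pow, norm_pow, norm_neg, norm_one, one_pow, one_mul, Real.norm_of_nonneg h0]
    rw [Real.norm_eq_abs, Real.norm_eq_abs]
    have hc := abs_cos_le_one (2 * n * x)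
    have hn : r^n / |(n:ℝ)| ≤ r^n := by
      rcases Nat.eq_zero_or_pos n with h | h
      · simp [h]
      · apply div_le_self (by positivity)
        rw [abs_of_nonneg (by positivity)]; exact_mod_cast h
    calc _ ≤ r^n * 1 := mul_le_mul hn hc (abs_nonneg _) (by positivity)
      _ = _ := mul_one _
  · refine Filter.Eventually.of_forall (fun x _ => ?_)
    exact (summable_geometric_of_lt_one h0 h1).mul_left _
  · apply Continuous.intervalIntegrable
    simp_rw [tsum_mul_left]
    fun_prop
  · refine Filter.Eventually.of_forall (fun x _ => ?_)
    apply HasSum.mul_left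
    have hz : ‖(r:ℂ) * Complex.exp (2 * x * Complex.I)‖ < 1 := by rw [norm_rexp r x h0]; exact h1
    have := Complex.hasSum_re (Complex.hasSum_taylorSeries_log hz)
    convert! this using 1
    funext n
    rw [mul_pow, ← Complex.exp_nat_mul]
    rw [show (n * (2 * x * Complex.I) : ℂ) = ((2 * n * x : ℝ):ℂ) * Complex.I by push_cast; ring]
    rw [show ((-1:ℂ)^(n+1) * ((r:ℂ)^n * Complex.exp (((2 * n * x : ℝ):ℂ) * Complex.I)) / n) = (((-1)^(n+1) * r^n / n : ℝ) : ℂ) * Complex.exp (((2 * n * x : ℝ):ℂ) * Complex.I) by push_cast; ring]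
    rw [Complex.re_ofReal_mul, Complex.exp_ofReal_mul_I_re]

lemma fourier_lim (b : ℕ) (C : ℝ) (hC : ∀ n : ℕ, |mom b n / n| ≤ C / (n:ℝ)^2) :
    ∫ x in (0:ℝ)..(π/2), x^b * (log (cos x) + log 2) = ∑' n : ℕ, (-1)^(n+1) * (mom b n / n) := by
  have hl := W_lim (fun x => ((x^b : ℝ) : ℂ)) (by fun_prop) 0 (by simp) 1 (by norm_num)
  have hi := fun r h0 h1 => W_int (fun x => ((x^b : ℝ) : ℂ)) (by fun_prop) 0 (by simp) 1 (by norm_num) r h0 h1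
  have hre := (Complex.continuous_re.tendsto _).comp hl
  have hcomm := fun r h0 h1 => Complex.reCLM.intervalIntegral_comp_comm (hi r h0 h1)
  simp only [Complex.reCLM_apply, pow_one, Complex.ofReal_zero, sub_zero, Complex.re_ofReal_mul] at hcomm
  simp only [pow_one, Complex.ofReal_zero, sub_zero] at hre
  rw [← hcomm 1 (by norm_num) le_rfl] at hre
  have h2 : Filter.Tendsto (fun r : ℝ => ∑' n : ℕ, (-1)^(n+1) * r^n / n * mom b n) (nhdsWithin 1 (Set.Iio 1)) (nhds (∑' n : ℕ, (-1)^(n+1) * (mom b n / n))) := by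
    apply tendsto_tsum_of_dominated_convergence (bound := fun n : ℕ => C / (n:ℝ)^2)
    · have := (Real.summable_one_div_nat_pow (p := 2)).2 (by norm_num)
      simpa [div_eq_mul_inv] using this.mul_left C
    · intro n
      have hc : ContinuousAt (fun r : ℝ => (-1)^(n+1) * r^n / n * mom b n) 1 := by fun_prop
      have := hc.tendsto.mono_left (nhdsWithin_le_nhds (s := Set.Iio 1))
      convert! this using 2
      simp; ring
    · filter_upwards [ev_r] with r hr n
      have e : (-1:ℝ)^(n+1) * r^n / n * mom b n = (-1:ℝ)^(n+1) * r^n * (mom b n / n) := by ring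
      rw [e, norm_mul, norm_mul, norm_pow, norm_pow, norm_neg, norm_one, one_pow, one_mul, Real.norm_eq_abs, Real.norm_eq_abs]
      rw [abs_of_nonneg (by linarith : 0 ≤ r)]
      calc _ ≤ 1 * |mom b n / n| := by
            gcongr
            exact pow_le_one₀ (by linarith) hr.2.le
        _ ≤ _ := by rw [one_mul]; exact hC n
  have h3 := h2.congr' (f₂ := (Complex.re ∘ fun r => ∫ x in (0:ℝ)..(π/2), ((x^b : ℝ) : ℂ) * WW r x)) (by
    filter_upwards [ev_r] with r hr
    simp only [Function.comp]
    rw [← hcomm r hr.1 hr.2.le]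
    exact (fourier_r b r (by linarith) hr.2).tsum_eq)
  rw [← tendsto_nhds_unique hre h3]
  apply intervalIntegral.integral_congr_ae
  filter_upwards [hae2] with x hx0 hx
  rw [Set.uIoc_of_le (by positivity)] at hx
  have hx' : x ∈ Set.Ioo 0 (π/2) := ⟨hx.1, lt_of_le_of_ne hx.2 hx0⟩
  rw [W_one hx']
  rw [Complex.add_re, Complex.add_re, Complex.ofReal_re, Complex.ofReal_re]; simp

lemma cos_nat (n : ℕ) : cos (2 * n * (π/2)) = (-1)^n := by
  rw [show 2 * (n:ℝ) * (π/2) = n * π by ring]; exact cos_nat_mul_pi n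
lemma sin_nat (n : ℕ) : sin (2 * n * (π/2)) = 0 := by
  rw [show 2 * (n:ℝ) * (π/2) = n * π by ring]; exact sin_nat_mul_pi n

lemma d_sin (n : ℕ) (x : ℝ) : HasDerivAt (fun x => sin (2 * n * x)) (cos (2 * n * x) * (2 * n)) x := by
  have := ((hasDerivAt_id x).const_mul (2 * (n:ℝ))).sin
  simpa using this
lemma d_cos (n : ℕ) (x : ℝ) : HasDerivAt (fun x => cos (2 * n * x)) (-sin (2 * n * x) * (2 * n)) x := by
  have := ((hasDerivAt_id x).const_mul (2 * (n:ℝ))).cos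
  simpa using this

lemma mom1 (n : ℕ) (hn : n ≠ 0) : mom 1 n = ((-1)^n - 1) / (4 * n^2) := by
  unfold mom
  have hn' : (n:ℝ) ≠ 0 := by exact_mod_cast hn
  rw [intervalIntegral.integral_eq_sub_of_hasDerivAt (f := fun x => x * sin (2 * n * x) / (2 * n) + cos (2 * n * x) / (4 * n^2))]
  · simp only [cos_nat, sin_nat]; simp; ring
  · intro x _
    have := (((hasDerivAt_id' x).fun_mul (d_sin n x)).div_const (2 * (n:ℝ))).fun_add ((d_cos n x).div_const (4 * (n:ℝ)^2))
    refine this.congr_deriv ?_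
    field_simp; ring
  · apply Continuous.intervalIntegrable; fun_prop

lemma mom2 (n : ℕ) (hn : n ≠ 0) : mom 2 n = π * (-1)^n / (4 * n^2) := by
  unfold mom
  have hn' : (n:ℝ) ≠ 0 := by exact_mod_cast hn
  rw [intervalIntegral.integral_eq_sub_of_hasDerivAt (f := fun x => x^2 * sin (2 * n * x) / (2 * n) + 2 * (x * cos (2 * n * x)) / (4 * n^2) - 2 * sin (2 * n * x) / (8 * n^3))]
  · simp only [cos_nat, sin_nat]; simp; field_simp
  · intro x _
    have := ((((hasDerivAt_pow 2 x).fun_mul (d_sin n x)).div_const (2 * (n:ℝ))).fun_add ((((hasDerivAt_id' x).fun_mul (d_cos n x)).const_mul 2).div_const (4 * (n:ℝ)^2))).fun_sub (((d_sin n x).const_mul 2).div_const (8 * (n:ℝ)^3))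
    refine this.congr_deriv ?_
    field_simp; push_cast; ring
  · apply Continuous.intervalIntegrable; fun_prop

lemma mom3 (n : ℕ) (hn : n ≠ 0) : mom 3 n = 3 * π^2 * (-1)^n / (16 * n^2) - 3/8 * ((-1)^n - 1) / n^4 := by
  unfold mom
  have hn' : (n:ℝ) ≠ 0 := by exact_mod_cast hn
  rw [intervalIntegral.integral_eq_sub_of_hasDerivAt (f := fun x => x^3 * sin (2 * n * x) / (2 * n) + 3 * (x^2 * cos (2 * n * x)) / (4 * n^2) - 6 * (x * sin (2 * n * x)) / (8 * n^3) - 6 * cos (2 * n * x) / (16 * n^4))]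
  · simp only [cos_nat, sin_nat]; simp; field_simp; ring
  · intro x _
    have := (((((hasDerivAt_pow 3 x).fun_mul (d_sin n x)).div_const (2 * (n:ℝ))).fun_add ((((hasDerivAt_pow 2 x).fun_mul (d_cos n x)).const_mul 3).div_const (4 * (n:ℝ)^2))).fun_sub ((((hasDerivAt_id' x).fun_mul (d_sin n x)).const_mul 6).div_const (8 * (n:ℝ)^3))).fun_sub (((d_cos n x).const_mul 6).div_const (16 * (n:ℝ)^4))
    refine this.congr_deriv ?_
    field_simp; push_cast; ring
  · apply Continuous.intervalIntegrable; fun_prop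


lemma hz (s : ℕ) (hs : 1 < s) : HasSum (fun n : ℕ => 1 / (n:ℝ)^s) (zetaVal s) := by
  have h := (Real.summable_one_div_nat_pow (p := s)).2 hs
  have h2 : HasSum (fun n : ℕ => 1 / ((n+1 : ℕ):ℝ)^s) (zetaVal s) := by
    have := ((summable_nat_add_iff 1).2 h).hasSum
    convert! this using 1
    unfold zetaVal; congr 1; funext n; push_cast; rfl
  have h3 := (hasSum_nat_add_iff (f := fun n : ℕ => 1 / (n:ℝ)^s) 1).1 h2
  have : (0:ℝ)^s = 0 := zero_pow (by omega)
  simpa [this] using h3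

lemma heta (s : ℕ) (hs : 1 < s) : HasSum (fun n : ℕ => (-1:ℝ)^(n+1) / (n:ℝ)^s) ((1 - 2 * (1/2)^s) * zetaVal s) := by
  have h := hz s hs
  have he : HasSum (fun k : ℕ => 1 / (((2 * k : ℕ) : ℝ))^s) ((1/2)^s * zetaVal s) := by
    refine (h.mul_left ((1/2:ℝ)^s)).congr_fun ?_
    intro n; push_cast; rw [mul_pow]; simp; ring
  have ho := (h.summable.comp_injective (i := fun k : ℕ => 2 * k + 1) (fun a b hab => by simpa using hab)).hasSum
  have hu := (he.even_add_odd (f := fun n : ℕ => 1 / (n:ℝ)^s) ho).unique h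
  have h1 : HasSum (fun k : ℕ => (-1:ℝ)^(2*k+1) / ((2 * k : ℕ):ℝ)^s) (-((1/2)^s * zetaVal s)) := by
    refine he.neg.congr_fun ?_
    intro n; rw [pow_succ, pow_mul]; simp [neg_div]
  have h2 : HasSum (fun k : ℕ => (-1:ℝ)^(2*k+1+1) / ((2 * k + 1 : ℕ):ℝ)^s) (zetaVal s - (1/2)^s * zetaVal s) := by
    rw [show zetaVal s - (1/2)^s * zetaVal s = _ from (eq_sub_of_add_eq' hu).symm]
    refine ho.congr_fun ?_
    intro n; simp only [Function.comp]; rw [show 2 * n + 1 + 1 = 2 * (n+1) by ring, pow_mul]; simp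
  have := HasSum.even_add_odd (f := fun n : ℕ => (-1:ℝ)^(n+1) / (n:ℝ)^s) h1 h2
  convert! this using 1; ring

lemma sgn_abs (n : ℕ) : |(-1:ℝ)^n| = 1 := by simp
lemma sgn2 (n : ℕ) : |(-1:ℝ)^n - 1| ≤ 2 := by
  rcases neg_one_pow_eq_or ℝ n with h | h <;> rw [h] <;> norm_num
lemma sgn_mul (n : ℕ) : (-1:ℝ)^(n+1) * (-1)^n = -1 := by
  rw [pow_succ, mul_right_comm, ← mul_pow]; simp

lemma A1 : ∫ x in (0:ℝ)..(π/2), x^1 * (log (cos x) + log 2) = -(7/16) * zetaVal 3 := by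
  rw [fourier_lim 1 1]
  · have := ((hz 3 (by norm_num)).add (heta 3 (by norm_num))).mul_left (-(1/4))
    rw [← (show -(1/4) * (zetaVal 3 + (1 - 2 * (1/2)^3) * zetaVal 3) = -(7/16) * zetaVal 3 by ring), ← this.tsum_eq]
    congr 1; funext n
    rcases eq_or_ne n 0 with rfl | hn
    · simp
    have hn' : (n:ℝ) ≠ 0 := by exact_mod_cast hn
    rw [mom1 n hn]
    have := sgn_mul n
    field_simp
    linear_combination this
  · intro n
    rcases eq_or_ne n 0 with rfl | hn
    · simp
    have hn' : (1:ℝ) ≤ n := by exact_mod_cast Nat.one_le_iff_ne_zero.2 hn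
    rw [mom1 n hn, div_div, abs_div, abs_of_pos (by positivity : (0:ℝ) < 4 * n^2 * n)]
    rw [div_le_div_iff₀ (by positivity) (by positivity)]
    have := sgn2 n
    nlinarith [sq_nonneg (n:ℝ), mul_le_mul_of_nonneg_left hn' (sq_nonneg (n:ℝ)), mul_le_mul_of_nonneg_right this (sq_nonneg (n:ℝ))]

lemma A2 : ∫ x in (0:ℝ)..(π/2), x^2 * (log (cos x) + log 2) = -(π/4) * zetaVal 3 := by
  rw [fourier_lim 2 1]
  · have := (hz 3 (by norm_num)).mul_left (-(π/4))
    rw [← this.tsum_eq]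
    congr 1; funext n
    rcases eq_or_ne n 0 with rfl | hn
    · simp
    have hn' : (n:ℝ) ≠ 0 := by exact_mod_cast hn
    rw [mom2 n hn]
    have := sgn_mul n
    field_simp
    linear_combination this
  · intro n
    rcases eq_or_ne n 0 with rfl | hn
    · simp
    have hn' : (1:ℝ) ≤ n := by exact_mod_cast Nat.one_le_iff_ne_zero.2 hn
    rw [mom2 n hn, div_div, abs_div, abs_of_pos (by positivity : (0:ℝ) < 4 * n^2 * n), abs_mul, sgn_abs, mul_one, abs_of_pos pi_pos]
    rw [div_le_div_iff₀ (by positivity) (by positivity)]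
    have := pi_le_four
    nlinarith [sq_nonneg (n:ℝ), mul_le_mul_of_nonneg_left hn' (sq_nonneg (n:ℝ)), mul_le_mul_of_nonneg_right this (sq_nonneg (n:ℝ))]

lemma A3 : ∫ x in (0:ℝ)..(π/2), x^3 * (log (cos x) + log 2) = -(3*π^2/16) * zetaVal 3 + 3/8*(31/16) * zetaVal 5 := by
  rw [fourier_lim 3 4]
  · have := ((hz 3 (by norm_num)).mul_left (-(3*π^2/16))).add (((hz 5 (by norm_num)).add (heta 5 (by norm_num))).mul_left (3/8))
    rw [← (show -(3*π^2/16) * zetaVal 3 + 3/8 * (zetaVal 5 + (1 - 2 * (1/2)^5) * zetaVal 5) = -(3*π^2/16) * zetaVal 3 + 3/8*(31/16) * zetaVal 5 by ring), ← this.tsum_eq]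
    congr 1; funext n
    rcases eq_or_ne n 0 with rfl | hn
    · simp
    have hn' : (n:ℝ) ≠ 0 := by exact_mod_cast hn
    rw [mom3 n hn]
    have := sgn_mul n
    field_simp
    linear_combination (n^2 * π^2 * 8 - 16) * this
  · intro n
    rcases eq_or_ne n 0 with rfl | hn
    · simp
    have hn' : (1:ℝ) ≤ n := by exact_mod_cast Nat.one_le_iff_ne_zero.2 hn
    rw [mom3 n hn]
    have hn0 : (0:ℝ) < n := by linarith
    have a1 : (n:ℝ) ≤ n^2 := by nlinarith
    have a2 : (n:ℝ) ≤ n^4 := by nlinarith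
    have p1 : π^2 ≤ 16 := by nlinarith [pi_le_four, pi_pos]
    have h1 : |3 * π^2 * (-1)^n / (16 * (n:ℝ)^2) - 3/8 * ((-1)^n - 1) / n^4| ≤ 4 / (n:ℝ) := by
      refine (abs_sub _ _).trans ?_
      rw [abs_div, abs_mul (3 * π^2), sgn_abs, mul_one, abs_div, abs_mul (3/8)]
      rw [abs_of_pos (by positivity : (0:ℝ) < 3 * π^2), abs_of_pos (by positivity : (0:ℝ) < 16 * n^2), abs_of_pos (by positivity : (0:ℝ) < n^4), abs_of_pos (by norm_num : (0:ℝ) < 3/8)]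
      have e1 : 3 * π^2 / (16 * n^2) ≤ 3 / n := by
        rw [div_le_div_iff₀ (by positivity) (by positivity)]
        nlinarith
      have e2 : 3/8 * |(-1:ℝ)^n - 1| / n^4 ≤ 1 / n := by
        rw [div_le_div_iff₀ (by positivity) (by positivity)]
        nlinarith [sgn2 n]
      have : 4 / (n:ℝ) = 3 / n + 1 / n := by ring
      linarith
    rw [abs_div, abs_of_pos hn0, div_le_iff₀ hn0]
    convert! h1 using 1
    field_simp


lemma cont_ulog (k : ℕ) : ContinuousOn (fun u : ℝ => u * log u ^ k) (Set.Ici 0) := by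
  intro u hu
  rcases eq_or_lt_of_le (show (0:ℝ) ≤ u from hu) with h | h
  · subst h
    rw [← continuousWithinAt_Ioi_iff_Ici]
    have h1 := (isLittleO_pow_log_id_atTop (n := k)).tendsto_div_nhds_zero
    have h2 := (h1.comp tendsto_inv_nhdsGT_zero).const_mul ((-1:ℝ)^k)
    unfold ContinuousWithinAt
    rw [mul_zero] at h2
    simp only [zero_mul]
    refine h2.congr (fun x => ?_)
    simp only [Function.comp, id, log_inv, div_inv_eq_mul]
    rw [← mul_assoc, ← mul_pow, neg_one_mul, neg_neg, mul_comm]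
  · apply ContinuousAt.continuousWithinAt
    have := h.ne'
    fun_prop (disch := assumption)

lemma cont_ulog_add (a : ℝ) (k : ℕ) : ContinuousOn (fun u : ℝ => u * (log u + a) ^ k) (Set.Ici 0) := by
  have h : ContinuousOn (fun u : ℝ => exp (-a) * ((exp a * u) * log (exp a * u) ^ k)) (Set.Ici 0) := by
    apply ContinuousOn.mul continuousOn_const
    refine (cont_ulog k).comp (f := fun u => exp a * u) (by fun_prop) ?_
    intro u hu
    have : (0:ℝ) ≤ u := hu
    show 0 ≤ exp a * u
    positivity
  refine h.congr (fun u hu => ?_)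
  rcases eq_or_lt_of_le (show (0:ℝ) ≤ u from hu) with h | h
  · subst h; simp
  · simp only
    rw [log_mul (exp_pos a).ne' h.ne', log_exp, ← mul_assoc, ← mul_assoc, ← exp_add]
    simp [add_comm]

noncomputable def GG (a : ℝ) (m : ℕ) (u : ℝ) : ℝ := u^m * ((log u + a)^4 - a^4)
noncomputable def AF (a : ℝ) (m : ℕ) (u : ℝ) : ℝ :=
  u^m * (u * (log u + a)^4 / (m+1) - 4 * (u * (log u + a)^3) / (m+1)^2 + 12 * (u * (log u + a)^2) / (m+1)^3
    - 24 * (u * (log u + a)^1) / (m+1)^4 + 24 * u / (m+1)^5 - a^4 * u / (m+1))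

lemma AF_cont (a : ℝ) (m : ℕ) : ContinuousOn (AF a m) (Set.Ici 0) := by
  have h4 := cont_ulog_add a 4
  have h3 := cont_ulog_add a 3
  have h2 := cont_ulog_add a 2
  have h1 := cont_ulog_add a 1
  unfold AF
  exact (continuousOn_id.pow m).mul ((((((h4.div_const _).sub ((continuousOn_const.mul h3).div_const _)).add ((continuousOn_const.mul h2).div_const _)).sub ((continuousOn_const.mul h1).div_const _)).add ((continuousOn_const.mul continuousOn_id).div_const _)).sub ((continuousOn_const.mul continuousOn_id).div_const _))

lemma AF_deriv (a : ℝ) (m : ℕ) (u : ℝ) (hu : 0 < u) : HasDerivAt (AF a m) (GG a m u) u := by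
  have hm : (m:ℝ) + 1 ≠ 0 := by positivity
  have hl : HasDerivAt (fun u => log u + a) (u⁻¹) u := (hasDerivAt_log hu.ne').add_const a
  have key : ∀ Q Q' : ℝ, HasDerivAt (fun u => u^(m+1)) ((m+1) * u^m) u := by
    intro _ _; simpa using hasDerivAt_pow (m+1) u
  have hq : HasDerivAt (fun u => (log u + a)^4 / (m+1) - 4 * (log u + a)^3 / (m+1)^2 + 12 * (log u + a)^2 / (m+1)^3
    - 24 * (log u + a) / (m+1)^4 + 24 / (m+1)^5 - a^4 / (m+1))
    ((4 * (log u + a)^3 / (m+1) - 12 * (log u + a)^2 / (m+1)^2 + 24 * (log u + a) / (m+1)^3 - 24 / (m+1)^4) * u⁻¹) u := by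
    have := (((((((hl.fun_pow 4).div_const ((m:ℝ)+1)).fun_sub (((hl.fun_pow 3).const_mul 4).div_const (((m:ℝ)+1)^2))).fun_add (((hl.fun_pow 2).const_mul 12).div_const (((m:ℝ)+1)^3))).fun_sub ((hl.const_mul 24).div_const (((m:ℝ)+1)^4))).add_const (24/((m:ℝ)+1)^5)).sub_const (a^4/((m:ℝ)+1)))
    refine this.congr_deriv ?_
    push_cast; simp; ring
  have h := (key 0 0).fun_mul hq
  have he : AF a m = fun u => u^(m+1) * ((log u + a)^4 / (m+1) - 4 * (log u + a)^3 / (m+1)^2 + 12 * (log u + a)^2 / (m+1)^3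
    - 24 * (log u + a) / (m+1)^4 + 24 / (m+1)^5 - a^4 / (m+1)) := by
    funext v; unfold AF; rw [pow_succ]; ring
  rw [he]
  refine h.congr_deriv ?_
  unfold GG
  rw [pow_succ]
  generalize log u + a = q
  field_simp
  ring

lemma GG_int (a c σ : ℝ) (hc : 0 ≤ c) (hc1 : c < 1) (hσ : σ * σ = 1) (hs : ∀ u ∈ Set.Ioo c 1, 0 ≤ σ * ((log u + a)^4 - a^4)) (m : ℕ) :
    IntervalIntegrable (GG a m) MeasureTheory.volume c 1 ∧ ∫ u in c..1, GG a m u = AF a m 1 - AF a m c := by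
  have hcont : ContinuousOn (AF a m) (Set.Icc c 1) := (AF_cont a m).mono (fun x hx => hc.trans hx.1)
  have hd : ∀ x ∈ Set.Ioo c 1, HasDerivAt (AF a m) (GG a m x) x := fun x hx => AF_deriv a m x (lt_of_le_of_lt hc hx.1)
  have hi : IntervalIntegrable (GG a m) MeasureTheory.volume c 1 := by
    have h1 := intervalIntegral.integrableOn_deriv_of_nonneg (g := fun x => σ * AF a m x) (g' := fun x => σ * GG a m x) (continuousOn_const.mul hcont)
      (fun x hx => (hd x hx).const_mul σ) (fun x hx => by
        have h0 : 0 < x := lt_of_le_of_lt hc hx.1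
        have := hs x hx
        unfold GG
        rw [mul_left_comm]; positivity)
    have h2 := (intervalIntegrable_iff_integrableOn_Ioc_of_le hc1.le).2 h1
    have h3 := h2.const_mul σ
    simp only [← mul_assoc, hσ, one_mul] at h3
    exact h3
  exact ⟨hi, intervalIntegral.integral_eq_sub_of_hasDerivAt_of_le hc1.le hcont hd hi⟩

lemma GG_sum (a c σ : ℝ) (hc : 0 ≤ c) (hc1 : c < 1) (hσ : σ * σ = 1) (hs : ∀ u ∈ Set.Ioo c 1, 0 ≤ σ * ((log u + a)^4 - a^4)) (V : ℝ)
    (hV : HasSum (fun m => AF a m 1 - AF a m c) V) : ∫ u in c..1, ((log u + a)^4 - a^4) / (1 - u) = V := by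
  have hi := fun m => GG_int a c σ hc hc1 hσ hs m
  have h1 := MeasureTheory.hasSum_integral_of_summable_integral_norm (μ := MeasureTheory.volume.restrict (Set.Ioo c 1)) (F := fun m u => GG a m u)
    (fun m => (intervalIntegrable_iff_integrableOn_Ioo_of_le hc1.le).1 (hi m).1) ?_
  · have h2 : ∀ m, ∫ u in Set.Ioo c 1, GG a m u = AF a m 1 - AF a m c := by
      intro m
      rw [← (hi m).2, intervalIntegral.integral_of_le hc1.le, MeasureTheory.integral_Ioc_eq_integral_Ioo]
    simp only [h2] at h1
    rw [hV.unique h1, intervalIntegral.integral_of_le hc1.le, MeasureTheory.integral_Ioc_eq_integral_Ioo]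
    apply MeasureTheory.setIntegral_congr_fun measurableSet_Ioo
    intro u hu
    simp only [GG]
    rw [tsum_mul_right, tsum_geometric_of_lt_one (hc.trans hu.1.le) hu.2]
    ring
  · have h3 : ∀ m, ∫ u in Set.Ioo c 1, ‖GG a m u‖ = σ * (AF a m 1 - AF a m c) := by
      intro m
      rw [← (hi m).2, intervalIntegral.integral_of_le hc1.le, MeasureTheory.integral_Ioc_eq_integral_Ioo, ← MeasureTheory.integral_const_mul]
      apply MeasureTheory.setIntegral_congr_fun measurableSet_Ioo
      intro u hu
      have h0 : 0 < u := lt_of_le_of_lt hc hu.1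
      have h4 := hs u hu
      have h5 : |σ| = 1 := by
        have : |σ| * |σ| = 1 := by rw [← abs_mul, hσ, abs_one]
        nlinarith [abs_nonneg σ]
      have : 0 ≤ σ * GG a m u := by unfold GG; rw [mul_left_comm]; positivity
      simp only
      rw [← abs_of_nonneg this, abs_mul, h5, one_mul, Real.norm_eq_abs]
    simp only [h3]
    exact hV.summable.mul_left σ

lemma hz' (s : ℕ) (hs : 1 < s) : HasSum (fun n : ℕ => 1 / ((n:ℝ)+1)^s) (zetaVal s) := by
  have h := (Real.summable_one_div_nat_pow (p := s)).2 hs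
  have := ((summable_nat_add_iff 1).2 h)
  simp only [Nat.cast_add, Nat.cast_one] at this
  exact this.hasSum

lemma AF_one (a : ℝ) : HasSum (fun m => AF a m 1) (-4 * a^3 * zetaVal 2 + 12 * a^2 * zetaVal 3 - 24 * a * zetaVal 4 + 24 * zetaVal 5) := by
  have := ((((hz' 2 (by norm_num)).mul_left (-4 * a^3)).add ((hz' 3 (by norm_num)).mul_left (12 * a^2))).sub ((hz' 4 (by norm_num)).mul_left (24 * a))).add ((hz' 5 (by norm_num)).mul_left 24)
  convert! this using 1
  funext m
  simp [AF]; ring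

lemma AF_half : HasSum (fun m => AF (log 2) m (1/2)) (24 * polyLog 5 (1/2) - log 2 ^ 5) := by
  have h1 := hasSum_pow_div_log_of_abs_lt_one (x := 1/2) (by norm_num [abs_lt])
  have h2 : HasSum (fun k : ℕ => (1/2:ℝ) ^ (k + 1) / (k + 1 : ℝ) ^ 5) (polyLog 5 (1/2)) := by
    apply Summable.hasSum
    refine Summable.of_nonneg_of_le (fun k => by positivity) (fun k => ?_) (hz' 5 (by norm_num)).summable
    gcongr
    exact pow_le_one₀ (by norm_num) (by norm_num)
  have h3 := (h2.mul_left 24).sub (h1.mul_left (log 2 ^ 4))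
  convert! h3 using 1
  · funext m
    have : log (1/2) + log 2 = 0 := by rw [one_div, log_inv]; ring
    simp only [AF, this]
    rw [pow_succ]
    ring
  · rw [show (1:ℝ) - 1/2 = 2⁻¹ by norm_num, log_inv]; ring


lemma zpos (s : ℕ) : 0 ≤ zetaVal s := tsum_nonneg (fun n => by positivity)
lemma zpos5 : 0 < zetaVal 5 := by
  apply (hz' 5 (by norm_num)).summable.tsum_pos (fun n => by positivity) 0
  norm_num

lemma neg_part : IntervalIntegrable (fR 4) MeasureTheory.volume (-1) 0 ∧
    ∫ x in (-1:ℝ)..0, fR 4 x = -(4 * log 2^3 * zetaVal 2 + 12 * log 2^2 * zetaVal 3 + 24 * log 2 * zetaVal 4 + 24 * zetaVal 5) := by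
  have hl : 0 < log 2 := log_pos (by norm_num)
  have hv : HasSum (fun m => AF (-log 2) m 1 - AF (-log 2) m 0) (4 * log 2^3 * zetaVal 2 + 12 * log 2^2 * zetaVal 3 + 24 * log 2 * zetaVal 4 + 24 * zetaVal 5) := by
    have := AF_one (-log 2)
    convert! this using 1
    · funext m; simp [AF]
    · ring
  have h := GG_sum (-log 2) 0 1 le_rfl zero_lt_one (by norm_num) (fun u hu => by
    have h1 : log u < 0 := log_neg hu.1 hu.2
    have : (1:ℝ) * ((log u + -log 2)^4 - (-log 2)^4) = (-log u)^4 + 4 * log 2 * (-log u)^3 + 6 * log 2^2 * (-log u)^2 + 4 * log 2^3 * (-log u) := by ring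
    rw [this]
    have h2 : 0 < -log u := by linarith
    positivity) _ hv
  have hi : IntervalIntegrable (fun u => ((log u + -log 2)^4 - (-log 2)^4) / (1 - u)) MeasureTheory.volume 0 1 := by
    by_contra hcon
    rw [intervalIntegral.integral_undef hcon] at h
    have := zpos 2
    have := zpos 3
    have := zpos 4
    have := zpos5
    have : 0 < 4 * log 2^3 * zetaVal 2 + 12 * log 2^2 * zetaVal 3 + 24 * log 2 * zetaVal 4 + 24 * zetaVal 5 := by positivity
    linarith
  obtain ⟨g, hg⟩ : ∃ g : ℝ → ℝ, g = fun u => ((log u + -log 2)^4 - (-log 2)^4) / (1 - u) := ⟨_, rfl⟩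
  have h' : ∫ u in (0:ℝ)..1, g u = 4 * log 2^3 * zetaVal 2 + 12 * log 2^2 * zetaVal 3 + 24 * log 2 * zetaVal 4 + 24 * zetaVal 5 := by
    rw [hg]; exact h
  rw [← hg] at hi
  have he : fR 4 = fun x => -g (1 + x) := by
    funext x
    simp only [fR, hg]
    rw [show 1 - (1 + x) = -x by ring, div_neg, neg_neg, ← sub_eq_add_neg]
  rw [he]
  constructor
  · have := (hi.comp_add_left 1).neg
    norm_num at this
    exact this
  · rw [intervalIntegral.integral_neg, intervalIntegral.integral_comp_add_left]
    norm_num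
    rw [h']; ring

noncomputable def hN (x : ℝ) : ℝ := (log (1 + x) - log 2)^4

lemma dsl {x : ℝ} (hx : x ≠ 0) : dslope hN 0 x = fR 4 x := by
  rw [dslope_of_ne _ hx, slope_def_field]
  simp [hN, fR]

lemma dsl_cont : ContinuousOn (dslope hN 0) (Set.Icc (-1/2) 1) := by
  rw [continuousOn_dslope (Icc_mem_nhds (by norm_num) (by norm_num))]
  constructor
  · intro x hx
    apply ContinuousAt.continuousWithinAt
    have : 1 + x ≠ 0 := by linarith [hx.1]
    unfold hN
    fun_prop (disch := assumption)
  · unfold hN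
    have : (1:ℝ) + 0 ≠ 0 := by norm_num
    fun_prop (disch := assumption)

lemma hae0 : ∀ᵐ x : ℝ, x ≠ 0 := by
  rw [MeasureTheory.ae_iff]; simp

lemma pos_int : IntervalIntegrable (fR 4) MeasureTheory.volume 0 1 := by
  have h : IntervalIntegrable (dslope hN 0) MeasureTheory.volume 0 1 :=
    (dsl_cont.mono (by rw [Set.uIcc_of_le zero_le_one]; exact Set.Icc_subset_Icc (by norm_num) le_rfl)).intervalIntegrable
  refine h.congr_ae ?_
  apply MeasureTheory.ae_restrict_of_ae
  filter_upwards [hae0] with x hx using dsl hx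

lemma pos_part : ∫ x in (0:ℝ)..1, fR 4 x = log 2^5/5 - 4 * log 2^3 * zetaVal 2 + 12 * log 2^2 * zetaVal 3 - 24 * log 2 * zetaVal 4 + 24 * zetaVal 5 - 24 * polyLog 5 (1/2) := by
  have hl : 0 < log 2 := log_pos (by norm_num)
  have hl2 : log (1/2) + log 2 = 0 := by rw [one_div, log_inv]; ring
  have hv := (AF_one (log 2)).sub AF_half
  have h := GG_sum (log 2) (1/2) (-1) (by norm_num) (by norm_num) (by norm_num) (fun u hu => by
    have h1 : log u < 0 := log_neg (by linarith [hu.1]) hu.2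
    have h2 : log (1/2) < log u := log_lt_log (by norm_num) hu.1
    have h3 : 0 ≤ log u + log 2 := by linarith
    have : (log u + log 2)^4 ≤ log 2^4 := by gcongr; linarith
    linarith) _ hv
  have hI1 : ∫ u in (1/2:ℝ)..1, ((log u + log 2)^4 - log 2^4) / u = log 2^5/5 - log 2^5 := by
    rw [intervalIntegral.integral_eq_sub_of_hasDerivAt (f := fun u => (log u + log 2)^5/5 - log 2^4 * log u)]
    · simp only [hl2, log_one]
      rw [one_div, log_inv]; ring
    · intro u hu
      rw [Set.uIcc_of_le (by norm_num)] at hu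
      have h0 : u ≠ 0 := by linarith [hu.1]
      have := ((((hasDerivAt_log h0).add_const (log 2)).fun_pow 5).div_const 5).fun_sub ((hasDerivAt_log h0).const_mul (log 2^4))
      refine this.congr_deriv ?_
      field_simp; norm_num; ring
    · apply ContinuousOn.intervalIntegrable
      intro u hu
      rw [Set.uIcc_of_le (by norm_num)] at hu
      have h0 : u ≠ 0 := by linarith [hu.1]
      apply ContinuousAt.continuousWithinAt
      fun_prop (disch := assumption)
  have hc1 : IntervalIntegrable (fun u => ((log u + log 2)^4 - log 2^4) / u) MeasureTheory.volume (1/2) 1 := by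
    apply ContinuousOn.intervalIntegrable
    intro u hu
    rw [Set.uIcc_of_le (by norm_num)] at hu
    have h0 : u ≠ 0 := by linarith [hu.1]
    apply ContinuousAt.continuousWithinAt
    fun_prop (disch := assumption)
  have hmaps : (fun u : ℝ => 1/u - 1) '' Set.uIcc (1/2) 1 ⊆ Set.Icc (-1/2) 1 := by
    rintro _ ⟨u, hu, rfl⟩
    rw [Set.uIcc_of_le (by norm_num)] at hu
    have h0 : 0 < u := by linarith [hu.1]
    have h1 : 1 ≤ 1/u := by rw [le_div_iff₀ h0]; linarith [hu.2]
    have h2 : 1/u ≤ 2 := by rw [div_le_iff₀ h0]; linarith [hu.1]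
    constructor <;> simp only <;> linarith
  have hfc : ContinuousOn (fun u : ℝ => 1/u - 1) (Set.uIcc (1/2) 1) := by
    intro u hu
    rw [Set.uIcc_of_le (by norm_num)] at hu
    have h0 : u ≠ 0 := by linarith [hu.1]
    apply ContinuousAt.continuousWithinAt
    fun_prop (disch := assumption)
  have hfc' : ContinuousOn (fun u : ℝ => -(1/u^2)) (Set.uIcc (1/2) 1) := by
    intro u hu
    rw [Set.uIcc_of_le (by norm_num)] at hu
    have h0 : u^2 ≠ 0 := by have : u ≠ 0 := by linarith [hu.1]
                            positivity
    apply ContinuousAt.continuousWithinAt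
    fun_prop (disch := assumption)
  have hsub := intervalIntegral.integral_comp_mul_deriv'' (a := 1/2) (b := 1) (f := fun u : ℝ => 1/u - 1) (f' := fun u => -(1/u^2)) (g := dslope hN 0) hfc (by
      intro u hu
      have h0 : u ≠ 0 := by
        have := hu.1
        norm_num at this
        linarith
      have := ((hasDerivAt_inv h0).sub_const 1).hasDerivWithinAt (s := Set.Ioi u)
      simpa [one_div] using this) hfc' (dsl_cont.mono hmaps)
  have hci : IntervalIntegrable (fun u => (dslope hN 0 ∘ fun u : ℝ => 1/u - 1) u * -(1/u^2)) MeasureTheory.volume (1/2) 1 := by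
    apply ContinuousOn.intervalIntegrable
    exact (dsl_cont.comp hfc (Set.mapsTo_iff_image_subset.2 hmaps)).mul hfc'
  have hsub2 : ∫ u in (1/2:ℝ)..1, (dslope hN 0 ∘ fun u : ℝ => 1/u - 1) u * -(1/u^2) = -∫ x in (0:ℝ)..1, dslope hN 0 x := by
    refine hsub.trans ?_
    rw [← intervalIntegral.integral_symm]; norm_num
  have hneg : IntervalIntegrable (fun u => -((dslope hN 0 ∘ fun u : ℝ => 1/u - 1) u * -(1/u^2))) MeasureTheory.volume (1/2) 1 := hci.neg
  have hD : ∫ x in (0:ℝ)..1, fR 4 x = ∫ x in (0:ℝ)..1, dslope hN 0 x := by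
    apply intervalIntegral.integral_congr_ae
    filter_upwards [hae0] with x hx _ using (dsl hx).symm
  have hsplit : ∫ u in (1/2:ℝ)..1, ((log u + log 2)^4 - log 2^4) / (1 - u) = ∫ u in (1/2:ℝ)..1, (-((dslope hN 0 ∘ fun u : ℝ => 1/u - 1) u * -(1/u^2)) - ((log u + log 2)^4 - log 2^4) / u) := by
    rw [intervalIntegral.integral_of_le (by norm_num), intervalIntegral.integral_of_le (by norm_num), MeasureTheory.integral_Ioc_eq_integral_Ioo, MeasureTheory.integral_Ioc_eq_integral_Ioo]
    apply MeasureTheory.setIntegral_congr_fun measurableSet_Ioo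
    intro u hu
    have h0 : 0 < u := by linarith [hu.1]
    have h1 : 0 < 1 - u := by linarith [hu.2]
    have h2 : 1/u - 1 ≠ 0 := by
      have : 1/u - 1 = (1-u)/u := by field_simp
      rw [this]; positivity
    simp only [Function.comp]
    rw [dsl h2]
    simp only [fR]
    rw [show 1 + (1/u - 1) = u⁻¹ by ring, log_inv, show 1/u - 1 = (1-u)/u by field_simp]
    generalize log u = q
    field_simp
    ring
  rw [hsplit, intervalIntegral.integral_sub hneg hc1, intervalIntegral.integral_neg, hI1, hsub2] at h
  rw [hD]
  linarith

lemma J_lim : Filter.Tendsto (fun r => ∫ x in (-r)..r, fR 4 x) (nhdsWithin 1 (Set.Iio 1)) (nhds (log 2^5/5 - 8 * log 2^3 * zetaVal 2 - 48 * log 2 * zetaVal 4 - 24 * polyLog 5 (1/2))) := by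
  have hi := neg_part.1.trans pos_int
  have hc := intervalIntegral.continuousOn_primitive_interval' hi (a := 0) (by rw [Set.uIcc_of_le (by norm_num)]; norm_num)
  rw [Set.uIcc_of_le (by norm_num)] at hc
  have ht1 : Filter.Tendsto (fun r : ℝ => r) (nhdsWithin 1 (Set.Iio 1)) (nhdsWithin 1 (Set.Icc (-1) 1)) := by
    refine tendsto_nhdsWithin_iff.2 ⟨nhdsWithin_le_nhds, ?_⟩
    filter_upwards [ev_r] with r hr
    exact ⟨by linarith, by linarith⟩
  have ht2 : Filter.Tendsto (fun r : ℝ => -r) (nhdsWithin 1 (Set.Iio 1)) (nhdsWithin (-1) (Set.Icc (-1) 1)) := by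
    refine tendsto_nhdsWithin_iff.2 ⟨(continuous_neg.tendsto (1:ℝ)).mono_left nhdsWithin_le_nhds, ?_⟩
    filter_upwards [ev_r] with r hr
    exact ⟨by linarith, by linarith⟩
  have h1 := (hc 1 (by norm_num)).tendsto.comp ht1
  have h2 := (hc (-1) (by norm_num)).tendsto.comp ht2
  have h3 := h1.sub h2
  rw [pos_part, intervalIntegral.integral_symm, neg_part.2] at h3
  rw [show log 2^5/5 - 8 * log 2^3 * zetaVal 2 - 48 * log 2 * zetaVal 4 - 24 * polyLog 5 (1/2) = log 2^5/5 - 4 * log 2^3 * zetaVal 2 + 12 * log 2^2 * zetaVal 3 - 24 * log 2 * zetaVal 4 + 24 * zetaVal 5 - 24 * polyLog 5 (1/2) - - -(4 * log 2^3 * zetaVal 2 + 12 * log 2^2 * zetaVal 3 + 24 * log 2 * zetaVal 4 + 24 * zetaVal 5) by ring]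
  refine h3.congr' ?_
  filter_upwards [ev_r] with r hr
  simp only [Function.comp]
  have i1 : IntervalIntegrable (fR 4) MeasureTheory.volume 0 r := hi.mono_set (by
    rw [Set.uIcc_of_le (by linarith), Set.uIcc_of_le (by norm_num)]; exact Set.Icc_subset_Icc (by norm_num) hr.2.le)
  have i2 : IntervalIntegrable (fR 4) MeasureTheory.volume 0 (-r) := hi.mono_set (by
    rw [Set.uIcc_of_ge (by linarith), Set.uIcc_of_le (by norm_num)]; exact Set.Icc_subset_Icc (by linarith) (by norm_num))
  rw [intervalIntegral.integral_interval_sub_left i1 i2]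



lemma cI (b n : ℕ) (hn : n ≤ 4) : IntervalIntegrable (fun x : ℝ => x^b * log (cos x)^n) MeasureTheory.volume 0 (π/2) :=
  cosInt (fun x => x^b) (by fun_prop) n hn

lemma cI1 (b : ℕ) : IntervalIntegrable (fun x : ℝ => x^b * log (cos x)) MeasureTheory.volume 0 (π/2) := by
  simpa only [pow_one] using cI b 1 (by norm_num)

lemma Eb (b : ℕ) : ∫ x in (0:ℝ)..(π/2), x^b * log (cos x) = (∫ x in (0:ℝ)..(π/2), x^b * (log (cos x) + log 2)) - log 2 * ((π/2)^(b+1) / (b+1)) := by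
  have h2 : IntervalIntegrable (fun x : ℝ => x^b * log 2) MeasureTheory.volume 0 (π/2) := by
    apply Continuous.intervalIntegrable; fun_prop
  simp only [mul_add]
  rw [intervalIntegral.integral_add (cI1 b) h2, intervalIntegral.integral_mul_const, integral_pow]
  simp; ring

lemma E0 : ∫ x in (0:ℝ)..(π/2), log (cos x) = -log 2 * π / 2 := by
  rw [← integral_log_sin_zero_pi_div_two]
  have := intervalIntegral.integral_comp_sub_left (a := 0) (b := π/2) (fun x => log (sin x)) (π/2)
  simp only [sin_pi_div_two_sub, sub_self, sub_zero] at this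
  exact this

lemma refl_int : ∫ x in Set.Ioo 0 (π/2), (x * log (sin x)^3 + x^3 * log (sin x)) =
    ∫ x in (0:ℝ)..(π/2), ((π/2 - x) * log (cos x)^3 + (π/2 - x)^3 * log (cos x)) := by
  rw [← MeasureTheory.integral_Ioc_eq_integral_Ioo, ← intervalIntegral.integral_of_le (by positivity)]
  have := intervalIntegral.integral_comp_sub_left (a := 0) (b := π/2) (fun x => x * log (sin x)^3 + x^3 * log (sin x)) (π/2)
  simp only [sin_pi_div_two_sub, sub_self, sub_zero] at this
  exact this.symm

lemma main_int : ∫ x in Set.Ioo 0 (π/2), (x * log (sin x)^3 + x^3 * log (sin x)) =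
    π/2 * (∫ x in (0:ℝ)..(π/2), x^0 * log (cos x)^3) - (∫ x in (0:ℝ)..(π/2), x^1 * log (cos x)^3)
    + (π/2)^3 * (∫ x in (0:ℝ)..(π/2), x^0 * log (cos x)) - 3 * (π/2)^2 * (∫ x in (0:ℝ)..(π/2), x^1 * log (cos x))
    + 3 * (π/2) * (∫ x in (0:ℝ)..(π/2), x^2 * log (cos x)) - (∫ x in (0:ℝ)..(π/2), x^3 * log (cos x)) := by
  rw [refl_int]
  have a0 := (cI 0 3 (by norm_num)).const_mul (π/2)
  have a1 := cI 1 3 (by norm_num)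
  have b0 := (cI1 0).const_mul ((π/2)^3)
  have b1 := (cI1 1).const_mul (3 * (π/2)^2)
  have b2 := (cI1 2).const_mul (3 * (π/2))
  have b3 := cI1 3
  rw [← intervalIntegral.integral_const_mul, ← intervalIntegral.integral_const_mul, ← intervalIntegral.integral_const_mul, ← intervalIntegral.integral_const_mul]
  have s1 := a0.sub a1
  have s2 := s1.add b0
  have s3 := s2.sub b1
  have s4 := s3.add b2
  rw [← intervalIntegral.integral_sub a0 a1, ← intervalIntegral.integral_add s1 b0, ← intervalIntegral.integral_sub s2 b1, ← intervalIntegral.integral_add s3 b2, ← intervalIntegral.integral_sub s4 b3]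
  congr 1; funext x; ring

lemma C3 : ∫ x in (0:ℝ)..(π/2), x^0 * log (cos x)^3 = 3 * (∫ x in (0:ℝ)..(π/2), x^2 * log (cos x)) - log 2^3 * (π/2) := by
  have h := int_n3
  have e := intervalIntegral.integral_sub (cI 0 3 (by norm_num)) ((cI1 2).const_mul 3)
  rw [intervalIntegral.integral_const_mul] at e
  have : ∫ x in (0:ℝ)..(π/2), (log (cos x) ^ 3 - 3 * x^2 * log (cos x)) = ∫ x in (0:ℝ)..(π/2), (x^0 * log (cos x)^3 - 3 * (x^2 * log (cos x))) := by
    congr 1; funext x; ring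
  rw [this, e] at h
  linarith

lemma X3 : ∫ x in (0:ℝ)..(π/2), x^1 * log (cos x)^3 = (log 2^5/5 - 8 * log 2^3 * zetaVal 2 - 48 * log 2 * zetaVal 4 - 24 * polyLog 5 (1/2)) / 8 + ∫ x in (0:ℝ)..(π/2), x^3 * log (cos x) := by
  have h := int_n4 _ J_lim
  rw [intervalIntegral.integral_const_mul] at h
  have e := intervalIntegral.integral_sub (cI 1 3 (by norm_num)) (cI1 3)
  have : ∫ x in (0:ℝ)..(π/2), (x * log (cos x) ^ 3 - x^3 * log (cos x)) = ∫ x in (0:ℝ)..(π/2), (x^1 * log (cos x)^3 - x^3 * log (cos x)) := by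
    congr 1; funext x; ring
  rw [this, e] at h
  linarith

lemma z2 : zetaVal 2 = π^2/6 := (hz 2 (by norm_num)).unique hasSum_zeta_two
lemma z4 : zetaVal 4 = π^4/90 := (hz 4 (by norm_num)).unique hasSum_zeta_four

theorem stmt_1 :
    ∑' k : ℕ, (4 : ℝ) ^ (k + 1) * genHarmonic (k + 1) 2 /
      ((k + 1 : ℝ) ^ 3 * (Nat.choose (2 * (k + 1)) (k + 1) : ℝ))
    = 31 / 4 * zetaVal 5 + 3 / 2 * zetaVal 2 * zetaVal 3 - 16 * polyLog 5 (1 / 2)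
      - 2 * Real.log 2 * zetaVal 4 + 8 / 3 * Real.log 2 ^ 3 * zetaVal 2 + 2 / 15 * Real.log 2 ^ 5 := by
  have hS := series_eq.tsum_eq
  have e : ∀ k : ℕ, (4 : ℝ) ^ (k + 1) * genHarmonic (k + 1) 2 /
      ((k + 1 : ℝ) ^ 3 * (Nat.choose (2 * (k + 1)) (k + 1) : ℝ)) = aC k * hh (k+1) / (k+1) := by
    intro k
    have hh1 : genHarmonic (k+1) 2 = hh (k+1) := rfl
    rw [hh1, aC]
    have h1 : (Nat.choose (2 * (k + 1)) (k + 1) : ℝ) ≠ 0 := by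
      exact_mod_cast (Nat.choose_pos (by omega)).ne'
    have h2 : (k:ℝ) + 1 ≠ 0 := by positivity
    field_simp
  simp only [e]
  rw [hS, main_int, X3, C3, Eb 3, Eb 2, Eb 1, A3, A2, A1]
  simp only [pow_zero, one_mul]
  rw [E0, z2, z4]
  push_cast
  ring
end
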